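/- Let D₁ ⊆ B(H₁) and D₂ ⊆ B(H₂) be masas on separable Hilbert spaces, let r, l₁, …, l_r ∈ ℕ, let {B_j^i}_{j=1}^{l_i} be masa-bimodules of finite width in B(H₁,H₂), and let U_i ⊆ B(K₁,K₂) be a weak* closed subspace, for i = 1, …, r. Set B^i = ∩_{j=1}^{l_i} B_j^i. Then the intersection, over all choices of indices j₁ ∈ {1,…,l₁}, …, j_r ∈ {1,…,l_r}, of the weak* closures cl(B_{j₁}^1 ⊗̄ U₁ + ⋯ + B_{j_r}^r ⊗̄ U_r) equals cl(B^1 ⊗̄ U₁ + ⋯ + B^r ⊗̄ U_r), where cl denotes weak* closure. -/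

import Mathlib

open scoped ComplexInnerProductSpace Pointwise
open Set MeasureTheory

noncomputable section

namespace OpSynth

/-! ### The σ-weak (weak*) topology on `B(H,K)` -/

/-- The σ-weak (weak*) topology on the space of bounded operators between Hilbert
spaces: the initial topology with respect to the functionals
`T ↦ ∑' n, ⟪η n, T (ξ n)⟫` associated to square-summable sequences `ξ`, `η`.
This is the weak* topology arising from the identification of `B(H,K)` with the
dual of the trace class operators. -/
def sigmaWeak (H K : Type*) [NormedAddCommGroup H] [InnerProductSpace ℂ H]
    [NormedAddCommGroup K] [InnerProductSpace ℂ K] :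
    TopologicalSpace (H →L[ℂ] K) :=
  ⨅ (ξ : ℕ → H) (η : ℕ → K) (_ : Summable fun n => ‖ξ n‖ ^ 2)
    (_ : Summable fun n => ‖η n‖ ^ 2),
    TopologicalSpace.induced
      (fun T : H →L[ℂ] K => ∑' n, ⟪η n, T (ξ n)⟫) inferInstance

section Basic

variable {H K H₁ H₂ H₃ K₁ K₂ T₁ T₂ : Type*}
  [NormedAddCommGroup H] [InnerProductSpace ℂ H]
  [NormedAddCommGroup K] [InnerProductSpace ℂ K]
  [NormedAddCommGroup H₁] [InnerProductSpace ℂ H₁]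
  [NormedAddCommGroup H₂] [InnerProductSpace ℂ H₂]
  [NormedAddCommGroup H₃] [InnerProductSpace ℂ H₃]
  [NormedAddCommGroup K₁] [InnerProductSpace ℂ K₁]
  [NormedAddCommGroup K₂] [InnerProductSpace ℂ K₂]
  [NormedAddCommGroup T₁] [InnerProductSpace ℂ T₁]
  [NormedAddCommGroup T₂] [InnerProductSpace ℂ T₂]

/-- A set of operators is weak* closed if it is closed in the σ-weak topology. -/
def WkClosed (S : Set (H →L[ℂ] K)) : Prop :=
  @IsClosed _ (sigmaWeak H K) S

/-- The weak* closure of a set of operators. -/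
def wkClosure (S : Set (H →L[ℂ] K)) : Set (H →L[ℂ] K) :=
  @closure _ (sigmaWeak H K) S

/-- A weak* closed (linear) subspace of `B(H,K)`. -/
def IsWkClosedSubspace (S : Set (H →L[ℂ] K)) : Prop :=
  (∃ M : Submodule ℂ (H →L[ℂ] K), (M : Set (H →L[ℂ] K)) = S) ∧ WkClosed S

/-- A map between operator spaces is weak* continuous if it is continuous with
respect to the σ-weak topologies. -/
def WkContinuous (φ : (H₁ →L[ℂ] H₂) → (K₁ →L[ℂ] K₂)) : Prop :=
  @Continuous _ _ (sigmaWeak H₁ H₂) (sigmaWeak K₁ K₂) φ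

/-- The norm of an `n × n` matrix of operators, viewed as an operator on the
column Hilbert space `ℓ²(Fin n, H)`: the supremum over the unit ball of the
ℓ²-norm of the image. -/
def blockNorm {n : ℕ} (M : Matrix (Fin n) (Fin n) (H →L[ℂ] K)) : ℝ :=
  sSup { r | ∃ v : Fin n → H, (∑ j, ‖v j‖ ^ 2) ≤ 1 ∧
    r = Real.sqrt (∑ i, ‖∑ j, M i j (v j)‖ ^ 2) }

/-- A map `φ : B(H₁,H₂) → B(K₁,K₂)` is completely bounded if its matrix
amplifications are uniformly bounded. -/
def CompletelyBounded (φ : (H₁ →L[ℂ] H₂) → (K₁ →L[ℂ] K₂)) : Prop :=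
  ∃ C : ℝ, 0 ≤ C ∧ ∀ (n : ℕ) (M : Matrix (Fin n) (Fin n) (H₁ →L[ℂ] H₂)),
    blockNorm (M.map φ) ≤ C * blockNorm M

/-- `t : H → K → T₁` realizes `T₁` as the Hilbertian tensor product `H ⊗ K`:
`t` is bilinear, multiplicative for inner products, and has total range. -/
def IsTensorEmbedding (t : H → K → T₁) : Prop :=
  (∀ x x' y, t (x + x') y = t x y + t x' y) ∧
  (∀ x y y', t x (y + y') = t x y + t x y') ∧
  (∀ (c : ℂ) x y, t (c • x) y = c • t x y) ∧
  (∀ (c : ℂ) x y, t x (c • y) = c • t x y) ∧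
  (∀ x x' y y', ⟪t x y, t x' y'⟫ = ⟪x, x'⟫ * ⟪y, y'⟫) ∧
  (Submodule.span ℂ { z | ∃ x y, z = t x y }).topologicalClosure = ⊤

/-- `W` is the elementary tensor `S ⊗ R` of the operators `S` and `R`, relative
to the tensor product realizations `t₁`, `t₂`. -/
def IsElemTensor (t₁ : H₁ → K₁ → T₁) (t₂ : H₂ → K₂ → T₂)
    (W : T₁ →L[ℂ] T₂) (S : H₁ →L[ℂ] H₂) (R : K₁ →L[ℂ] K₂) : Prop :=
  ∀ x y, W (t₁ x y) = t₂ (S x) (R y)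

/-- The weak* closed tensor product `V ⊗̄ U`: the weak* closed subspace generated
by the elementary tensors `S ⊗ R` with `S ∈ V`, `R ∈ U`. -/
def wTensor (t₁ : H₁ → K₁ → T₁) (t₂ : H₂ → K₂ → T₂)
    (V : Set (H₁ →L[ℂ] H₂)) (U : Set (K₁ →L[ℂ] K₂)) : Set (T₁ →L[ℂ] T₂) :=
  wkClosure ↑(Submodule.span ℂ
    { W : T₁ →L[ℂ] T₂ | ∃ S ∈ V, ∃ R ∈ U, IsElemTensor t₁ t₂ W S R })

/-- The Fubini product `F(V,U) = (V ⊗̄ B(K₁,K₂)) ∩ (B(H₁,H₂) ⊗̄ U)`. -/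
def Fubini (t₁ : H₁ → K₁ → T₁) (t₂ : H₂ → K₂ → T₂)
    (V : Set (H₁ →L[ℂ] H₂)) (U : Set (K₁ →L[ℂ] K₂)) : Set (T₁ →L[ℂ] T₂) :=
  wTensor t₁ t₂ V univ ∩ wTensor t₁ t₂ univ U

/-- Sum of finitely many subsets of an additive monoid. -/
def setSum {α : Type*} [AddCommMonoid α] {n : ℕ} (S : Fin n → Set α) : Set α :=
  { x | ∃ f : Fin n → α, (∀ i, f i ∈ S i) ∧ x = ∑ i, f i }

/-- The reflexive hull `Ref W = {T : Tx ∈ closure (W x) for all x}`. -/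
def RefHull (W : Set (H →L[ℂ] K)) : Set (H →L[ℂ] K) :=
  { T | ∀ x : H, T x ∈ closure ((fun S : H →L[ℂ] K => S x) '' W) }

end Basic

/-- Property `S_σ`: `F(V,U) = V ⊗̄ U` for every weak* closed subspace `U` of
`B(K₁,K₂)`, all Hilbert spaces `K₁`, `K₂`, and all realizations of the
corresponding Hilbertian tensor products. -/
def HasSsigma {H₁ H₂ : Type*}
    [NormedAddCommGroup H₁] [InnerProductSpace ℂ H₁]
    [NormedAddCommGroup H₂] [InnerProductSpace ℂ H₂]
    (V : Set (H₁ →L[ℂ] H₂)) : Prop :=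
  ∀ (K₁ K₂ T₁ T₂ : Type)
    [NormedAddCommGroup K₁] [InnerProductSpace ℂ K₁] [CompleteSpace K₁]
    [NormedAddCommGroup K₂] [InnerProductSpace ℂ K₂] [CompleteSpace K₂]
    [NormedAddCommGroup T₁] [InnerProductSpace ℂ T₁] [CompleteSpace T₁]
    [NormedAddCommGroup T₂] [InnerProductSpace ℂ T₂] [CompleteSpace T₂]
    (t₁ : H₁ → K₁ → T₁) (t₂ : H₂ → K₂ → T₂),
    IsTensorEmbedding t₁ → IsTensorEmbedding t₂ →
    ∀ U : Set (K₁ →L[ℂ] K₂), IsWkClosedSubspace U →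
      Fubini t₁ t₂ V U = wTensor t₁ t₂ V U

section Masa

variable {H H₁ H₂ H₃ : Type*}
  [NormedAddCommGroup H] [InnerProductSpace ℂ H] [CompleteSpace H]
  [NormedAddCommGroup H₁] [InnerProductSpace ℂ H₁] [CompleteSpace H₁]
  [NormedAddCommGroup H₂] [InnerProductSpace ℂ H₂] [CompleteSpace H₂]
  [NormedAddCommGroup H₃] [InnerProductSpace ℂ H₃] [CompleteSpace H₃]

/-- A masa: a maximal abelian selfadjoint subalgebra of `B(H)`. -/
def IsMasa (D : StarSubalgebra ℂ (H →L[ℂ] H)) : Prop :=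
  (∀ a ∈ D, ∀ b ∈ D, a * b = b * a) ∧
  ∀ E : StarSubalgebra ℂ (H →L[ℂ] H),
    (∀ a ∈ E, ∀ b ∈ E, a * b = b * a) → D ≤ E → E = D

/-- A (weak* closed) `D₂,D₁`-masa-bimodule. -/
def IsMasaBimodule (D₁ : StarSubalgebra ℂ (H₁ →L[ℂ] H₁))
    (D₂ : StarSubalgebra ℂ (H₂ →L[ℂ] H₂)) (V : Set (H₁ →L[ℂ] H₂)) : Prop :=
  IsWkClosedSubspace V ∧
  ∀ X ∈ V, ∀ A ∈ D₁, ∀ B ∈ D₂, B ∘L X ∘L A ∈ V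

/-- A ternary set of operators: closed under the triple product `T S* R`. -/
def IsTernary (M : Set (H₁ →L[ℂ] H₂)) : Prop :=
  ∀ T ∈ M, ∀ S ∈ M, ∀ R ∈ M, T ∘L (ContinuousLinearMap.adjoint S) ∘L R ∈ M

/-- An orthogonal projection. -/
def IsProj (p : H →L[ℂ] H) : Prop := p ∘L p = p ∧ IsSelfAdjoint p

/-- A minimal non-zero projection of a masa. -/
def IsMinimalProjOf (D : StarSubalgebra ℂ (H →L[ℂ] H)) (p : H →L[ℂ] H) : Prop :=
  p ∈ D ∧ IsProj p ∧ p ≠ 0 ∧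
    ∀ q ∈ D, IsProj q → p ∘L q = q → q = 0 ∨ q = p

/-- A projection in a masa is non-atomic if it dominates no minimal non-zero
projection of the masa. -/
def IsNonAtomicProj (D : StarSubalgebra ℂ (H →L[ℂ] H)) (E : H →L[ℂ] H) : Prop :=
  ∀ p, IsMinimalProjOf D p → ¬ (E ∘L p = p)

/-- A `D₂,D₁`-masa-bimodule map. -/
def IsMasaBimoduleMap (D₁ : StarSubalgebra ℂ (H₁ →L[ℂ] H₁))
    (D₂ : StarSubalgebra ℂ (H₂ →L[ℂ] H₂))
    (φ : (H₁ →L[ℂ] H₂) → (H₁ →L[ℂ] H₂)) : Prop :=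
  ∀ (X : H₁ →L[ℂ] H₂), ∀ A ∈ D₁, ∀ B ∈ D₂,
    φ (B ∘L X ∘L A) = B ∘L (φ X) ∘L A

/-- A Schur idempotent: a weak* continuous completely bounded idempotent
masa-bimodule map. -/
def IsSchurIdempotent (D₁ : StarSubalgebra ℂ (H₁ →L[ℂ] H₁))
    (D₂ : StarSubalgebra ℂ (H₂ →L[ℂ] H₂))
    (φ : (H₁ →L[ℂ] H₂) → (H₁ →L[ℂ] H₂)) : Prop :=
  IsLinearMap ℂ φ ∧ WkContinuous φ ∧ CompletelyBounded φ ∧ φ ∘ φ = φ ∧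
    IsMasaBimoduleMap D₁ D₂ φ

/-- A nest: a totally ordered family of closed subspaces containing the
intersection and the closed linear span of any of its subsets. -/
def IsNest (N : Set (Submodule ℂ H)) : Prop :=
  (∀ p ∈ N, IsClosed (p : Set H)) ∧ IsChain (· ≤ ·) N ∧
  ∀ S : Set (Submodule ℂ H), S ⊆ N →
    sInf S ∈ N ∧ (sSup S).topologicalClosure ∈ N

/-- The nest algebra of a nest: all operators leaving each subspace invariant. -/
def nestAlg (N : Set (Submodule ℂ H)) : Set (H →L[ℂ] H) :=
  { T | ∀ p ∈ N, ∀ x ∈ p, T x ∈ p }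

/-- A (weak* closed) nest algebra bimodule. -/
def IsNestBimodule (V : Set (H₁ →L[ℂ] H₂)) : Prop :=
  IsWkClosedSubspace V ∧
  ∃ (N₁ : Set (Submodule ℂ H₁)) (N₂ : Set (Submodule ℂ H₂)),
    IsNest N₁ ∧ IsNest N₂ ∧
    ∀ X ∈ V, ∀ A ∈ nestAlg N₁, ∀ B ∈ nestAlg N₂, B ∘L X ∘L A ∈ V

/-- A masa-bimodule of finite width: a finite intersection of masa-bimodules
each of which is a nest algebra bimodule. -/
def HasFiniteWidth (D₁ : StarSubalgebra ℂ (H₁ →L[ℂ] H₁))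
    (D₂ : StarSubalgebra ℂ (H₂ →L[ℂ] H₂)) (V : Set (H₁ →L[ℂ] H₂)) : Prop :=
  ∃ (k : ℕ) (Vs : Fin k → Set (H₁ →L[ℂ] H₂)),
    (∀ j, IsMasaBimodule D₁ D₂ (Vs j) ∧ IsNestBimodule (Vs j)) ∧
    V = ⋂ j, Vs j

end Masa

section Algebras

variable {H H₁ H₂ H₃ K : Type*}
  [NormedAddCommGroup H] [InnerProductSpace ℂ H] [CompleteSpace H]
  [NormedAddCommGroup H₁] [InnerProductSpace ℂ H₁] [CompleteSpace H₁]
  [NormedAddCommGroup H₂] [InnerProductSpace ℂ H₂] [CompleteSpace H₂]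
  [NormedAddCommGroup H₃] [InnerProductSpace ℂ H₃] [CompleteSpace H₃]

/-- A weak* closed unital operator algebra in `B(H)`. -/
def IsWkClosedUnitalAlg (A : Set (H →L[ℂ] H)) : Prop :=
  IsWkClosedSubspace A ∧ (1 : H →L[ℂ] H) ∈ A ∧ ∀ a ∈ A, ∀ b ∈ A, a ∘L b ∈ A

/-- `[X Y]`: the weak* closed linear span of the products `x ∘ y`. -/
def mulSpan (X : Set (H₂ →L[ℂ] H₃)) (Y : Set (H₁ →L[ℂ] H₂)) :
    Set (H₁ →L[ℂ] H₃) :=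
  wkClosure ↑(Submodule.span ℂ { T : H₁ →L[ℂ] H₃ | ∃ x ∈ X, ∃ y ∈ Y, T = x ∘L y })

/-- The data witnessing a spatial embedding of `A` into `B`. -/
def SpatialPair (A : Set (H₁ →L[ℂ] H₁)) (B : Set (H₂ →L[ℂ] H₂))
    (X : Set (H₁ →L[ℂ] H₂)) (Y : Set (H₂ →L[ℂ] H₁)) : Prop :=
  IsWkClosedSubspace X ∧ IsWkClosedSubspace Y ∧
  (∀ x ∈ X, ∀ b ∈ B, ∀ a ∈ A, b ∘L x ∘L a ∈ X) ∧
  (∀ y ∈ Y, ∀ a ∈ A, ∀ b ∈ B, a ∘L y ∘L b ∈ Y) ∧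
  mulSpan X Y ⊆ B ∧ mulSpan Y X = A

/-- `A` is spatially embedded in `B`. -/
def SpatiallyEmbedded (A : Set (H₁ →L[ℂ] H₁)) (B : Set (H₂ →L[ℂ] H₂)) : Prop :=
  ∃ X Y, SpatialPair A B X Y

/-- `A` and `B` are spatially Morita equivalent. -/
def SpatiallyMorita (A : Set (H₁ →L[ℂ] H₁)) (B : Set (H₂ →L[ℂ] H₂)) : Prop :=
  ∃ X Y, SpatialPair A B X Y ∧ mulSpan X Y = B

/-- The strong operator topology on `B(H,K)`. -/
def sot (H K : Type*) [NormedAddCommGroup H] [InnerProductSpace ℂ H]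
    [NormedAddCommGroup K] [InnerProductSpace ℂ K] :
    TopologicalSpace (H →L[ℂ] K) :=
  TopologicalSpace.induced (fun T : H →L[ℂ] K => (T : H → K)) Pi.topologicalSpace

/-- A commutative subspace lattice (CSL): a strongly closed lattice of mutually
commuting orthogonal projections containing `0` and `1`. -/
def IsCSL (L : Set (H →L[ℂ] H)) : Prop :=
  (∀ P ∈ L, IsProj P) ∧
  (∀ P ∈ L, ∀ Q ∈ L, P ∘L Q = Q ∘L P) ∧
  (0 : H →L[ℂ] H) ∈ L ∧ (1 : H →L[ℂ] H) ∈ L ∧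
  (∀ P ∈ L, ∀ Q ∈ L, P ∘L Q ∈ L ∧ P + Q - P ∘L Q ∈ L) ∧
  @IsClosed _ (sot H H) L

/-- The CSL algebra `Alg L = {T : (1 - P) T P = 0 for all P ∈ L}`. -/
def cslAlg (L : Set (H →L[ℂ] H)) : Set (H →L[ℂ] H) :=
  { T | ∀ P ∈ L, (1 - P) ∘L T ∘L P = 0 }

/-- A lattice homomorphism between CSLs (preserving meets and joins). -/
def IsLatticeHom (L₁ : Set (H₁ →L[ℂ] H₁)) (L₂ : Set (H₂ →L[ℂ] H₂))
    (φ : (H₁ →L[ℂ] H₁) → (H₂ →L[ℂ] H₂)) : Prop :=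
  MapsTo φ L₁ L₂ ∧
  (∀ P ∈ L₁, ∀ Q ∈ L₁, φ (P ∘L Q) = φ P ∘L φ Q) ∧
  (∀ P ∈ L₁, ∀ Q ∈ L₁, φ (P + Q - P ∘L Q) = φ P + φ Q - φ P ∘L φ Q)

end Algebras

section MeasurePart

variable {X X₁ X₂ : Type*} [MeasurableSpace X] [MeasurableSpace X₁] [MeasurableSpace X₂]

/-- A subset of a product of measure spaces is marginally null if it is
contained in `(M₁ × X₂) ∪ (X₁ × M₂)` with `μ₁ M₁ = μ₂ M₂ = 0`. -/
def MargNull (μ₁ : Measure X₁) (μ₂ : Measure X₂) (E : Set (X₁ × X₂)) : Prop :=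
  ∃ (M₁ : Set X₁) (M₂ : Set X₂), MeasurableSet M₁ ∧ MeasurableSet M₂ ∧
    μ₁ M₁ = 0 ∧ μ₂ M₂ = 0 ∧
    E ⊆ (M₁ ×ˢ (univ : Set X₂)) ∪ ((univ : Set X₁) ×ˢ M₂)

/-- Marginal equivalence: the symmetric difference is marginally null. -/
def MargEquiv (μ₁ : Measure X₁) (μ₂ : Measure X₂) (E F : Set (X₁ × X₂)) : Prop :=
  MargNull μ₁ μ₂ ((E \ F) ∪ (F \ E))

/-- ω-open sets: marginally equivalent to a countable union of measurable
rectangles. -/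
def OmegaOpen (μ₁ : Measure X₁) (μ₂ : Measure X₂) (E : Set (X₁ × X₂)) : Prop :=
  ∃ (α : ℕ → Set X₁) (β : ℕ → Set X₂),
    (∀ n, MeasurableSet (α n)) ∧ (∀ n, MeasurableSet (β n)) ∧
    MargEquiv μ₁ μ₂ E (⋃ n, (α n) ×ˢ (β n))

/-- ω-closed sets: complements of ω-open sets. -/
def OmegaClosed (μ₁ : Measure X₁) (μ₂ : Measure X₂) (E : Set (X₁ × X₂)) : Prop :=
  OmegaOpen μ₁ μ₂ Eᶜ

/-- `A` is a multiplication operator on `L²(X,μ)`: `A f = φ · f` for some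
essentially bounded function `φ`.  The collection `{A | IsMultOp μ A}` is the
multiplication masa of `L^∞(X,μ)`. -/
def IsMultOp (μ : Measure X) (A : Lp ℂ 2 μ →L[ℂ] Lp ℂ 2 μ) : Prop :=
  ∃ φ : X → ℂ, AEStronglyMeasurable φ μ ∧ (∃ C, ∀ᵐ x ∂μ, ‖φ x‖ ≤ C) ∧
    ∀ f : Lp ℂ 2 μ, ⇑(A f) =ᵐ[μ] fun x => φ x * f x

/-- A (weak* closed) masa-bimodule over the multiplication masas. -/
def IsMultBimodule (μ₁ : Measure X₁) (μ₂ : Measure X₂)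
    (V : Set (Lp ℂ 2 μ₁ →L[ℂ] Lp ℂ 2 μ₂)) : Prop :=
  IsWkClosedSubspace V ∧
  ∀ X ∈ V, ∀ (A : Lp ℂ 2 μ₁ →L[ℂ] Lp ℂ 2 μ₁) (B : Lp ℂ 2 μ₂ →L[ℂ] Lp ℂ 2 μ₂),
    IsMultOp μ₁ A → IsMultOp μ₂ B → B ∘L X ∘L A ∈ V

/-- `T` is supported on `κ`: `M_{χ_β} T M_{χ_α} = 0` (equivalently,
`⟪T f, g⟫ = 0` whenever `f` vanishes off `α` and `g` vanishes off `β`)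
whenever the rectangle `α × β` intersects `κ` marginally nullly. -/
def SupportedOn (μ₁ : Measure X₁) (μ₂ : Measure X₂) (κ : Set (X₁ × X₂))
    (T : Lp ℂ 2 μ₁ →L[ℂ] Lp ℂ 2 μ₂) : Prop :=
  ∀ (α : Set X₁) (β : Set X₂), MeasurableSet α → MeasurableSet β →
    MargNull μ₁ μ₂ ((α ×ˢ β) ∩ κ) →
    ∀ (f : Lp ℂ 2 μ₁) (g : Lp ℂ 2 μ₂),
      (∀ᵐ x ∂μ₁, x ∉ α → f x = 0) → (∀ᵐ y ∂μ₂, y ∉ β → g y = 0) →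
      ⟪T f, g⟫ = (0 : ℂ)

/-- `M_max κ`: the space of all operators supported on `κ` — the largest
masa-bimodule with support `κ`. -/
def Mmax (μ₁ : Measure X₁) (μ₂ : Measure X₂) (κ : Set (X₁ × X₂)) :
    Set (Lp ℂ 2 μ₁ →L[ℂ] Lp ℂ 2 μ₂) :=
  { T | SupportedOn μ₁ μ₂ κ T }

/-- `U` has support `κ`: `κ` is ω-closed and `Ref U = M_max κ`. -/
def HasSupport (μ₁ : Measure X₁) (μ₂ : Measure X₂)
    (U : Set (Lp ℂ 2 μ₁ →L[ℂ] Lp ℂ 2 μ₂)) (κ : Set (X₁ × X₂)) : Prop :=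
  OmegaClosed μ₁ μ₂ κ ∧ RefHull U = Mmax μ₁ μ₂ κ

/-- `M_min κ`: the smallest weak* closed masa-bimodule with support `κ`,
realized as the intersection of all weak* closed masa-bimodules with support `κ`. -/
def Mmin (μ₁ : Measure X₁) (μ₂ : Measure X₂) (κ : Set (X₁ × X₂)) :
    Set (Lp ℂ 2 μ₁ →L[ℂ] Lp ℂ 2 μ₂) :=
  ⋂₀ { U | IsMultBimodule μ₁ μ₂ U ∧ HasSupport μ₁ μ₂ U κ }

/-- `κ` is operator synthetic if it is ω-closed and `M_min κ = M_max κ`. -/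
def OperatorSynthetic (μ₁ : Measure X₁) (μ₂ : Measure X₂)
    (κ : Set (X₁ × X₂)) : Prop :=
  OmegaClosed μ₁ μ₂ κ ∧ Mmin μ₁ μ₂ κ = Mmax μ₁ μ₂ κ

/-- A masa-bimodule of finite width over the multiplication masas. -/
def MultFiniteWidth (μ₁ : Measure X₁) (μ₂ : Measure X₂)
    (V : Set (Lp ℂ 2 μ₁ →L[ℂ] Lp ℂ 2 μ₂)) : Prop :=
  ∃ (k : ℕ) (Vs : Fin k → Set (Lp ℂ 2 μ₁ →L[ℂ] Lp ℂ 2 μ₂)),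
    (∀ j, IsMultBimodule μ₁ μ₂ (Vs j) ∧ IsNestBimodule (Vs j)) ∧
    V = ⋂ j, Vs j

/-- A set of finite width: the support of a masa-bimodule of finite width. -/
def FiniteWidthSet (μ₁ : Measure X₁) (μ₂ : Measure X₂)
    (κ : Set (X₁ × X₂)) : Prop :=
  ∃ V, MultFiniteWidth μ₁ μ₂ V ∧ HasSupport μ₁ μ₂ V κ

end MeasurePart

/-- The flip `ρ : (X₁ × X₂) × (Y₁ × Y₂) → (X₁ × Y₁) × (X₂ × Y₂)`. -/
def flipProd {X₁ X₂ Y₁ Y₂ : Type*} :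
    (X₁ × X₂) × (Y₁ × Y₂) → (X₁ × Y₁) × (X₂ × Y₂) :=
  fun q => ((q.1.1, q.2.1), (q.1.2, q.2.2))

end OpSynth


noncomputable section
open scoped ComplexInnerProductSpace
open Set OpSynth Filter Topology
set_option linter.unusedVariables false
set_option linter.unusedSectionVars false
namespace OSP

section Wk
variable {H K H' K' : Type*}
  [NormedAddCommGroup H] [InnerProductSpace ℂ H]
  [NormedAddCommGroup K] [InnerProductSpace ℂ K]
  [NormedAddCommGroup H'] [InnerProductSpace ℂ H']
  [NormedAddCommGroup K'] [InnerProductSpace ℂ K']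

lemma pair_bound (T : H →L[ℂ] K) (x : H) (y : K) {C : ℝ} (hC : ‖T‖ ≤ C) :
    ‖⟪y, T x⟫‖ ≤ C * (‖x‖ ^ 2 + ‖y‖ ^ 2) := by
  have h1 : ‖⟪y, T x⟫‖ ≤ ‖y‖ * (C * ‖x‖) :=
    (norm_inner_le_norm _ _).trans (mul_le_mul_of_nonneg_left (T.le_of_opNorm_le hC x) (norm_nonneg _))
  have hC0 : 0 ≤ C := (norm_nonneg _).trans hC
  have h2 : ‖y‖ * ‖x‖ ≤ ‖x‖ ^ 2 + ‖y‖ ^ 2 := by nlinarith [sq_nonneg (‖x‖ - ‖y‖), sq_nonneg ‖x‖, sq_nonneg ‖y‖]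
  calc _ ≤ C * (‖y‖ * ‖x‖) := by linarith
    _ ≤ _ := mul_le_mul_of_nonneg_left h2 hC0

lemma pair_summable {ι : Type*} (T : H →L[ℂ] K) {ξ : ι → H} {η : ι → K}
    (h1 : Summable fun n => ‖ξ n‖ ^ 2) (h2 : Summable fun n => ‖η n‖ ^ 2) :
    Summable fun n => ⟪η n, T (ξ n)⟫ :=
  Summable.of_norm_bounded ((h1.add h2).mul_left ‖T‖) fun n => pair_bound T _ _ le_rfl

lemma wk_tendsto {ι : Type*} {l : Filter ι} {f : ι → H →L[ℂ] K} {Y : H →L[ℂ] K} :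
    Tendsto f l (@nhds _ (sigmaWeak H K) Y) ↔
    ∀ (ξ : ℕ → H) (η : ℕ → K), (Summable fun n => ‖ξ n‖ ^ 2) → (Summable fun n => ‖η n‖ ^ 2) →
      Tendsto (fun i => ∑' n, ⟪η n, f i (ξ n)⟫) l (𝓝 (∑' n, ⟪η n, Y (ξ n)⟫)) := by
  have : @nhds _ (sigmaWeak H K) Y = ⨅ (ξ : ℕ → H) (η : ℕ → K) (_ : Summable fun n => ‖ξ n‖ ^ 2)
      (_ : Summable fun n => ‖η n‖ ^ 2),
      comap (fun T : H →L[ℂ] K => ∑' n, ⟪η n, T (ξ n)⟫) (𝓝 (∑' n, ⟪η n, Y (ξ n)⟫)) := by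
    unfold sigmaWeak
    rw [nhds_iInf]; refine iInf_congr fun ξ => ?_
    rw [nhds_iInf]; refine iInf_congr fun η => ?_
    rw [nhds_iInf]; refine iInf_congr fun h1 => ?_
    rw [nhds_iInf]; refine iInf_congr fun h2 => ?_
    rw [nhds_induced]
  rw [this]
  simp only [tendsto_iInf, tendsto_comap_iff]
  rfl

lemma wk_func_cont (ξ : ℕ → H) (η : ℕ → K) (h1 : Summable fun n => ‖ξ n‖ ^ 2)
    (h2 : Summable fun n => ‖η n‖ ^ 2) :
    @Continuous _ ℂ (sigmaWeak H K) _ (fun T : H →L[ℂ] K => ∑' n, ⟪η n, T (ξ n)⟫) := by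
  rw [continuous_iff_le_induced]
  exact iInf_le_of_le ξ (iInf_le_of_le η (iInf_le_of_le h1 (iInf_le_of_le h2 le_rfl)))

lemma wk_cont {φ : (H →L[ℂ] K) → (H' →L[ℂ] K')}
    (h : ∀ (ξ : ℕ → H') (η : ℕ → K'), (Summable fun n => ‖ξ n‖ ^ 2) → (Summable fun n => ‖η n‖ ^ 2) →
      @Continuous _ ℂ (sigmaWeak H K) _ (fun T => ∑' n, ⟪η n, φ T (ξ n)⟫)) :
    WkContinuous φ := by
  unfold WkContinuous
  rw [continuous_iff_le_induced]
  simp only [sigmaWeak, induced_iInf, induced_compose]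
  refine le_iInf fun ξ => le_iInf fun η => le_iInf fun h1 => le_iInf fun h2 => ?_
  have := continuous_iff_le_induced.1 (h ξ η h1 h2)
  exact this

lemma wk_func_cont' {ι : Type*} [Countable ι] (ξ : ι → H) (η : ι → K)
    (h1 : Summable fun n => ‖ξ n‖ ^ 2) (h2 : Summable fun n => ‖η n‖ ^ 2) :
    @Continuous _ ℂ (sigmaWeak H K) _ (fun T : H →L[ℂ] K => ∑' n, ⟪η n, T (ξ n)⟫) := by
  obtain ⟨g, hg⟩ := exists_injective_nat ι
  have e1 : ∀ n, n ∉ range g → Function.extend g ξ 0 n = 0 := fun n hn =>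
    Function.extend_apply' _ _ _ (by simpa using hn)
  have e2 : ∀ n, n ∉ range g → Function.extend g η 0 n = 0 := fun n hn =>
    Function.extend_apply' _ _ _ (by simpa using hn)
  have s1 : Summable fun n => ‖Function.extend g ξ 0 n‖ ^ 2 := by
    rw [← hg.summable_iff (fun n hn => by simp [e1 n hn])]
    simpa [Function.comp_def, hg.extend_apply] using h1
  have s2 : Summable fun n => ‖Function.extend g η 0 n‖ ^ 2 := by
    rw [← hg.summable_iff (fun n hn => by simp [e2 n hn])]
    simpa [Function.comp_def, hg.extend_apply] using h2
  convert wk_func_cont _ _ s1 s2 using 2 with T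
  rw [← hg.tsum_eq (f := fun n => ⟪Function.extend g η 0 n, T (Function.extend g ξ 0 n)⟫)]
  · simp [hg.extend_apply]
  · intro n hn
    by_contra h
    exact hn (by simp [e1 n h])

lemma wk_mem_map {φ : (H →L[ℂ] K) → (H' →L[ℂ] K')} (hφ : WkContinuous φ)
    {S : Set (H →L[ℂ] K)} {S' : Set (H' →L[ℂ] K')} (h : ∀ x ∈ S, φ x ∈ S') {x : H →L[ℂ] K}
    (hx : x ∈ wkClosure S) : φ x ∈ wkClosure S' :=
  @map_mem_closure _ _ (sigmaWeak H K) (sigmaWeak H' K') _ _ _ _ hφ hx h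

lemma wk_add_right (Y : H →L[ℂ] K) : WkContinuous (fun X : H →L[ℂ] K => X + Y) := by
  refine wk_cont fun ξ η h1 h2 => ?_
  have : (fun T : H →L[ℂ] K => ∑' n, ⟪η n, (T + Y) (ξ n)⟫) =
      fun T => (∑' n, ⟪η n, T (ξ n)⟫) + ∑' n, ⟪η n, Y (ξ n)⟫ := by
    funext T
    simp only [add_apply, inner_add_right]
    exact (pair_summable T h1 h2).tsum_add (pair_summable Y h1 h2)
  rw [this]
  exact @Continuous.add _ _ _ _ _ (sigmaWeak H K) _ _ (wk_func_cont ξ η h1 h2) (@continuous_const _ _ (sigmaWeak H K) _ _)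

lemma wk_smul (c : ℂ) : WkContinuous (fun X : H →L[ℂ] K => c • X) := by
  refine wk_cont fun ξ η h1 h2 => ?_
  have : (fun T : H →L[ℂ] K => ∑' n, ⟪η n, (c • T) (ξ n)⟫) =
      fun T => c * (∑' n, ⟪η n, T (ξ n)⟫) := by
    funext T
    simp only [smul_apply, inner_smul_right]
    exact tsum_mul_left
  rw [this]
  exact @Continuous.mul _ _ _ _ _ (sigmaWeak H K) _ _ (@continuous_const _ _ (sigmaWeak H K) _ _) (wk_func_cont ξ η h1 h2)

lemma subset_wkClosure (S : Set (H →L[ℂ] K)) : S ⊆ wkClosure S := @subset_closure _ (sigmaWeak H K) _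
lemma wkClosed_wkClosure (S : Set (H →L[ℂ] K)) : WkClosed (wkClosure S) := @isClosed_closure _ (sigmaWeak H K) _
lemma wkClosure_min {S N : Set (H →L[ℂ] K)} (h : S ⊆ N) (hN : WkClosed N) : wkClosure S ⊆ N :=
  @closure_minimal _ (sigmaWeak H K) _ _ h hN
lemma wkClosure_mono {S N : Set (H →L[ℂ] K)} (h : S ⊆ N) : wkClosure S ⊆ wkClosure N :=
  @closure_mono _ (sigmaWeak H K) _ _ h

/-- weak* closed span -/
def cspan (S : Set (H →L[ℂ] K)) : Submodule ℂ (H →L[ℂ] K) where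
  carrier := wkClosure ↑(Submodule.span ℂ S)
  zero_mem' := subset_wkClosure _ (Submodule.zero_mem _)
  add_mem' := by
    intro a b ha hb
    have h1 : ∀ y ∈ (Submodule.span ℂ S : Set (H →L[ℂ] K)), a + y ∈ wkClosure (Submodule.span ℂ S : Set (H →L[ℂ] K)) := by
      intro y hy
      exact wk_mem_map (wk_add_right y) (fun x hx => Submodule.add_mem _ hx hy) ha
    have h2 := wk_mem_map (wk_add_right a) (S' := wkClosure (Submodule.span ℂ S : Set (H →L[ℂ] K)))
      (fun x hx => by rw [add_comm]; exact h1 x hx) hb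
    rw [add_comm]
    exact wkClosure_min subset_rfl (wkClosed_wkClosure _) h2
  smul_mem' := by
    intro c x hx
    exact wk_mem_map (wk_smul c) (fun x hx => Submodule.smul_mem _ c hx) hx

lemma subset_cspan (S : Set (H →L[ℂ] K)) : S ⊆ cspan S :=
  fun _ hx => subset_wkClosure _ (Submodule.subset_span hx)

lemma cspan_closed (S : Set (H →L[ℂ] K)) : WkClosed (cspan S : Set (H →L[ℂ] K)) := wkClosed_wkClosure _

lemma cspan_le {S : Set (H →L[ℂ] K)} {N : Submodule ℂ (H →L[ℂ] K)} (hN : WkClosed (N : Set (H →L[ℂ] K)))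
    (h : S ⊆ N) : cspan S ≤ N :=
  wkClosure_min (Submodule.span_le.2 h) hN

lemma cspan_mono {S S' : Set (H →L[ℂ] K)} (h : S ⊆ S') : cspan S ≤ cspan S' :=
  cspan_le (cspan_closed _) (h.trans (subset_cspan _))

lemma closed_comap {φ : (H →L[ℂ] K) → (H' →L[ℂ] K')} (hφ : WkContinuous φ) {N : Set (H' →L[ℂ] K')}
    (hN : WkClosed N) : WkClosed (φ ⁻¹' N) :=
  @IsClosed.preimage _ _ (sigmaWeak H K) (sigmaWeak H' K') _ hφ _ hN

lemma cspan_map (φ : (H →L[ℂ] K) →ₗ[ℂ] (H' →L[ℂ] K')) (hφ : WkContinuous φ)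
    {S : Set (H →L[ℂ] K)} {N : Submodule ℂ (H' →L[ℂ] K')} (hN : WkClosed (N : Set (H' →L[ℂ] K')))
    (h : ∀ x ∈ S, φ x ∈ N) {x : H →L[ℂ] K} (hx : x ∈ cspan S) : φ x ∈ N := by
  have : cspan S ≤ N.comap φ := cspan_le (closed_comap hφ hN) h
  exact this hx

lemma wk_mem_of_tendsto {ι : Type*} {l : Filter ι} [l.NeBot] {f : ι → H →L[ℂ] K} {Y : H →L[ℂ] K}
    {N : Set (H →L[ℂ] K)} (hN : WkClosed N) (h : Tendsto f l (@nhds _ (sigmaWeak H K) Y))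
    (hf : ∀ i, f i ∈ N) : Y ∈ N :=
  @IsClosed.mem_of_tendsto _ (sigmaWeak H K) _ _ _ _ _ _ hN h (Eventually.of_forall hf)

lemma wk_tendsto_of_bdd {ι : Type*} {l : Filter ι} {f : ι → H →L[ℂ] K} {Y : H →L[ℂ] K} {C : ℝ}
    (hC : ∀ i, ‖f i‖ ≤ C) (h : ∀ x y, Tendsto (fun i => ⟪y, f i x⟫) l (𝓝 ⟪y, Y x⟫)) :
    Tendsto f l (@nhds _ (sigmaWeak H K) Y) := by
  rw [wk_tendsto]
  intro ξ η h1 h2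
  exact tendsto_tsum_of_dominated_convergence ((h1.add h2).mul_left C) (fun n => h _ _)
    (Eventually.of_forall fun i n => pair_bound _ _ _ (hC i))

end Wk

section Comp
variable {H K H' K' : Type*}
  [NormedAddCommGroup H] [InnerProductSpace ℂ H] [CompleteSpace H]
  [NormedAddCommGroup K] [InnerProductSpace ℂ K] [CompleteSpace K]
  [NormedAddCommGroup H'] [InnerProductSpace ℂ H'] [CompleteSpace H']
  [NormedAddCommGroup K'] [InnerProductSpace ℂ K'] [CompleteSpace K']

lemma summable_comp (A : H' →L[ℂ] H) {ξ : ℕ → H'} (h : Summable fun n => ‖ξ n‖ ^ 2) :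
    Summable fun n => ‖A (ξ n)‖ ^ 2 := by
  refine Summable.of_nonneg_of_le (fun n => sq_nonneg _) (fun n => ?_) (h.mul_left (‖A‖ ^ 2))
  rw [← mul_pow]
  exact pow_le_pow_left₀ (norm_nonneg _) (A.le_opNorm _) 2

/-- two-sided multiplication -/
def sand (B : K →L[ℂ] K') (A : H' →L[ℂ] H) : (H →L[ℂ] K) →ₗ[ℂ] (H' →L[ℂ] K') where
  toFun X := B ∘L X ∘L A
  map_add' X Y := by ext; simp
  map_smul' c X := by ext; simp

@[simp] lemma sand_apply (B : K →L[ℂ] K') (A : H' →L[ℂ] H) (X : H →L[ℂ] K) : sand B A X = B ∘L X ∘L A := rfl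

lemma sand_cont (B : K →L[ℂ] K') (A : H' →L[ℂ] H) : WkContinuous (sand B A : (H →L[ℂ] K) →ₗ[ℂ] (H' →L[ℂ] K')) := by
  refine wk_cont fun ξ η h1 h2 => ?_
  convert wk_func_cont (fun n => A (ξ n)) (fun n => ContinuousLinearMap.adjoint B (η n)) (summable_comp A h1) (summable_comp _ h2) using 4
  simp [ContinuousLinearMap.adjoint_inner_left]

lemma wk_tendsto_sand {ι : Type*} {l : Filter ι} {f : ι → H →L[ℂ] K} {Y : H →L[ℂ] K}
    (h : Tendsto f l (@nhds _ (sigmaWeak H K) Y)) (x : H) (y : K) :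
    Tendsto (fun i => ⟪y, f i x⟫) l (𝓝 ⟪y, Y x⟫) := by
  have := (wk_tendsto.1 h) (fun n => if n = 0 then x else 0) (fun n => if n = 0 then y else 0)
    (summable_of_ne_finset_zero (s := {0}) (by intro b hb; simp at hb; simp [hb]))
    (summable_of_ne_finset_zero (s := {0}) (by intro b hb; simp at hb; simp [hb]))
  have e : ∀ T : H →L[ℂ] K, ∑' n : ℕ, ⟪(if n = 0 then y else 0), T (if n = 0 then x else 0)⟫ = ⟪y, T x⟫ := by
    intro T
    rw [tsum_eq_single 0 (by intro b hb; simp [hb])]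
    simp
  simpa only [e] using this

/-- bounded nets have ultrafilter limits -/
lemma exists_lim {ι : Type*} (u : Ultrafilter ι) {f : ι → H →L[ℂ] K} {C : ℝ}
    (hC : ∀ i, ‖f i‖ ≤ C) : ∃ Y : H →L[ℂ] K, ‖Y‖ ≤ C ∧ Tendsto f u (@nhds _ (sigmaWeak H K) Y) := by
  have hC0 : 0 ≤ C := by
    obtain ⟨i⟩ := nonempty_of_neBot (u : Filter ι)
    exact (norm_nonneg _).trans (hC i)
  have hb : ∀ i x y, ‖⟪f i x, y⟫‖ ≤ C * ‖x‖ * ‖y‖ := fun i x y =>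
    (norm_inner_le_norm _ _).trans (mul_le_mul_of_nonneg_right ((f i).le_of_opNorm_le (hC i) x) (norm_nonneg _))
  have hl : ∀ x y, ∃ z : ℂ, ‖z‖ ≤ C * ‖x‖ * ‖y‖ ∧ Tendsto (fun i => ⟪f i x, y⟫) u (𝓝 z) := by
    intro x y
    have hcomp : IsCompact (Metric.closedBall (0 : ℂ) (C * ‖x‖ * ‖y‖)) := isCompact_closedBall _ _
    obtain ⟨z, hz, hz'⟩ := hcomp.ultrafilter_le_nhds (u.map fun i => ⟪f i x, y⟫) (by
      simp only [Ultrafilter.coe_map, le_principal_iff, mem_map]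
      exact univ_mem' fun i => by simpa using hb i x y)
    exact ⟨z, by simpa using hz, hz'⟩
  choose b hb1 hb2 using hl
  let Bf : H →ₗ⋆[ℂ] K →ₗ[ℂ] ℂ := LinearMap.mk₂'ₛₗ (starRingEnd ℂ) (RingHom.id ℂ) b
    (fun x x' y => tendsto_nhds_unique (hb2 _ _) (by simpa [inner_add_left] using (hb2 x y).add (hb2 x' y)))
    (fun c x y => tendsto_nhds_unique (hb2 _ _) (by simpa [inner_smul_left, mul_comm] using (hb2 x y).const_mul (starRingEnd ℂ c)))
    (fun x y y' => tendsto_nhds_unique (hb2 _ _) (by simpa [inner_add_right] using (hb2 x y).add (hb2 x y')))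
    (fun c x y => tendsto_nhds_unique (hb2 _ _) (by simpa [inner_smul_right] using (hb2 x y).const_mul c))
  let Bc := Bf.mkContinuous₂ C (fun x y => hb1 x y)
  let Y : H →L[ℂ] K := ((InnerProductSpace.toDual ℂ K).symm.toContinuousLinearEquiv : _ →L⋆[ℂ] K).comp Bc
  have hY : ∀ x y, ⟪Y x, y⟫ = b x y := fun x y => by
    show ⟪(InnerProductSpace.toDual ℂ K).symm (Bc x), y⟫ = b x y
    rw [InnerProductSpace.toDual_symm_apply]; rfl
  refine ⟨Y, ?_, ?_⟩
  · refine Y.opNorm_le_bound hC0 fun x => ?_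
    have h1 := hb1 x (Y x)
    rw [← hY, inner_self_eq_norm_sq_to_K] at h1
    have h2 : ‖Y x‖ ^ 2 ≤ C * ‖x‖ * ‖Y x‖ := by simpa using h1
    rcases eq_or_lt_of_le (norm_nonneg (Y x)) with h | h
    · rw [← h]; positivity
    · nlinarith
  · refine wk_tendsto_of_bdd hC fun x y => ?_
    have := (hb2 x y).star
    rw [← hY] at this
    simpa using this

/-- approximation criterion -/
lemma mem_of_approx {N : Set (H →L[ℂ] K)} (hN : WkClosed N) {X : H →L[ℂ] K} (C : ℝ)
    {A : Set H} {B : Set K} (hA : (Submodule.span ℂ A).topologicalClosure = ⊤)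
    (hB : (Submodule.span ℂ B).topologicalClosure = ⊤)
    (h : ∀ s : Finset H, ↑s ⊆ A → ∀ t : Finset K, ↑t ⊆ B → ∀ ε > 0, ∃ Z ∈ N, ‖Z‖ ≤ C ∧
      ∀ x ∈ s, ∀ y ∈ t, ‖⟪y, Z x⟫ - ⟪y, X x⟫‖ ≤ ε) : X ∈ N := by
  classical
  choose! Z hZ1 hZ2 hZ3 using h
  let ι := Finset A × Finset B × ℕ
  let f : ι → H →L[ℂ] K := fun i => Z (i.1.map (Function.Embedding.subtype _)) (i.2.1.map (Function.Embedding.subtype _)) (1 / ((i.2.2 : ℝ) + 1))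
  have hs : ∀ i : Finset A, (↑(i.map (Function.Embedding.subtype (· ∈ A))) : Set H) ⊆ A := by
    intro i x hx; simp at hx; exact hx.1
  have ht : ∀ i : Finset B, (↑(i.map (Function.Embedding.subtype (· ∈ B))) : Set K) ⊆ B := by
    intro i x hx; simp at hx; exact hx.1
  have hp : ∀ n : ℕ, (1 / ((n : ℝ) + 1)) > 0 := fun n => by positivity
  obtain ⟨Y, -, hY⟩ := exists_lim (Ultrafilter.of (atTop : Filter ι)) (f := f) (C := C)
    (fun i => hZ2 _ (hs _) _ (ht _) _ (hp _))
  have hYN : Y ∈ N := wk_mem_of_tendsto hN hY (fun i => hZ1 _ (hs _) _ (ht _) _ (hp _))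
  have key : ∀ x ∈ A, ∀ y ∈ B, ⟪y, Y x⟫ = ⟪y, X x⟫ := by
    intro x hx y hy
    refine tendsto_nhds_unique (wk_tendsto_sand hY x y) ?_
    refine Tendsto.mono_left ?_ (Ultrafilter.of_le _)
    rw [Metric.tendsto_atTop]
    intro ε hε
    obtain ⟨n, hn⟩ := exists_nat_one_div_lt hε
    refine ⟨({⟨x, hx⟩}, {⟨y, hy⟩}, n), fun i hi => ?_⟩
    rw [dist_eq_norm]
    have hi1 : ⟨x, hx⟩ ∈ i.1 := hi.1 (by simp)
    have hi2 : ⟨y, hy⟩ ∈ i.2.1 := hi.2.1 (by simp)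
    have hi3 : n ≤ i.2.2 := hi.2.2
    refine (hZ3 _ (hs i.1) _ (ht i.2.1) _ (hp i.2.2) x (by simpa using ⟨hx, hi1⟩) y (by simpa using ⟨hy, hi2⟩)).trans_lt
      (lt_of_le_of_lt ?_ hn)
    exact one_div_le_one_div_of_le (by positivity) (by have : (n : ℝ) ≤ i.2.2 := by exact_mod_cast hi3
                                                       linarith)
  have key2 : ∀ x ∈ A, Y x = X x := by
    intro x hx
    have : Dense (Submodule.span ℂ B : Set K) := by
      rw [← Submodule.dense_iff_topologicalClosure_eq_top] at hB; exact hB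
    refine Dense.eq_of_inner_right (𝕜 := ℂ) this fun v hv => ?_
    induction hv using Submodule.span_induction with
    | mem v hv => exact key x hx v hv
    | zero => simp
    | add a b _ _ ha hb => simp [inner_add_left, ha, hb]
    | smul c a _ ha => simp [inner_smul_left, ha]
  have : Y = X := by
    have hd : Dense (Submodule.span ℂ A : Set H) := by
      rw [← Submodule.dense_iff_topologicalClosure_eq_top] at hA; exact hA
    exact ContinuousLinearMap.ext_on hd key2
  exact this ▸ hYN

end Comp
end OSP
end


noncomputable section
open scoped ComplexInnerProductSpace
open scoped TensorProduct InnerProduct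
open Set OpSynth Filter Topology
set_option linter.unusedVariables false
set_option linter.unusedSectionVars false
namespace OSP

section Emb
variable {H K T : Type*}
  [NormedAddCommGroup H] [InnerProductSpace ℂ H]
  [NormedAddCommGroup K] [InnerProductSpace ℂ K]
  [NormedAddCommGroup T] [InnerProductSpace ℂ T] {t : H → K → T}

lemma te_norm (ht : IsTensorEmbedding t) (x : H) (y : K) : ‖t x y‖ = ‖x‖ * ‖y‖ := by
  have h := ht.2.2.2.2.1 x x y y
  rw [inner_self_eq_norm_sq_to_K, inner_self_eq_norm_sq_to_K, inner_self_eq_norm_sq_to_K, ← mul_pow] at h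
  have h2 : ‖t x y‖ ^ 2 = (‖x‖ * ‖y‖) ^ 2 := by exact_mod_cast h
  exact (pow_left_inj₀ (norm_nonneg _) (by positivity) two_ne_zero).1 h2

lemma te_total (ht : IsTensorEmbedding t) :
    (Submodule.span ℂ {z | ∃ x y, z = t x y}).topologicalClosure = ⊤ := ht.2.2.2.2.2

lemma te_inner (ht : IsTensorEmbedding t) (x x' : H) (y y' : K) : ⟪t x y, t x' y'⟫ = ⟪x, x'⟫ * ⟪y, y'⟫ :=
  ht.2.2.2.2.1 x x' y y'

/-- the map `y ↦ x ⊗ y` -/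
def tL (ht : IsTensorEmbedding t) (x : H) : K →L[ℂ] T :=
  LinearMap.mkContinuous
    { toFun := fun y => t x y, map_add' := ht.2.1 x, map_smul' := fun c y => ht.2.2.2.1 c x y } ‖x‖
    (fun y => (te_norm ht x y).le)

/-- the map `x ↦ x ⊗ y` -/
def tR (ht : IsTensorEmbedding t) (y : K) : H →L[ℂ] T :=
  LinearMap.mkContinuous
    { toFun := fun x => t x y, map_add' := fun x x' => ht.1 x x' y, map_smul' := fun c x => ht.2.2.1 c x y } ‖y‖
    (fun x => (by rw [mul_comm]; exact (te_norm ht x y).le))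

@[simp] lemma tL_apply (ht : IsTensorEmbedding t) (x : H) (y : K) : tL ht x y = t x y := rfl
@[simp] lemma tR_apply (ht : IsTensorEmbedding t) (x : H) (y : K) : tR ht y x = t x y := rfl

lemma te_ext {F : Type*} [NormedAddCommGroup F] [InnerProductSpace ℂ F] (ht : IsTensorEmbedding t) {A B : T →L[ℂ] F}
    (h : ∀ x y, A (t x y) = B (t x y)) : A = B := by
  have hd : Dense (Submodule.span ℂ {z | ∃ x y, z = t x y} : Set T) := by
    rw [Submodule.dense_iff_topologicalClosure_eq_top]; exact te_total ht
  refine ContinuousLinearMap.ext_on hd ?_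
  rintro _ ⟨x, y, rfl⟩
  exact h x y

lemma te_ext_inner {F : Type*} [NormedAddCommGroup F] [InnerProductSpace ℂ F] (ht : IsTensorEmbedding t) {A B : F →L[ℂ] T}
    (h : ∀ x y z, ⟪t x y, A z⟫ = ⟪t x y, B z⟫) : A = B := by
  have hd : Dense (Submodule.span ℂ {z | ∃ x y, z = t x y} : Set T) := by
    rw [Submodule.dense_iff_topologicalClosure_eq_top]; exact te_total ht
  ext z
  refine Dense.eq_of_inner_right (𝕜 := ℂ) hd fun v hv => ?_
  induction hv using Submodule.span_induction with
  | mem v hv => obtain ⟨x, y, rfl⟩ := hv; exact h x y z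
  | zero => simp
  | add a b _ _ ha hb => simp [inner_add_left, ha, hb]
  | smul c a _ ha => simp [inner_smul_left, ha]

/-- linear map from the algebraic tensor product -/
def tJ (ht : IsTensorEmbedding t) : H ⊗[ℂ] K →ₗᵢ[ℂ] T :=
  LinearMap.isometryOfInner
    (TensorProduct.lift (LinearMap.mk₂ ℂ t ht.1 (fun c x y => ht.2.2.1 c x y) ht.2.1 (fun c x y => ht.2.2.2.1 c x y)))
    (by
      intro a b
      induction a using TensorProduct.induction_on with
      | zero => simp
      | add a a' h h' => simp [inner_add_left, h, h']
      | tmul x y =>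
        induction b using TensorProduct.induction_on with
        | zero => simp
        | add a a' h h' => rw [map_add, inner_add_right, h, h', inner_add_right]
        | tmul x' y' => simpa using te_inner ht x x' y y')

@[simp] lemma tJ_tmul (ht : IsTensorEmbedding t) (x : H) (y : K) : tJ ht (x ⊗ₜ y) = t x y := rfl

lemma tJ_dense (ht : IsTensorEmbedding t) : DenseRange (tJ ht) := by
  have hd : Dense (Submodule.span ℂ {z | ∃ x y, z = t x y} : Set T) := by
    rw [Submodule.dense_iff_topologicalClosure_eq_top]; exact te_total ht
  refine hd.mono ?_
  have : Submodule.span ℂ {z | ∃ x y, z = t x y} ≤ LinearMap.range (tJ ht).toLinearMap := by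
    rw [Submodule.span_le]
    rintro _ ⟨x, y, rfl⟩
    exact ⟨x ⊗ₜ y, rfl⟩
  intro z hz
  obtain ⟨a, ha⟩ := this hz
  exact ⟨a, ha⟩

end Emb

section Tens
variable {H₁ K₁ T₁ H₂ K₂ T₂ H₃ K₃ T₃ : Type*}
  [NormedAddCommGroup H₁] [InnerProductSpace ℂ H₁] [CompleteSpace H₁]
  [NormedAddCommGroup K₁] [InnerProductSpace ℂ K₁] [CompleteSpace K₁]
  [NormedAddCommGroup T₁] [InnerProductSpace ℂ T₁] [CompleteSpace T₁]
  [NormedAddCommGroup H₂] [InnerProductSpace ℂ H₂] [CompleteSpace H₂]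
  [NormedAddCommGroup K₂] [InnerProductSpace ℂ K₂] [CompleteSpace K₂]
  [NormedAddCommGroup T₂] [InnerProductSpace ℂ T₂] [CompleteSpace T₂]
  [NormedAddCommGroup H₃] [InnerProductSpace ℂ H₃] [CompleteSpace H₃]
  [NormedAddCommGroup K₃] [InnerProductSpace ℂ K₃] [CompleteSpace K₃]
  [NormedAddCommGroup T₃] [InnerProductSpace ℂ T₃] [CompleteSpace T₃]
  {t₁ : H₁ → K₁ → T₁} {t₂ : H₂ → K₂ → T₂} {t₃ : H₃ → K₃ → T₃}
  (ht₁ : IsTensorEmbedding t₁) (ht₂ : IsTensorEmbedding t₂) (ht₃ : IsTensorEmbedding t₃)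

/-- elementary tensor of operators -/
def tens (S : H₁ →L[ℂ] H₂) (R : K₁ →L[ℂ] K₂) : T₁ →L[ℂ] T₂ :=
  ContinuousLinearMap.extend ((tJ ht₂).toContinuousLinearMap ∘L TensorProduct.mapL S R) (tJ ht₁).toContinuousLinearMap

@[simp] lemma tens_apply (S : H₁ →L[ℂ] H₂) (R : K₁ →L[ℂ] K₂) (x : H₁) (y : K₁) :
    tens ht₁ ht₂ S R (t₁ x y) = t₂ (S x) (R y) := by
  have := ContinuousLinearMap.extend_eq ((tJ ht₂).toContinuousLinearMap ∘L TensorProduct.mapL S R)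
    (e := (tJ ht₁).toContinuousLinearMap) (tJ_dense ht₁) (tJ ht₁).isometry.isUniformInducing (x ⊗ₜ y)
  simpa [tens] using this

lemma norm_tens_le (S : H₁ →L[ℂ] H₂) (R : K₁ →L[ℂ] K₂) : ‖tens ht₁ ht₂ S R‖ ≤ ‖S‖ * ‖R‖ := by
  have h := ContinuousLinearMap.opNorm_extend_le ((tJ ht₂).toContinuousLinearMap ∘L TensorProduct.mapL S R)
    (e := (tJ ht₁).toContinuousLinearMap) (N := 1) (tJ_dense ht₁) (fun x => by simp)
  refine h.trans ?_
  rw [NNReal.coe_one, one_mul]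
  refine (ContinuousLinearMap.opNorm_comp_le _ _).trans ?_
  refine (mul_le_mul ((tJ ht₂).norm_toContinuousLinearMap_le) (TensorProduct.norm_mapL_le S R) (ContinuousLinearMap.opNorm_nonneg _) zero_le_one).trans ?_
  rw [one_mul]

lemma elem_iff {W : T₁ →L[ℂ] T₂} {S : H₁ →L[ℂ] H₂} {R : K₁ →L[ℂ] K₂} :
    IsElemTensor t₁ t₂ W S R ↔ W = tens ht₁ ht₂ S R := by
  constructor
  · intro h; exact te_ext ht₁ fun x y => by rw [h x y, tens_apply]
  · rintro rfl x y; simp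

lemma tens_comp (S : H₂ →L[ℂ] H₃) (R : K₂ →L[ℂ] K₃) (S' : H₁ →L[ℂ] H₂) (R' : K₁ →L[ℂ] K₂) :
    tens ht₂ ht₃ S R ∘L tens ht₁ ht₂ S' R' = tens ht₁ ht₃ (S ∘L S') (R ∘L R') :=
  te_ext ht₁ fun x y => by simp

lemma tens_one : tens ht₁ ht₁ (1 : H₁ →L[ℂ] H₁) (1 : K₁ →L[ℂ] K₁) = 1 := te_ext ht₁ fun x y => by simp

lemma tens_adjoint (S : H₁ →L[ℂ] H₂) (R : K₁ →L[ℂ] K₂) :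
    ContinuousLinearMap.adjoint (tens ht₁ ht₂ S R) = tens ht₂ ht₁ (ContinuousLinearMap.adjoint S) (ContinuousLinearMap.adjoint R) := by
  refine te_ext ht₂ fun x y => ?_
  refine ext_inner_left ℂ fun z => ?_
  have : ∀ z, ⟪z, (ContinuousLinearMap.adjoint (tens ht₁ ht₂ S R)) (t₂ x y)⟫ = ⟪z, tens ht₂ ht₁ (ContinuousLinearMap.adjoint S) (ContinuousLinearMap.adjoint R) (t₂ x y)⟫ := by
    intro z
    have hd := tJ_dense ht₁
    refine DenseRange.induction_on hd z (isClosed_eq (by fun_prop) (by fun_prop)) fun a => ?_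
    induction a using TensorProduct.induction_on with
    | zero => simp
    | add a a' h h' => rw [map_add, inner_add_left, h, h', inner_add_left]
    | tmul a b =>
      simp [ContinuousLinearMap.adjoint_inner_right, te_inner ht₁, te_inner ht₂]
  exact this z

/-- `tens` as a bilinear map, in the right variable -/
def tensR (S : H₁ →L[ℂ] H₂) : (K₁ →L[ℂ] K₂) →ₗ[ℂ] (T₁ →L[ℂ] T₂) where
  toFun R := tens ht₁ ht₂ S R
  map_add' R R' := te_ext ht₁ fun x y => by simp [ht₂.2.1]
  map_smul' c R := te_ext ht₁ fun x y => by simp [ht₂.2.2.2.1]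

/-- `tens` as a bilinear map, in the left variable -/
def tensL (R : K₁ →L[ℂ] K₂) : (H₁ →L[ℂ] H₂) →ₗ[ℂ] (T₁ →L[ℂ] T₂) where
  toFun S := tens ht₁ ht₂ S R
  map_add' R R' := te_ext ht₁ fun x y => by simp [ht₂.1]
  map_smul' c R := te_ext ht₁ fun x y => by simp [ht₂.2.2.1]

@[simp] lemma tensR_apply (S : H₁ →L[ℂ] H₂) (R : K₁ →L[ℂ] K₂) : tensR ht₁ ht₂ S R = tens ht₁ ht₂ S R := rfl
@[simp] lemma tensL_apply (S : H₁ →L[ℂ] H₂) (R : K₁ →L[ℂ] K₂) : tensL ht₁ ht₂ R S = tens ht₁ ht₂ S R := rfl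

/-- ampliation -/
def amp (A : H₁ →L[ℂ] H₁) : T₁ →L[ℂ] T₁ := tens ht₁ ht₁ A 1

@[simp] lemma amp_apply (A : H₁ →L[ℂ] H₁) (x : H₁) (y : K₁) : amp ht₁ A (t₁ x y) = t₁ (A x) y := by simp [amp]
lemma amp_comp (A B : H₁ →L[ℂ] H₁) : amp ht₁ A ∘L amp ht₁ B = amp ht₁ (A ∘L B) := by
  simp only [amp, tens_comp]; rfl
lemma amp_one : amp ht₁ (1 : H₁ →L[ℂ] H₁) = 1 := tens_one ht₁
lemma amp_zero : amp ht₁ (0 : H₁ →L[ℂ] H₁) = 0 := (tensL ht₁ ht₁ 1).map_zero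
lemma amp_add (A B : H₁ →L[ℂ] H₁) : amp ht₁ (A + B) = amp ht₁ A + amp ht₁ B := (tensL ht₁ ht₁ 1).map_add A B
lemma amp_sub (A B : H₁ →L[ℂ] H₁) : amp ht₁ (A - B) = amp ht₁ A - amp ht₁ B := (tensL ht₁ ht₁ 1).map_sub A B
lemma amp_smul (c : ℂ) (B : H₁ →L[ℂ] H₁) : amp ht₁ (c • B) = c • amp ht₁ B := (tensL ht₁ ht₁ 1).map_smul c B
lemma amp_sum {ι : Type*} (s : Finset ι) (A : ι → H₁ →L[ℂ] H₁) : amp ht₁ (∑ i ∈ s, A i) = ∑ i ∈ s, amp ht₁ (A i) :=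
  map_sum (tensL ht₁ ht₁ 1) A s
lemma amp_adjoint (A : H₁ →L[ℂ] H₁) : ContinuousLinearMap.adjoint (amp ht₁ A) = amp ht₁ (ContinuousLinearMap.adjoint A) := by
  unfold amp; rw [tens_adjoint, ContinuousLinearMap.adjoint_one]
lemma norm_amp_le (A : H₁ →L[ℂ] H₁) : ‖amp ht₁ A‖ ≤ ‖A‖ := by
  refine (norm_tens_le ht₁ ht₁ A 1).trans ?_
  exact mul_le_of_le_one_right (norm_nonneg _) ContinuousLinearMap.norm_id_le

/-- slice map -/
def slice (x : H₁) (y : H₂) : (T₁ →L[ℂ] T₂) →ₗ[ℂ] (K₁ →L[ℂ] K₂) :=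
  sand (ContinuousLinearMap.adjoint (tL ht₂ y)) (tL ht₁ x)

lemma slice_cont (x : H₁) (y : H₂) : WkContinuous (slice ht₁ ht₂ x y) := sand_cont _ _

@[simp] lemma inner_slice (x : H₁) (y : H₂) (X : T₁ →L[ℂ] T₂) (k : K₁) (k' : K₂) :
    ⟪k', slice ht₁ ht₂ x y X k⟫ = ⟪t₂ y k', X (t₁ x k)⟫ := by
  simp [slice, ContinuousLinearMap.adjoint_inner_right]

lemma slice_tens (x : H₁) (y : H₂) (S : H₁ →L[ℂ] H₂) (R : K₁ →L[ℂ] K₂) :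
    slice ht₁ ht₂ x y (tens ht₁ ht₂ S R) = ⟪y, S x⟫ • R := by
  ext k
  refine ext_inner_left ℂ fun k' => ?_
  simp [te_inner ht₂, inner_smul_right]

/-- the other slice -/
def slice' (k : K₁) (k' : K₂) : (T₁ →L[ℂ] T₂) →ₗ[ℂ] (H₁ →L[ℂ] H₂) :=
  sand (ContinuousLinearMap.adjoint (tR ht₂ k')) (tR ht₁ k)

@[simp] lemma inner_slice' (x : H₁) (y : H₂) (X : T₁ →L[ℂ] T₂) (k : K₁) (k' : K₂) :
    ⟪y, slice' ht₁ ht₂ k k' X x⟫ = ⟪t₂ y k', X (t₁ x k)⟫ := by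
  simp [slice', ContinuousLinearMap.adjoint_inner_right]

end Tens

section T3
variable (H K : Type*) [NormedAddCommGroup H] [InnerProductSpace ℂ H] [NormedAddCommGroup K] [InnerProductSpace ℂ K]

/-- the completed Hilbert tensor product -/
abbrev HT : Type _ := UniformSpace.Completion (H ⊗[ℂ] K)

/-- the canonical tensor embedding -/
def ht (x : H) (y : K) : HT H K := ((x ⊗ₜ[ℂ] y : H ⊗[ℂ] K) : HT H K)

lemma ht_emb : IsTensorEmbedding (ht H K) := by
  refine ⟨fun x x' y => ?_, fun x y y' => ?_, fun c x y => ?_, fun c x y => ?_, fun x x' y y' => ?_, ?_⟩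
  · simp only [ht, TensorProduct.add_tmul, UniformSpace.Completion.coe_add]
  · simp only [ht, TensorProduct.tmul_add, UniformSpace.Completion.coe_add]
  · simp only [ht, ← TensorProduct.smul_tmul', UniformSpace.Completion.coe_smul]
  · simp only [ht, TensorProduct.tmul_smul, UniformSpace.Completion.coe_smul]
  · simp only [ht, UniformSpace.Completion.inner_coe, TensorProduct.inner_tmul]
  · rw [← Submodule.dense_iff_topologicalClosure_eq_top]
    have hd : DenseRange ((↑) : H ⊗[ℂ] K → HT H K) := UniformSpace.Completion.denseRange_coe
    refine hd.mono ?_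
    rintro _ ⟨a, rfl⟩
    induction a using TensorProduct.induction_on with
    | zero => rw [UniformSpace.Completion.coe_zero]; exact Submodule.zero_mem _
    | add a b ha hb => rw [UniformSpace.Completion.coe_add]; exact Submodule.add_mem _ ha hb
    | tmul x y => exact Submodule.subset_span ⟨x, y, rfl⟩

end T3

section Basis
variable {H₁ K₁ T₁ H₂ K₂ T₂ : Type*}
  [NormedAddCommGroup H₁] [InnerProductSpace ℂ H₁] [CompleteSpace H₁]
  [NormedAddCommGroup K₁] [InnerProductSpace ℂ K₁] [CompleteSpace K₁]
  [NormedAddCommGroup T₁] [InnerProductSpace ℂ T₁] [CompleteSpace T₁]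
  [NormedAddCommGroup H₂] [InnerProductSpace ℂ H₂] [CompleteSpace H₂]
  [NormedAddCommGroup K₂] [InnerProductSpace ℂ K₂] [CompleteSpace K₂]
  [NormedAddCommGroup T₂] [InnerProductSpace ℂ T₂] [CompleteSpace T₂]
  {t₁ : H₁ → K₁ → T₁} {t₂ : H₂ → K₂ → T₂}
  (ht₁ : IsTensorEmbedding t₁) (ht₂ : IsTensorEmbedding t₂)

lemma onb_countable [TopologicalSpace.SeparableSpace H₁] {w : Set H₁} (hw : Orthonormal ℂ ((↑) : w → H₁)) : Countable w := by
  refine Pairwise.countable_of_isOpen_disjoint (s := fun i : w => Metric.ball (i : H₁) (1 / 2)) ?_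
    (fun i => Metric.isOpen_ball) (fun i => ⟨i, by simp⟩)
  intro i j hij
  refine Metric.ball_disjoint_ball ?_
  have h1 : ‖(i : H₁) - j‖ * ‖(i : H₁) - j‖ = 2 := by
    have h3 := norm_sub_mul_self (𝕜 := ℂ) (i : H₁) (j : H₁)
    rw [hw.2 hij, hw.1 i, hw.1 j] at h3
    rw [h3]; simp; norm_num
  rw [dist_eq_norm]
  nlinarith [norm_nonneg ((i : H₁) - j)]

lemma te_decomp {ι : Type*} (b : HilbertBasis ι ℂ H₁) (ξ : T₁) :
    HasSum (fun m => tL ht₁ (b m) (ContinuousLinearMap.adjoint (tL ht₁ (b m)) ξ)) ξ ∧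
    HasSum (fun m => ‖ContinuousLinearMap.adjoint (tL ht₁ (b m)) ξ‖ ^ 2) (‖ξ‖ ^ 2) := by
  classical
  let V : ι → K₁ →ₗᵢ[ℂ] T₁ := fun m => ⟨(tL ht₁ (b m)).toLinearMap, fun k => by
    have := te_norm ht₁ (b m) k
    rw [b.orthonormal.1 m, one_mul] at this
    exact this⟩
  have hV : ∀ m k, V m k = t₁ (b m) k := fun m k => rfl
  have ho : OrthogonalFamily ℂ (fun _ : ι => K₁) V := by
    intro i j hij v w
    rw [hV, hV, te_inner ht₁, b.orthonormal.2 hij, zero_mul]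
  have hS : IsHilbertSum ℂ (fun _ : ι => K₁) V := by
    refine IsHilbertSum.mk ho ?_
    rw [← te_total ht₁]
    refine Submodule.topologicalClosure_minimal _ ?_ (Submodule.isClosed_topologicalClosure _)
    rw [Submodule.span_le]
    rintro _ ⟨x, k, rfl⟩
    have h1 := (tR ht₁ k).hasSum (b.hasSum_repr x)
    refine (Submodule.isClosed_topologicalClosure _).mem_of_tendsto h1 (Eventually.of_forall fun s => ?_)
    refine Submodule.sum_mem _ fun i _ => ?_
    simp only [map_smul]
    refine Submodule.smul_mem _ _ (Submodule.le_topologicalClosure _ (Submodule.mem_iSup_of_mem i ?_))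
    exact ⟨k, rfl⟩
  obtain ⟨f, rfl⟩ := hS.linearIsometryEquiv.symm.surjective ξ
  have h1 := hS.hasSum_linearIsometryEquiv_symm f
  have h2 : ∀ m, ContinuousLinearMap.adjoint (tL ht₁ (b m)) (hS.linearIsometryEquiv.symm f) = f m := by
    intro m
    have h3 := (ContinuousLinearMap.adjoint (tL ht₁ (b m))).hasSum h1
    refine h3.unique ?_
    have h4 : ∀ n, (ContinuousLinearMap.adjoint (tL ht₁ (b m))) (V n (f n)) = if n = m then f m else 0 := by
      intro n
      refine ext_inner_left ℂ fun k => ?_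
      rw [ContinuousLinearMap.adjoint_inner_right, hV, tL_apply, te_inner ht₁, orthonormal_iff_ite.1 b.orthonormal]
      by_cases h : m = n
      · subst h; simp
      · simp [h, Ne.symm h]
    have h5 := hasSum_ite_eq m (f m)
    refine h5.congr_fun ?_
    intro n; exact h4 n
  simp only [h2]
  refine ⟨h1, ?_⟩
  rw [LinearIsometryEquiv.norm_map]
  have := lp.hasSum_norm (p := 2) (by norm_num) f
  simpa using this

lemma tensR_cont [TopologicalSpace.SeparableSpace H₁] (S : H₁ →L[ℂ] H₂) : WkContinuous (tensR ht₁ ht₂ S) := by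
  obtain ⟨w, b, hb⟩ := exists_hilbertBasis ℂ H₁
  have hw : Orthonormal ℂ ((↑) : w → H₁) := hb ▸ b.orthonormal
  have := onb_countable hw
  have ht₃ := ht_emb H₁ K₂
  refine wk_cont fun ξ η h1 h2 => ?_
  let S' := tens ht₃ ht₂ S (1 : K₂ →L[ℂ] K₂)
  let η' : ℕ → HT H₁ K₂ := fun n => ContinuousLinearMap.adjoint S' (η n)
  have h2' : Summable fun n => ‖η' n‖ ^ 2 := summable_comp _ h2
  let a : ℕ × w → K₁ := fun p => ContinuousLinearMap.adjoint (tL ht₁ (b p.2)) (ξ p.1)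
  let c : ℕ × w → K₂ := fun p => ContinuousLinearMap.adjoint (tL ht₃ (b p.2)) (η' p.1)
  have ha : Summable fun p => ‖a p‖ ^ 2 := by
    rw [summable_prod_of_nonneg (fun p => by positivity)]
    refine ⟨fun n => (te_decomp ht₁ b (ξ n)).2.summable, ?_⟩
    convert h1 using 2 with n
    exact (te_decomp ht₁ b (ξ n)).2.tsum_eq
  have hc : Summable fun p => ‖c p‖ ^ 2 := by
    rw [summable_prod_of_nonneg (fun p => by positivity)]
    refine ⟨fun n => (te_decomp ht₃ b (η' n)).2.summable, ?_⟩
    convert h2' using 2 with n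
    exact (te_decomp ht₃ b (η' n)).2.tsum_eq
  convert wk_func_cont' a c ha hc using 2 with u
  rw [(pair_summable u ha hc).tsum_prod]
  refine tsum_congr fun n => ?_
  have e : tensR ht₁ ht₂ S u = S' ∘L tens ht₁ ht₃ 1 u := by
    simp only [S', tens_comp, tensR_apply]; rfl
  rw [e]
  have h3 := (tens ht₁ ht₃ 1 u).hasSum (te_decomp ht₁ b (ξ n)).1
  have h4 := (innerSL ℂ (η' n)).hasSum h3
  have h5 : ⟪η n, (S' ∘L tens ht₁ ht₃ 1 u) (ξ n)⟫ = innerSL ℂ (η' n) (tens ht₁ ht₃ 1 u (ξ n)) := by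
    simp [η', ContinuousLinearMap.adjoint_inner_left]
  rw [h5, ← h4.tsum_eq]
  refine tsum_congr fun m => ?_
  simp [a, c, ContinuousLinearMap.adjoint_inner_left]

end Basis
end OSP
end


noncomputable section
open scoped ComplexInnerProductSpace
open scoped InnerProduct
open Set OpSynth Filter Topology
open ContinuousLinearMap (adjoint)
set_option linter.unusedVariables false
set_option linter.unusedSectionVars false
namespace OSP

section Ctrick
variable {G H : Type*}
  [NormedAddCommGroup G] [InnerProductSpace ℂ G] [CompleteSpace G]
  [NormedAddCommGroup H] [InnerProductSpace ℂ H] [CompleteSpace H]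

lemma ctrick {ι : Type*} (s : Finset ι) (S : ι → G →L[ℂ] H) {ε : ℝ} (hε : 0 < ε) :
    ∃ R : H →L[ℂ] H, adjoint R = R ∧
      (∀ A : H →L[ℂ] H, A ∘L (∑ j ∈ s, S j ∘L adjoint (S j)) = (∑ j ∈ s, S j ∘L adjoint (S j)) ∘L A → A ∘L R = R ∘L A) ∧
      (1 - (∑ j ∈ s, S j ∘L adjoint (S j)) ∘L R = (ε : ℂ) • R) ∧ 
      (1 - R ∘L (∑ j ∈ s, S j ∘L adjoint (S j)) = (ε : ℂ) • R) ∧ ‖(ε : ℂ) • R‖ ≤ 1 ∧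
      ∀ j ∈ s, ∀ x, ‖((ε : ℂ) • R) (S j x)‖ ≤ Real.sqrt ε * ‖x‖ := by
  set c := ∑ j ∈ s, S j ∘L adjoint (S j) with hc
  have hcsa : adjoint c = c := by
    rw [hc, map_sum]
    refine Finset.sum_congr rfl fun j _ => ?_
    rw [ContinuousLinearMap.adjoint_comp, ContinuousLinearMap.adjoint_adjoint]
  have hci : ∀ w, ⟪w, c w⟫ = ((∑ j ∈ s, ‖adjoint (S j) w‖ ^ 2 : ℝ) : ℂ) := by
    intro w
    rw [hc, sum_apply, inner_sum, Complex.ofReal_sum]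
    refine Finset.sum_congr rfl fun j _ => ?_
    rw [ContinuousLinearMap.comp_apply, ← ContinuousLinearMap.adjoint_inner_left, inner_self_eq_norm_sq_to_K]
    push_cast; rfl
  have hpos : (0 : H →L[ℂ] H) ≤ c := by
    rw [ContinuousLinearMap.nonneg_iff_isPositive]
    refine ContinuousLinearMap.isPositive_def'.2 ⟨hcsa, fun x => ?_⟩
    rw [ContinuousLinearMap.reApplyInnerSelf_apply, ← inner_re_symm, hci]
    simp only [RCLike.re_to_complex, Complex.ofReal_re]
    exact Finset.sum_nonneg fun _ _ => by positivity
  have hu : IsUnit ((ε : ℂ) • (1 : H →L[ℂ] H) + c) := by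
    refine CStarAlgebra.isUnit_of_le ((ε : ℂ) • (1 : H →L[ℂ] H)) (le_add_of_nonneg_right hpos) ⟨?_, ?_⟩
    · rw [ContinuousLinearMap.nonneg_iff_isPositive]
      exact ContinuousLinearMap.isPositive_one.smul_of_nonneg (by exact_mod_cast hε.le)
    · exact isUnit_one.smul (Units.mk0 (ε : ℂ) (by exact_mod_cast hε.ne'))
  obtain ⟨u, hu⟩ := hu
  have h1 : ((ε : ℂ) • (1 : H →L[ℂ] H) + c) ∘L (↑u⁻¹ : H →L[ℂ] H) = 1 := by rw [← hu]; exact u.mul_inv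
  have h2 : (↑u⁻¹ : H →L[ℂ] H) ∘L ((ε : ℂ) • (1 : H →L[ℂ] H) + c) = 1 := by rw [← hu]; exact u.inv_mul
  generalize (↑u⁻¹ : H →L[ℂ] H) = R at h1 h2
  have k1 : ∀ y, (ε : ℂ) • R y + c (R y) = y := fun y => by simpa using DFunLike.congr_fun h1 y
  have k2 : ∀ y, R ((ε : ℂ) • y + c y) = y := fun y => by simpa using DFunLike.congr_fun h2 y
  have k3 : ∀ y, ε * ‖R y‖ ^ 2 + ∑ j ∈ s, ‖adjoint (S j) (R y)‖ ^ 2 = (⟪R y, y⟫ : ℂ).re := by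
    intro y
    conv_rhs => rw [← k1 y]
    have e : R (((ε : ℂ) • R y + c (R y))) = R y := by rw [k1]
    rw [e, inner_add_right, hci, inner_smul_right, inner_self_eq_norm_sq_to_K, Complex.add_re, Complex.ofReal_re]
    congr 1
    rw [Complex.re_ofReal_mul]
    norm_cast
  refine ⟨R, ?_, ?_, ?_, ?_, ?_, ?_⟩
  · have h3 : ((ε : ℂ) • (1 : H →L[ℂ] H) + c) ∘L adjoint R = 1 := by
      have := congrArg adjoint h2
      rw [ContinuousLinearMap.adjoint_comp, map_add, hcsa, map_smulₛₗ, ContinuousLinearMap.adjoint_one, Complex.conj_ofReal] at this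
      exact this
    calc adjoint R = (R ∘L ((ε : ℂ) • (1 : H →L[ℂ] H) + c)) ∘L adjoint R := by rw [h2]; rfl
      _ = R ∘L (((ε : ℂ) • (1 : H →L[ℂ] H) + c) ∘L adjoint R) := rfl
      _ = R := by rw [h3]; rfl
  · intro A hA
    have hA' : ∀ y, A (c y) = c (A y) := fun y => DFunLike.congr_fun hA y
    ext y
    have : A (R y) = R ((ε : ℂ) • A (R y) + c (A (R y))) := (k2 _).symm
    simp only [ContinuousLinearMap.comp_apply]
    rw [this, ← hA', ← map_smul, ← map_add, k1]
  · ext y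
    have := k1 y
    simp only [sub_apply, one_apply_eq_self, ContinuousLinearMap.comp_apply, smul_apply]
    rw [sub_eq_iff_eq_add, this]
  · ext y
    have := k2 y
    simp only [sub_apply, one_apply_eq_self, ContinuousLinearMap.comp_apply, smul_apply]
    rw [sub_eq_iff_eq_add, ← map_smul, ← map_add, this]
  · refine ContinuousLinearMap.opNorm_le_bound _ zero_le_one fun y => ?_
    have h3 := k3 y
    have h4 : (⟪R y, y⟫ : ℂ).re ≤ ‖R y‖ * ‖y‖ := re_inner_le_norm (𝕜 := ℂ) _ _
    have h5 : 0 ≤ ∑ j ∈ s, ‖adjoint (S j) (R y)‖ ^ 2 := Finset.sum_nonneg fun _ _ => by positivity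
    rw [smul_apply, norm_smul, Complex.norm_real, Real.norm_of_nonneg hε.le]
    rcases eq_or_lt_of_le (norm_nonneg (R y)) with h | h
    · rw [← h]; simp
    · have : (ε * ‖R y‖) * ‖R y‖ ≤ ‖y‖ * ‖R y‖ := by nlinarith
      have := le_of_mul_le_mul_right this h
      linarith
  · intro j hj x
    have h3 := k3 (S j x)
    have h4 : (⟪R (S j x), S j x⟫ : ℂ).re ≤ ‖adjoint (S j) (R (S j x))‖ * ‖x‖ := by
      rw [← ContinuousLinearMap.adjoint_inner_left]
      exact re_inner_le_norm (𝕜 := ℂ) _ _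
    have h5 : ‖adjoint (S j) (R (S j x))‖ ^ 2 ≤ ∑ i ∈ s, ‖adjoint (S i) (R (S j x))‖ ^ 2 :=
      Finset.single_le_sum (f := fun i => ‖adjoint (S i) (R (S j x))‖ ^ 2) (fun _ _ => by positivity) hj
    rw [smul_apply, norm_smul, Complex.norm_real, Real.norm_of_nonneg hε.le]
    refine abs_le_of_sq_le_sq' ?_ (by positivity) |>.2
    rw [mul_pow, mul_pow, Real.sq_sqrt hε.le]
    have h6 : ε * ‖R (S j x)‖ ^ 2 ≤ ‖x‖ ^ 2 := by
      nlinarith [sq_nonneg (‖adjoint (S j) (R (S j x))‖ - ‖x‖ / 2), sq_nonneg ‖x‖]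
    nlinarith

end Ctrick
end OSP
end


noncomputable section
open scoped ComplexInnerProductSpace
open scoped InnerProduct
open Set OpSynth Filter Topology
open ContinuousLinearMap (adjoint)
set_option linter.unusedVariables false
set_option linter.unusedSectionVars false
namespace OSP

section Cyc
variable {H : Type*} [NormedAddCommGroup H] [InnerProductSpace ℂ H] [CompleteSpace H]

lemma _root_.OpSynth.IsProj.adj {p : H →L[ℂ] H} (hp : IsProj p) : adjoint p = p := hp.2.adjoint_eq

lemma proj_comm (M : Submodule ℂ H) [M.HasOrthogonalProjection] {E : H →L[ℂ] H} (hE : adjoint E = E)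
    (h : ∀ x ∈ M, E x ∈ M) : E ∘L M.starProjection = M.starProjection ∘L E := by
  have h1 : M.starProjection ∘L E ∘L M.starProjection = E ∘L M.starProjection := by
    ext x
    exact Submodule.starProjection_eq_self_iff.2 (h _ (Submodule.starProjection_apply_mem _ _))
  have hs : adjoint M.starProjection = M.starProjection := (isSelfAdjoint_starProjection M).adjoint_eq
  have h2 := congrArg adjoint h1
  simp only [ContinuousLinearMap.adjoint_comp, hE, hs] at h2
  rw [← h1, ← h2]; rfl

lemma starProj_isProj (M : Submodule ℂ H) [M.HasOrthogonalProjection] : IsProj M.starProjection :=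
  ⟨M.isIdempotentElem_starProjection, isSelfAdjoint_starProjection M⟩

/-- cyclic subspace -/
def cyc (𝓔 : Set (H →L[ℂ] H)) (ξ : H) : Submodule ℂ H :=
  (Submodule.span ℂ {z | ∃ W ∈ Submonoid.closure 𝓔, z = W ξ}).topologicalClosure

instance (𝓔 : Set (H →L[ℂ] H)) (ξ : H) : CompleteSpace (cyc 𝓔 ξ) := by
  unfold cyc; infer_instance

/-- cyclic projection -/
def pc (𝓔 : Set (H →L[ℂ] H)) (ξ : H) : H →L[ℂ] H := (cyc 𝓔 ξ).starProjection

lemma pc_proj (𝓔 : Set (H →L[ℂ] H)) (ξ : H) : IsProj (pc 𝓔 ξ) := starProj_isProj _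

lemma mem_cyc {𝓔 : Set (H →L[ℂ] H)} {ξ : H} {W : H →L[ℂ] H} (hW : W ∈ Submonoid.closure 𝓔) : W ξ ∈ cyc 𝓔 ξ :=
  Submodule.le_topologicalClosure _ (Submodule.subset_span ⟨W, hW, rfl⟩)

lemma pc_of_mem {𝓔 : Set (H →L[ℂ] H)} {ξ x : H} (h : x ∈ cyc 𝓔 ξ) : pc 𝓔 ξ x = x :=
  Submodule.starProjection_eq_self_iff.2 h

lemma pc_self (𝓔 : Set (H →L[ℂ] H)) (ξ : H) : pc 𝓔 ξ ξ = ξ :=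
  pc_of_mem (mem_cyc (W := 1) (Submonoid.one_mem _))

lemma pc_of_orth {𝓔 : Set (H →L[ℂ] H)} {ξ x : H} (h : x ∈ (cyc 𝓔 ξ)ᗮ) : pc 𝓔 ξ x = 0 :=
  (Submodule.starProjection_apply_eq_zero_iff _).2 h

lemma pc_comm {𝓔 : Set (H →L[ℂ] H)} (h𝓔 : ∀ E ∈ 𝓔, adjoint E = E) (ξ : H) {E : H →L[ℂ] H} (hE : E ∈ 𝓔) :
    E ∘L pc 𝓔 ξ = pc 𝓔 ξ ∘L E := by
  refine proj_comm _ (h𝓔 E hE) ?_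
  intro x hx
  have : cyc 𝓔 ξ ≤ (cyc 𝓔 ξ).comap (E : H →ₗ[ℂ] H) := by
    refine Submodule.topologicalClosure_minimal _ ?_ ?_
    · rw [Submodule.span_le]
      rintro _ ⟨W, hW, rfl⟩
      exact mem_cyc (W := E * W) (Submonoid.mul_mem _ (Submonoid.subset_closure hE) hW)
    · exact (Submodule.isClosed_topologicalClosure _).preimage E.continuous
  exact this hx

/-- the test set -/
def cycTest (𝓔 : Set (H →L[ℂ] H)) (ξ : H) : Set H := {z | ∃ W ∈ Submonoid.closure 𝓔, z = W ξ} ∪ ((cyc 𝓔 ξ)ᗮ : Submodule ℂ H)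

lemma cycTest_total (𝓔 : Set (H →L[ℂ] H)) (ξ : H) : (Submodule.span ℂ (cycTest 𝓔 ξ)).topologicalClosure = ⊤ := by
  rw [eq_top_iff]
  have h1 : cyc 𝓔 ξ ≤ (Submodule.span ℂ (cycTest 𝓔 ξ)).topologicalClosure :=
    Submodule.topologicalClosure_mono (Submodule.span_mono subset_union_left)
  have h2 : (cyc 𝓔 ξ)ᗮ ≤ (Submodule.span ℂ (cycTest 𝓔 ξ)).topologicalClosure :=
    fun x hx => Submodule.le_topologicalClosure _ (Submodule.subset_span (Or.inr hx))
  rw [← Submodule.sup_orthogonal_of_hasOrthogonalProjection (K := cyc 𝓔 ξ)]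
  exact sup_le h1 h2

lemma closure_fin {M : Type*} [Monoid M] {S : Set M} {W : M} (hW : W ∈ Submonoid.closure S) :
    ∃ F : Finset M, ↑F ⊆ S ∧ W ∈ Submonoid.closure (F : Set M) := by
  classical
  induction hW using Submonoid.closure_induction with
  | mem x hx => exact ⟨{x}, by simpa using hx, Submonoid.subset_closure (by simp)⟩
  | one => exact ⟨∅, by simp, Submonoid.one_mem _⟩
  | mul x y _ _ hx hy =>
    obtain ⟨F, h1, h2⟩ := hx
    obtain ⟨G, h3, h4⟩ := hy
    refine ⟨F ∪ G, by simp [h1, h3], Submonoid.mul_mem _ ?_ ?_⟩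
    · exact Submonoid.closure_mono (by simp) h2
    · exact Submonoid.closure_mono (by simp) h4

lemma exists_part (𝓕 : Finset (H →L[ℂ] H)) (hp : ∀ E ∈ 𝓕, IsProj E) (hc : ∀ E ∈ 𝓕, ∀ E' ∈ 𝓕, E * E' = E' * E) :
    ∃ (ι : Type) (_ : Fintype ι) (g : ι → H →L[ℂ] H), (∀ i, g i ∈ Algebra.adjoin ℂ (𝓕 : Set (H →L[ℂ] H))) ∧
      (∀ i, IsProj (g i)) ∧ (∀ i j, i ≠ j → g i * g j = 0) ∧ (∑ i, g i = 1) ∧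
      ∀ E ∈ 𝓕, ∀ i, E * g i = g i ∨ E * g i = 0 := by
  classical
  induction 𝓕 using Finset.induction_on with
  | empty =>
    refine ⟨Unit, inferInstance, fun _ => 1, fun _ => Subalgebra.one_mem _, fun _ => ⟨by ext; rfl, by simp [IsSelfAdjoint]⟩, ?_, by simp, by simp⟩
    intro i j hij; exact absurd (Subsingleton.elim i j) hij
  | insert E 𝓕 hE ih =>
    obtain ⟨ι, hι, g, h1, h2, h3, h4, h5⟩ := ih (fun E h => hp E (Finset.mem_insert_of_mem h))
      (fun E h E' h' => hc E (Finset.mem_insert_of_mem h) E' (Finset.mem_insert_of_mem h'))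
    have hEp := hp E (Finset.mem_insert_self _ _)
    have hEE : E * E = E := hEp.1
    have hcg : ∀ i, E * g i = g i * E := by
      intro i
      have : Algebra.adjoin ℂ (𝓕 : Set (H →L[ℂ] H)) ≤ Subalgebra.centralizer ℂ {E} := by
        rw [Algebra.adjoin_le_iff]
        intro E' hE'
        rw [SetLike.mem_coe, Subalgebra.mem_centralizer_iff]
        rintro _ rfl
        exact hc _ (Finset.mem_insert_self _ _) _ (Finset.mem_insert_of_mem hE')
      exact (Subalgebra.mem_centralizer_iff ℂ).1 (this (h1 i)) E rfl
    let e : Bool → H →L[ℂ] H := fun b => if b then E else 1 - E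
    have hee : ∀ b, e b * e b = e b := by
      intro b; cases b
      · simp [e, mul_sub, sub_mul, hEE]
      · simp [e, hEE]
    have hee' : ∀ b b', b ≠ b' → e b * e b' = 0 := by
      intro b b' h; cases b <;> cases b' <;> simp_all [e, mul_sub, sub_mul, hEE]
    have hes : ∀ b, IsSelfAdjoint (e b) := by
      intro b; cases b
      · simpa [e] using (IsSelfAdjoint.one _).sub hEp.2
      · simpa [e] using hEp.2
    have hec : ∀ b i, e b * g i = g i * e b := by
      intro b i; cases b
      · simp [e, mul_sub, sub_mul, hcg]
      · simp [e, hcg]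
    have hgg : ∀ i, g i * g i = g i := fun i => (h2 i).1
    have hprod : ∀ b b' i j, (e b * g i) * (e b' * g j) = (e b * e b') * (g i * g j) := by
      intro b b' i j
      rw [mul_assoc, ← mul_assoc (g i), ← hec, mul_assoc, mul_assoc]
    refine ⟨ι × Bool, inferInstance, fun x => e x.2 * g x.1, ?_, ?_, ?_, ?_, ?_⟩
    · rintro ⟨i, b⟩
      refine Subalgebra.mul_mem _ ?_ (Algebra.adjoin_mono (by simp) (h1 i))
      have : E ∈ Algebra.adjoin ℂ ((insert E 𝓕 : Finset (H →L[ℂ] H)) : Set (H →L[ℂ] H)) := Algebra.subset_adjoin (by simp)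
      cases b
      · simpa [e] using Subalgebra.sub_mem _ (Subalgebra.one_mem _) (by simpa using this)
      · simpa [e] using this
    · rintro ⟨i, b⟩
      refine ⟨?_, ?_⟩
      · show (e b * g i) * (e b * g i) = e b * g i
        rw [hprod, hee, hgg]
      · show star (e b * g i) = e b * g i
        rw [star_mul, (hes b).star_eq, (h2 i).2.star_eq, hec]
    · rintro ⟨i, b⟩ ⟨j, b'⟩ hij
      show (e b * g i) * (e b' * g j) = 0
      rw [hprod]
      by_cases h : i = j
      · have : b ≠ b' := by rintro rfl; exact hij (by rw [h])
        rw [hee' _ _ this, zero_mul]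
      · rw [h3 _ _ h, mul_zero]
    · rw [Fintype.sum_prod_type]
      simp only [Fintype.sum_bool, e, if_true]
      refine (Finset.sum_congr rfl fun i _ => ?_).trans h4
      simp [sub_mul]
    · intro E' hE' ⟨i, b⟩
      rcases Finset.mem_insert.1 hE' with rfl | h
      · cases b
        · right; simp [e, ← mul_assoc, mul_sub, hEE]
        · left; simp [e, ← mul_assoc, hEE]
      · show E' * (e b * g i) = e b * g i ∨ E' * (e b * g i) = 0
        have : E' * (e b * g i) = e b * (E' * g i) := by
          have hcc : E' * e b = e b * E' := by
            have := hc E (Finset.mem_insert_self _ _) E' hE'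
            cases b
            · simp [e, mul_sub, sub_mul, this]
            · simp [e, this]
          rw [← mul_assoc, hcc, mul_assoc]
        rw [this]
        rcases h5 E' h i with h | h
        · left; rw [h]
        · right; rw [h, mul_zero]

end Cyc
end OSP
end


noncomputable section
open scoped ComplexInnerProductSpace
open scoped InnerProduct
open Set OpSynth Filter Topology
open ContinuousLinearMap (adjoint)
set_option linter.unusedVariables false
set_option linter.unusedSectionVars false
namespace OSP
section NB
variable {T T' : Type*} [NormedAddCommGroup T] [InnerProductSpace ℂ T] [CompleteSpace T]
 [NormedAddCommGroup T'] [InnerProductSpace ℂ T'] [CompleteSpace T']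

lemma norm_sum_sq {ι : Type*} (s : Finset ι) (v : ι → T) (h : ∀ i ∈ s, ∀ j ∈ s, i ≠ j → ⟪v i, v j⟫ = 0) :
    ‖∑ i ∈ s, v i‖ ^ 2 = ∑ i ∈ s, ‖v i‖ ^ 2 := by
  classical
  induction s using Finset.induction_on with
  | empty => simp
  | insert a s ha ih =>
    rw [Finset.sum_insert ha, Finset.sum_insert ha, ← ih (fun i hi j hj => h i (Finset.mem_insert_of_mem hi) j (Finset.mem_insert_of_mem hj))]
    have : ⟪v a, ∑ i ∈ s, v i⟫ = 0 := by
      rw [inner_sum]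
      exact Finset.sum_eq_zero fun i hi => h _ (Finset.mem_insert_self _ _) _ (Finset.mem_insert_of_mem hi) (by rintro rfl; exact ha hi)
    have := norm_add_sq_eq_norm_sq_add_norm_sq_of_inner_eq_zero _ _ this
    nlinarith

lemma norm_block {ι : Type*} (s : Finset ι) (A : ι → T →L[ℂ] T') (P : ι → T →L[ℂ] T) {C : ℝ} (hC : 0 ≤ C)
    (hP : ∀ w, ∑ i ∈ s, ‖P i w‖ ^ 2 ≤ ‖w‖ ^ 2) (hA : ∀ i ∈ s, ∀ w, ‖A i w‖ ≤ C * ‖P i w‖)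
    (ho : ∀ i ∈ s, ∀ j ∈ s, i ≠ j → ∀ w, ⟪A i w, A j w⟫ = 0) : ‖∑ i ∈ s, A i‖ ≤ C := by
  refine ContinuousLinearMap.opNorm_le_bound _ hC fun w => ?_
  rw [sum_apply]
  refine le_of_sq_le_sq ?_ (by positivity)
  rw [norm_sum_sq s _ (fun i hi j hj hij => ho i hi j hj hij w), mul_pow]
  calc ∑ i ∈ s, ‖A i w‖ ^ 2 ≤ ∑ i ∈ s, C ^ 2 * ‖P i w‖ ^ 2 := by
        refine Finset.sum_le_sum fun i hi => ?_
        rw [← mul_pow]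
        exact pow_le_pow_left₀ (norm_nonneg _) (hA i hi w) 2
    _ = C ^ 2 * ∑ i ∈ s, ‖P i w‖ ^ 2 := by rw [Finset.mul_sum]
    _ ≤ _ := mul_le_mul_of_nonneg_left (hP w) (by positivity)

lemma _root_.OpSynth.IsProj.app {p : T →L[ℂ] T} (hp : IsProj p) (x : T) : p (p x) = p x := congrArg (· x) hp.1
lemma _root_.OpSynth.IsProj.inner {p : T →L[ℂ] T} (hp : IsProj p) (x y : T) : ⟪p x, y⟫ = ⟪x, p y⟫ := by
  conv_lhs => rw [← hp.adj]
  rw [ContinuousLinearMap.adjoint_inner_left]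

lemma _root_.OpSynth.IsProj.norm_le {p : T →L[ℂ] T} (hp : IsProj p) (x : T) : ‖p x‖ ≤ ‖x‖ := by
  have h1 : ‖p x‖ ^ 2 = RCLike.re ⟪x, p x⟫ := by
    rw [← inner_self_eq_norm_sq (𝕜 := ℂ), hp.inner, hp.app]
  have h2 : RCLike.re ⟪x, p x⟫ ≤ ‖x‖ * ‖p x‖ := (RCLike.re_le_norm _).trans (norm_inner_le_norm _ _)
  rcases eq_or_lt_of_le (norm_nonneg (p x)) with h | h
  · rw [← h]; positivity
  · nlinarith
lemma _root_.OpSynth.IsProj.norm_le_one {p : T →L[ℂ] T} (hp : IsProj p) : ‖p‖ ≤ 1 :=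
  p.opNorm_le_bound zero_le_one fun x => by simpa using hp.norm_le x

lemma proj_sum_sq {ι : Type*} (s : Finset ι) (P : ι → T →L[ℂ] T) (hp : ∀ i ∈ s, IsProj (P i))
    (ho : ∀ i ∈ s, ∀ j ∈ s, i ≠ j → P i ∘L P j = 0) (w : T) : ∑ i ∈ s, ‖P i w‖ ^ 2 ≤ ‖w‖ ^ 2 := by
  have h1 : ‖∑ i ∈ s, P i w‖ ^ 2 = ∑ i ∈ s, ‖P i w‖ ^ 2 := by
    refine norm_sum_sq s _ fun i hi j hj hij => ?_
    rw [(hp i hi).inner, show P i (P j w) = (P i ∘L P j) w from rfl, ho i hi j hj hij]; simp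
  have h2 : RCLike.re ⟪w, ∑ i ∈ s, P i w⟫ = ∑ i ∈ s, ‖P i w‖ ^ 2 := by
    rw [inner_sum, map_sum]
    refine Finset.sum_congr rfl fun i hi => ?_
    rw [← inner_self_eq_norm_sq (𝕜 := ℂ), (hp i hi).inner, (hp i hi).app]
  have h3 : RCLike.re ⟪w, ∑ i ∈ s, P i w⟫ ≤ ‖w‖ * ‖∑ i ∈ s, P i w‖ := (RCLike.re_le_norm _).trans (norm_inner_le_norm _ _)
  rw [← h1]
  rw [h2, ← h1] at h3
  refine pow_le_pow_left₀ (norm_nonneg _) ?_ 2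
  rcases eq_or_lt_of_le (norm_nonneg (∑ i ∈ s, P i w)) with h | h
  · rw [← h]; positivity
  · nlinarith
end NB

section ST
variable {H K₁ K₂ T₁ T₃ : Type*}
  [NormedAddCommGroup H] [InnerProductSpace ℂ H] [CompleteSpace H]
  [NormedAddCommGroup K₁] [InnerProductSpace ℂ K₁] [CompleteSpace K₁]
  [NormedAddCommGroup K₂] [InnerProductSpace ℂ K₂] [CompleteSpace K₂]
  [NormedAddCommGroup T₁] [InnerProductSpace ℂ T₁] [CompleteSpace T₁]
  [NormedAddCommGroup T₃] [InnerProductSpace ℂ T₃] [CompleteSpace T₃]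
  {t₁ : H → K₁ → T₁} {t₃ : H → K₂ → T₃}
  (ht₁ : IsTensorEmbedding t₁) (ht₃ : IsTensorEmbedding t₃)
include ht₁ ht₃

omit ht₃ in
lemma te_total_of {A : Set H} (hA : (Submodule.span ℂ A).topologicalClosure = ⊤) :
    (Submodule.span ℂ {z | ∃ x ∈ A, ∃ k, z = t₁ x k}).topologicalClosure = ⊤ := by
  rw [eq_top_iff, ← te_total ht₁]
  refine Submodule.topologicalClosure_minimal _ ?_ (Submodule.isClosed_topologicalClosure _)
  rw [Submodule.span_le]
  rintro _ ⟨x, k, rfl⟩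
  have : (Submodule.span ℂ A).topologicalClosure ≤ (Submodule.span ℂ {z | ∃ x ∈ A, ∃ k, z = t₁ x k}).topologicalClosure.comap (tR ht₁ k : H →ₗ[ℂ] T₁) := by
    refine Submodule.topologicalClosure_minimal _ ?_ ((Submodule.isClosed_topologicalClosure _).preimage (tR ht₁ k).continuous)
    rw [Submodule.span_le]
    intro x hx
    exact Submodule.le_topologicalClosure _ (Submodule.subset_span ⟨x, hx, k, by simp⟩)
  have h2 := this (show x ∈ _ by rw [hA]; trivial)
  exact h2

omit ht₃ in
lemma amp_proj {E : H →L[ℂ] H} (hE : IsProj E) : IsProj (amp ht₁ E) :=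
  ⟨by rw [amp_comp, hE.1], by
    rw [ContinuousLinearMap.isSelfAdjoint_iff', amp_adjoint, hE.adj]⟩

lemma norm_slice_le (x y : H) (Z : T₁ →L[ℂ] T₃) : ‖slice ht₁ ht₃ x y Z‖ ≤ ‖Z‖ * (‖x‖ * ‖y‖) := by
  refine ContinuousLinearMap.opNorm_le_bound _ (by positivity) fun k => ?_
  have h : ‖slice ht₁ ht₃ x y Z k‖ ^ 2 ≤ ‖Z‖ * (‖x‖ * ‖y‖) * ‖k‖ * ‖slice ht₁ ht₃ x y Z k‖ := by
    rw [← inner_self_eq_norm_sq (𝕜 := ℂ), inner_slice]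
    refine (RCLike.re_le_norm _).trans ((norm_inner_le_norm _ _).trans ?_)
    refine (mul_le_mul_of_nonneg_left (Z.le_opNorm _) (norm_nonneg _)).trans ?_
    rw [te_norm ht₁, te_norm ht₃]
    exact le_of_eq (by ring)
  rcases eq_or_lt_of_le (norm_nonneg (slice ht₁ ht₃ x y Z k)) with h' | h'
  · rw [← h']; positivity
  · nlinarith

/-- step 3 core -/
lemma step3' {𝓔 : Set (H →L[ℂ] H)} (hp : ∀ E ∈ 𝓔, IsProj E) (hc : ∀ E ∈ 𝓔, ∀ E' ∈ 𝓔, E * E' = E' * E)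
    (ξ : H) (Z : T₁ →L[ℂ] T₃) (hZ : ∀ E ∈ 𝓔, amp ht₃ E ∘L Z = Z ∘L amp ht₁ E)
    {Ub : Submodule ℂ (K₁ →L[ℂ] K₂)} (hs : ∀ x y, slice ht₁ ht₃ x y Z ∈ Ub)
    (h1 : Z ∘L amp ht₁ (pc 𝓔 ξ) = Z) (h2 : amp ht₃ (pc 𝓔 ξ) ∘L Z = Z)
    {N : Submodule ℂ (T₁ →L[ℂ] T₃)} (hN : WkClosed (N : Set (T₁ →L[ℂ] T₃)))
    (hT : ∀ g ∈ Algebra.adjoin ℂ 𝓔, ∀ u ∈ Ub, tens ht₁ ht₃ (pc 𝓔 ξ ∘L g ∘L pc 𝓔 ξ) u ∈ N) : Z ∈ N := by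
  classical
  refine mem_of_approx hN ‖Z‖ (te_total_of ht₁ (cycTest_total 𝓔 ξ)) (te_total_of ht₃ (cycTest_total 𝓔 ξ)) ?_
  intro s hs' t ht' ε hε
  -- choose finite family
  have key : ∀ z ∈ cycTest 𝓔 ξ, ∃ F : Finset (H →L[ℂ] H), ↑F ⊆ 𝓔 ∧ (z ∈ (cyc 𝓔 ξ)ᗮ ∨ ∃ W ∈ Submonoid.closure (F : Set (H →L[ℂ] H)), z = W ξ) := by
    rintro z (⟨W, hW, rfl⟩ | hz)
    · obtain ⟨F, hF, hF'⟩ := closure_fin hW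
      exact ⟨F, hF, Or.inr ⟨W, hF', rfl⟩⟩
    · exact ⟨∅, by simp, Or.inl hz⟩
  have key1 : ∀ w : T₁, ∃ F : Finset (H →L[ℂ] H), ↑F ⊆ 𝓔 ∧ (w ∈ s → ∃ x k, w = t₁ x k ∧ (x ∈ (cyc 𝓔 ξ)ᗮ ∨ ∃ W ∈ Submonoid.closure (F : Set (H →L[ℂ] H)), x = W ξ)) := by
    intro w
    by_cases hw : w ∈ s
    · obtain ⟨x, hx, k, rfl⟩ := hs' hw
      obtain ⟨F, hF, h⟩ := key x hx
      exact ⟨F, hF, fun _ => ⟨x, k, rfl, h⟩⟩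
    · exact ⟨∅, by simp, fun h => absurd h hw⟩
  have key2 : ∀ w : T₃, ∃ F : Finset (H →L[ℂ] H), ↑F ⊆ 𝓔 ∧ (w ∈ t → ∃ x k, w = t₃ x k ∧ (x ∈ (cyc 𝓔 ξ)ᗮ ∨ ∃ W ∈ Submonoid.closure (F : Set (H →L[ℂ] H)), x = W ξ)) := by
    intro w
    by_cases hw : w ∈ t
    · obtain ⟨x, hx, k, rfl⟩ := ht' hw
      obtain ⟨F, hF, h⟩ := key x hx
      exact ⟨F, hF, fun _ => ⟨x, k, rfl, h⟩⟩
    · exact ⟨∅, by simp, fun h => absurd h hw⟩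
  choose F1 hF1 hF1' using key1
  choose F2 hF2 hF2' using key2
  let 𝓕 : Finset (H →L[ℂ] H) := s.biUnion F1 ∪ t.biUnion F2
  have h𝓕 : ↑𝓕 ⊆ 𝓔 := by
    intro E hE
    simp only [𝓕, Finset.coe_union, Finset.coe_biUnion, Set.mem_union, Set.mem_iUnion] at hE
    rcases hE with ⟨w, _, h⟩ | ⟨w, _, h⟩
    · exact hF1 _ h
    · exact hF2 _ h
  obtain ⟨ι, hι, g, hg1, hg2, hg3, hg4, hg5⟩ := exists_part 𝓕 (fun E hE => hp E (h𝓕 hE)) (fun E hE E' hE' => hc E (h𝓕 hE) E' (h𝓕 hE'))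
  have hg1' : ∀ i, g i ∈ Algebra.adjoin ℂ 𝓔 := fun i => Algebra.adjoin_mono h𝓕 (hg1 i)
  have hgo : ∀ i j, i ≠ j → g i ∘L g j = 0 := hg3
  -- words
  have hword : ∀ W ∈ Submonoid.closure (𝓕 : Set (H →L[ℂ] H)), ∀ i, ∃ α : ℂ, W ∘L g i = α • g i := by
    intro W hW
    induction hW using Submonoid.closure_induction with
    | mem E hE =>
      intro i
      rcases hg5 E hE i with h | h
      · exact ⟨1, by rw [one_smul]; exact h⟩
      · exact ⟨0, by rw [zero_smul]; exact h⟩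
    | one => exact fun i => ⟨1, by rw [one_smul]; rfl⟩
    | mul a b _ _ ha hb =>
      intro i
      obtain ⟨α, hα⟩ := ha i
      obtain ⟨β, hβ⟩ := hb i
      refine ⟨β * α, ?_⟩
      show a ∘L (b ∘L g i) = _
      rw [hβ, ContinuousLinearMap.comp_smul, hα, smul_smul]
  have hcomm : ∀ W ∈ Submonoid.closure (𝓕 : Set (H →L[ℂ] H)), ∀ i, W ∘L g i = g i ∘L W := by
    intro W hW i
    have hle : Algebra.adjoin ℂ 𝓔 ≤ Subalgebra.centralizer ℂ 𝓔 := by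
      rw [Algebra.adjoin_le_iff]
      intro E' hE'
      rw [SetLike.mem_coe, Subalgebra.mem_centralizer_iff]
      exact fun E hE => hc E hE E' hE'
    have hgi := (Subalgebra.mem_centralizer_iff ℂ).1 (hle (hg1' i))
    induction hW using Submonoid.closure_induction with
    | mem E hE => exact hgi E (h𝓕 hE)
    | one => rfl
    | mul a b _ _ ha hb =>
      show a ∘L (b ∘L g i) = (g i ∘L a) ∘L b
      rw [hb, ← ha]; rfl
  have hgW : ∀ W ∈ Submonoid.closure (𝓕 : Set (H →L[ℂ] H)), ∀ i, ∃ α : ℂ, g i (W ξ) = α • g i ξ := by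
    intro W hW i
    obtain ⟨α, hα⟩ := hword W hW i
    refine ⟨α, ?_⟩
    rw [show g i (W ξ) = (g i ∘L W) ξ from rfl, ← hcomm W hW i, hα]; rfl
  have hZg : ∀ i, amp ht₃ (g i) ∘L Z = Z ∘L amp ht₁ (g i) := by
    intro i
    refine Algebra.adjoin_induction (p := fun a _ => amp ht₃ a ∘L Z = Z ∘L amp ht₁ a) (fun E hE => hZ E hE) ?_ ?_ ?_ (hg1' i)
    · intro c
      rw [Algebra.algebraMap_eq_smul_one, amp_smul, amp_smul, amp_one, amp_one, ContinuousLinearMap.smul_comp, ContinuousLinearMap.comp_smul]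
      rfl
    · intro a b _ _ ha hb
      rw [amp_add, amp_add, ContinuousLinearMap.add_comp, ContinuousLinearMap.comp_add, ha, hb]
    · intro a b _ _ ha hb
      show amp ht₃ (a ∘L b) ∘L Z = Z ∘L amp ht₁ (a ∘L b)
      rw [← amp_comp, ← amp_comp, ContinuousLinearMap.comp_assoc, hb, ← ContinuousLinearMap.comp_assoc, ha, ContinuousLinearMap.comp_assoc]
  let u : ι → K₁ →L[ℂ] K₂ := fun i => ((‖g i ξ‖ ^ 2 : ℝ) : ℂ)⁻¹ • slice ht₁ ht₃ (g i ξ) (g i ξ) Z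
  have hu : ∀ i, u i ∈ Ub := fun i => Ub.smul_mem _ (hs _ _)
  have hun : ∀ i, ‖u i‖ ≤ ‖Z‖ := by
    intro i
    simp only [u, norm_smul, norm_inv, Complex.norm_real, norm_pow, norm_norm]
    rcases eq_or_ne (g i ξ) 0 with h | h
    · simp [h]
    · have := norm_slice_le ht₁ ht₃ (g i ξ) (g i ξ) Z
      have hpos : 0 < ‖g i ξ‖ := norm_pos_iff.2 h
      rw [inv_mul_le_iff₀ (by positivity)]
      nlinarith
  have hus : ∀ i, ((‖g i ξ‖ ^ 2 : ℝ) : ℂ) • u i = slice ht₁ ht₃ (g i ξ) (g i ξ) Z := by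
    intro i
    rcases eq_or_ne (g i ξ) 0 with h | h
    · have : slice ht₁ ht₃ (g i ξ) (g i ξ) Z = 0 := by
        have := norm_slice_le ht₁ ht₃ (g i ξ) (g i ξ) Z
        rw [h, norm_zero, mul_zero, mul_zero] at this
        rw [h]; exact norm_le_zero_iff.1 this
      rw [this, h]; simp
    · simp only [u]
      rw [smul_smul, mul_inv_cancel₀, one_smul]
      simpa using h
  let A : ι → T₁ →L[ℂ] T₃ := fun i => tens ht₁ ht₃ (g i) (u i)
  have hAn : ‖∑ i, A i‖ ≤ ‖Z‖ := by
    refine norm_block Finset.univ A (fun i => amp ht₁ (g i)) (norm_nonneg _) ?_ ?_ ?_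
    · refine proj_sum_sq _ _ (fun i _ => amp_proj ht₁ (hg2 i)) fun i _ j _ hij => ?_
      rw [amp_comp, hgo i j hij, amp_zero]
    · intro i _ w
      have e : A i = tens ht₁ ht₃ 1 (u i) ∘L amp ht₁ (g i) := by
        rw [amp, tens_comp]; rfl
      rw [e]
      refine ((tens ht₁ ht₃ 1 (u i)).le_opNorm (amp ht₁ (g i) w)).trans (mul_le_mul_of_nonneg_right ?_ (norm_nonneg _))
      refine (norm_tens_le _ _ _ _).trans ?_
      have h3 : ‖(1 : H →L[ℂ] H)‖ ≤ 1 := ContinuousLinearMap.norm_id_le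
      have := hun i
      nlinarith [norm_nonneg (u i)]
    · intro i _ j _ hij w
      have e : ∀ i, A i = amp ht₃ (g i) ∘L tens ht₁ ht₃ 1 (u i) := by
        intro i; rw [amp, tens_comp]; rfl
      rw [e i, e j]
      show ⟪amp ht₃ (g i) _, amp ht₃ (g j) (tens ht₁ ht₃ 1 (u j) w)⟫ = 0
      rw [(amp_proj ht₃ (hg2 i)).inner, show ∀ v, amp ht₃ (g i) (amp ht₃ (g j) v) = (amp ht₃ (g i) ∘L amp ht₃ (g j)) v from fun _ => rfl, amp_comp, hgo i j hij, amp_zero]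
      simp
  let p := pc 𝓔 ξ
  have hpp : IsProj p := pc_proj _ _
  refine ⟨∑ i, tens ht₁ ht₃ (p ∘L g i ∘L p) (u i), ?_, ?_, ?_⟩
  · exact Submodule.sum_mem _ fun i _ => hT _ (hg1' i) _ (hu i)
  · have e : ∑ i, tens ht₁ ht₃ (p ∘L g i ∘L p) (u i) = amp ht₃ p ∘L (∑ i, A i) ∘L amp ht₁ p := by
      rw [ContinuousLinearMap.finsetSum_comp, ContinuousLinearMap.comp_finsetSum]
      refine Finset.sum_congr rfl fun i _ => ?_
      simp only [A, amp]
      rw [tens_comp, tens_comp]; rfl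
    rw [e]
    have h3 := (amp_proj ht₃ hpp).norm_le_one
    have h4 := (amp_proj ht₁ hpp).norm_le_one
    refine (ContinuousLinearMap.opNorm_comp_le _ _).trans ?_
    have h5 := ContinuousLinearMap.opNorm_comp_le (∑ i, A i) (amp ht₁ p)
    have h6 : ‖(∑ i, A i) ∘L amp ht₁ p‖ ≤ ‖Z‖ := h5.trans (by nlinarith [norm_nonneg (∑ i, A i)])
    nlinarith [norm_nonneg ((∑ i, A i) ∘L amp ht₁ p)]
  · intro w hw v hv
    refine le_trans (le_of_eq ?_) hε.le
    rw [norm_eq_zero, sub_eq_zero]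
    obtain ⟨x, k, rfl, hx⟩ := hF1' w hw
    obtain ⟨y, k', rfl, hy⟩ := hF2' v hv
    rcases hx with hx | ⟨W, hW, rfl⟩
    · have hpx : p x = 0 := pc_of_orth hx
      have e1 : Z (t₁ x k) = 0 := by
        rw [← h1]
        show Z (amp ht₁ p (t₁ x k)) = 0
        rw [amp_apply, hpx, ← tR_apply ht₁, map_zero, map_zero]
      rw [e1, sum_apply]
      simp only [tens_apply, ContinuousLinearMap.comp_apply, hpx, map_zero]
      simp only [← tR_apply ht₃, map_zero, Finset.sum_const_zero]
    have hWF : W ∈ Submonoid.closure (𝓕 : Set (H →L[ℂ] H)) := by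
      refine Submonoid.closure_mono ?_ hW
      intro E hE
      simp only [𝓕, Finset.coe_union, Finset.coe_biUnion]
      exact Or.inl (Set.mem_biUnion hw hE)
    have hWE : p (W ξ) = W ξ := pc_of_mem (mem_cyc (Submonoid.closure_mono h𝓕 hWF))
    have hL : ⟪t₃ y k', (∑ i, tens ht₁ ht₃ (p ∘L g i ∘L p) (u i)) (t₁ (W ξ) k)⟫ = ∑ i, ⟪g i (p y), g i (W ξ)⟫ * ⟪k', u i k⟫ := by
      rw [sum_apply, inner_sum]
      refine Finset.sum_congr rfl fun i _ => ?_
      rw [tens_apply, te_inner ht₃, (hg2 i).inner, (hg2 i).app, hpp.inner]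
      simp [hWE]
    rw [hL]
    rcases hy with hy | ⟨V, hV, rfl⟩
    · have hpy : p y = 0 := pc_of_orth hy
      rw [← h2, hpy]
      show _ = ⟪t₃ y k', amp ht₃ p (Z _)⟫
      rw [← (amp_proj ht₃ hpp).inner, amp_apply, hpy, ← tR_apply ht₃, map_zero, inner_zero_left]
      exact Finset.sum_eq_zero fun i _ => by rw [map_zero, inner_zero_left, zero_mul]
    have hVF : V ∈ Submonoid.closure (𝓕 : Set (H →L[ℂ] H)) := by
      refine Submonoid.closure_mono ?_ hV
      intro E hE
      simp only [𝓕, Finset.coe_union, Finset.coe_biUnion]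
      exact Or.inr (Set.mem_biUnion hv hE)
    have hVE : p (V ξ) = V ξ := pc_of_mem (mem_cyc (Submonoid.closure_mono h𝓕 hVF))
    have e2 : Z (t₁ (W ξ) k) = ∑ i, amp ht₃ (g i) (Z (amp ht₁ (g i) (t₁ (W ξ) k))) := by
      have : Z = ∑ i, amp ht₃ (g i) ∘L Z ∘L amp ht₁ (g i) := by
        have : ∀ i, amp ht₃ (g i) ∘L Z ∘L amp ht₁ (g i) = Z ∘L amp ht₁ (g i) := by
          intro i
          rw [← ContinuousLinearMap.comp_assoc, hZg, ContinuousLinearMap.comp_assoc, amp_comp, (hg2 i).1]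
        simp only [this]
        rw [← ContinuousLinearMap.comp_finsetSum, ← amp_sum, hg4, amp_one]; rfl
      conv_lhs => rw [this]
      rw [sum_apply]; rfl
    rw [e2, inner_sum, hVE]
    refine Finset.sum_congr rfl fun i _ => ?_
    rw [← (amp_proj ht₃ (hg2 i)).inner, amp_apply, amp_apply]
    obtain ⟨α, hα⟩ := hgW W hWF i
    obtain ⟨β, hβ⟩ := hgW V hVF i
    rw [hα, hβ, ← inner_slice ht₁ ht₃]
    have e3 : slice ht₁ ht₃ (α • g i ξ) (β • g i ξ) Z = (starRingEnd ℂ β * α) • slice ht₁ ht₃ (g i ξ) (g i ξ) Z := by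
      ext k0
      refine ext_inner_left ℂ fun k1 => ?_
      rw [inner_slice, smul_apply, inner_smul_right, inner_slice, ht₁.2.2.1, ht₃.2.2.1, map_smul, inner_smul_left, inner_smul_right]
      ring
    rw [e3, ← hus]
    generalize u i = v
    have e4 : ((starRingEnd ℂ β * α) • (((‖g i ξ‖ ^ 2 : ℝ) : ℂ) • v)) k = (starRingEnd ℂ β * α * ((‖g i ξ‖ ^ 2 : ℝ) : ℂ)) • v k := by
      rw [smul_smul]; rfl
    rw [e4, inner_smul_right, inner_smul_left, inner_smul_right, inner_self_eq_norm_sq_to_K]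
    push_cast
    simp only [Complex.coe_algebraMap]
    ring
end ST
end OSP
end


noncomputable section
open scoped ComplexInnerProductSpace
open scoped InnerProduct
open Set OpSynth Filter Topology
open ContinuousLinearMap (adjoint)
set_option linter.unusedVariables false
set_option linter.unusedSectionVars false
namespace OSP
section FL
variable {H₁ H₂ K₁ K₂ T₁ T₂ : Type*}
  [NormedAddCommGroup H₁] [InnerProductSpace ℂ H₁] [CompleteSpace H₁]
  [NormedAddCommGroup H₂] [InnerProductSpace ℂ H₂] [CompleteSpace H₂]
  [NormedAddCommGroup K₁] [InnerProductSpace ℂ K₁] [CompleteSpace K₁]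
  [NormedAddCommGroup K₂] [InnerProductSpace ℂ K₂] [CompleteSpace K₂]
  [NormedAddCommGroup T₁] [InnerProductSpace ℂ T₁] [CompleteSpace T₁]
  [NormedAddCommGroup T₂] [InnerProductSpace ℂ T₂] [CompleteSpace T₂]
  {t₁ : H₁ → K₁ → T₁} {t₂ : H₂ → K₂ → T₂}
  (ht₁ : IsTensorEmbedding t₁) (ht₂ : IsTensorEmbedding t₂)

/-- diagonal operators -/
def Dg (𝓡 : Set ((H₁ →L[ℂ] H₁) × (H₂ →L[ℂ] H₂))) : Set (H₁ →L[ℂ] H₂) :=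
  {T | ∀ p ∈ 𝓡, p.2 ∘L T = T ∘L p.1}

/-- diagonal operators, ampliated -/
def ADg (𝓡 : Set ((H₁ →L[ℂ] H₁) × (H₂ →L[ℂ] H₂))) : Set (T₁ →L[ℂ] T₂) :=
  {X | ∀ p ∈ 𝓡, amp ht₂ p.2 ∘L X = X ∘L amp ht₁ p.1}

lemma slice'_amp (k : K₁) (k' : K₂) (A : H₁ →L[ℂ] H₁) (B : H₂ →L[ℂ] H₂) (X : T₁ →L[ℂ] T₂) :
    slice' ht₁ ht₂ k k' (amp ht₂ B ∘L X ∘L amp ht₁ A) = B ∘L slice' ht₁ ht₂ k k' X ∘L A := by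
  ext x
  refine ext_inner_left ℂ fun y => ?_
  rw [inner_slice']
  show ⟪t₂ y k', amp ht₂ B (X (amp ht₁ A (t₁ x k)))⟫ = ⟪y, B (slice' ht₁ ht₂ k k' X (A x))⟫
  rw [← ContinuousLinearMap.adjoint_inner_left, ← ContinuousLinearMap.adjoint_inner_left B, inner_slice', amp_adjoint]
  simp

lemma slice_amp (x : H₁) (y : H₂) (A : H₁ →L[ℂ] H₁) (B : H₂ →L[ℂ] H₂) (X : T₁ →L[ℂ] T₂) :
    slice ht₁ ht₂ x y (amp ht₂ B ∘L X ∘L amp ht₁ A) = slice ht₁ ht₂ (A x) (adjoint B y) X := by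
  ext k
  refine ext_inner_left ℂ fun k' => ?_
  rw [inner_slice, inner_slice]
  show ⟪t₂ y k', amp ht₂ B (X (amp ht₁ A (t₁ x k)))⟫ = _
  rw [← ContinuousLinearMap.adjoint_inner_left, amp_adjoint]
  simp

lemma exists_delta {M ε : ℝ} (hM : 0 ≤ M) (hε : 0 < ε) : ∃ δ > 0, Real.sqrt δ * M ≤ ε := by
  refine ⟨(ε / (M + 1)) ^ 2, by positivity, ?_⟩
  rw [Real.sqrt_sq (by positivity), div_mul_eq_mul_div, div_le_iff₀ (by positivity)]
  nlinarith

variable {𝓡 : Set ((H₁ →L[ℂ] H₁) × (H₂ →L[ℂ] H₂))}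
  (hp1 : ∀ p ∈ 𝓡, IsProj p.1) (hp2 : ∀ p ∈ 𝓡, IsProj p.2)
  (hc : ∀ p ∈ 𝓡, ∀ q ∈ 𝓡, p.1 * q.1 = q.1 * p.1)
  {Ub : Submodule ℂ (K₁ →L[ℂ] K₂)} {N : Submodule ℂ (T₁ →L[ℂ] T₂)} (hN : WkClosed (N : Set (T₁ →L[ℂ] T₂)))
  (hT : ∀ S ∈ Dg 𝓡, ∀ u ∈ Ub, tens ht₁ ht₂ S u ∈ N)

include hp1 hp2 hc hN hT

lemma step3 (ξ : H₁) {S : H₁ →L[ℂ] H₂} (hS : S ∈ Dg 𝓡) (hSp : S ∘L pc (Prod.fst '' 𝓡) ξ = S)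
    {Y : T₁ →L[ℂ] T₂} (hY : Y ∈ ADg ht₁ ht₂ 𝓡) (hs : ∀ x y, slice ht₁ ht₂ x y Y ∈ Ub)
    (hYp : Y ∘L amp ht₁ (pc (Prod.fst '' 𝓡) ξ) = Y) : amp ht₂ (S ∘L adjoint S) ∘L Y ∈ N := by
  have ht₃ := ht_emb H₁ K₂
  set p := pc (Prod.fst '' 𝓡) ξ with hpdef
  have hpp : IsProj p := pc_proj _ _
  have hpc : ∀ q ∈ 𝓡, q.1 ∘L p = p ∘L q.1 := fun q hq => pc_comm (by
    rintro _ ⟨q, hq, rfl⟩; exact (hp1 q hq).adj) ξ ⟨q, hq, rfl⟩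
  have hSa : ∀ q ∈ 𝓡, q.1 ∘L adjoint S = adjoint S ∘L q.2 := by
    intro q hq
    have := congrArg adjoint (hS q hq)
    rw [ContinuousLinearMap.adjoint_comp, ContinuousLinearMap.adjoint_comp, (hp1 q hq).adj, (hp2 q hq).adj] at this
    exact this.symm
  let Z := tens ht₂ ht₃ (adjoint S) 1 ∘L Y
  let N' : Submodule ℂ (T₁ →L[ℂ] HT H₁ K₂) := N.comap (sand (tens ht₃ ht₂ S 1) (1 : T₁ →L[ℂ] T₁))
  have hN' : WkClosed (N' : Set (T₁ →L[ℂ] HT H₁ K₂)) := closed_comap (sand_cont _ _) hN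
  have key : Z ∈ N' := by
    refine step3' ht₁ ht₃ (𝓔 := Prod.fst '' 𝓡) ?_ ?_ ξ Z ?_ (Ub := Ub) ?_ ?_ ?_ hN' ?_
    · rintro _ ⟨q, hq, rfl⟩; exact hp1 q hq
    · rintro _ ⟨q, hq, rfl⟩ _ ⟨q', hq', rfl⟩; exact hc q hq q' hq'
    · rintro _ ⟨q, hq, rfl⟩
      simp only [Z]
      rw [← ContinuousLinearMap.comp_assoc, amp, tens_comp, hSa q hq, ContinuousLinearMap.comp_assoc, ← hY q hq, ← ContinuousLinearMap.comp_assoc, amp, tens_comp]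
    · intro x y
      have : slice ht₁ ht₃ x y Z = slice ht₁ ht₂ x (S y) Y := by
        ext k
        refine ext_inner_left ℂ fun k' => ?_
        rw [inner_slice, inner_slice]
        show ⟪_, tens ht₂ ht₃ (adjoint S) 1 (Y _)⟫ = _
        rw [← ContinuousLinearMap.adjoint_inner_left, tens_adjoint, tens_apply, ContinuousLinearMap.adjoint_adjoint, ContinuousLinearMap.adjoint_one]
        rfl
      rw [this]; exact hs _ _
    · simp only [Z]
      rw [ContinuousLinearMap.comp_assoc, hYp]
    · simp only [Z]
      rw [← ContinuousLinearMap.comp_assoc, amp, tens_comp]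
      have := congrArg adjoint hSp
      rw [ContinuousLinearMap.adjoint_comp, hpp.adj] at this
      rw [this]; rfl
    · intro g hg u hu
      show tens ht₃ ht₂ S 1 ∘L tens ht₁ ht₃ (p ∘L g ∘L p) u ∘L 1 ∈ N
      have : tens ht₃ ht₂ S 1 ∘L tens ht₁ ht₃ (p ∘L g ∘L p) u ∘L 1 = tens ht₁ ht₂ (S ∘L (p ∘L g ∘L p)) u := by
        have := tens_comp ht₁ ht₃ ht₂ S 1 (p ∘L g ∘L p) u
        exact this
      rw [this]
      refine hT _ ?_ u hu
      intro q hq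
      have hgq : q.1 ∘L g = g ∘L q.1 := by
        have hle : Algebra.adjoin ℂ (Prod.fst '' 𝓡) ≤ Subalgebra.centralizer ℂ {q.1} := by
          rw [Algebra.adjoin_le_iff]
          rintro _ ⟨q', hq', rfl⟩
          rw [SetLike.mem_coe, Subalgebra.mem_centralizer_iff]
          rintro _ rfl
          exact hc q hq q' hq'
        exact (Subalgebra.mem_centralizer_iff ℂ).1 (hle hg) _ rfl
      calc q.2 ∘L S ∘L p ∘L g ∘L p = (q.2 ∘L S) ∘L p ∘L g ∘L p := rfl
        _ = S ∘L (q.1 ∘L p) ∘L g ∘L p := by rw [hS q hq]; rfl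
        _ = S ∘L p ∘L (q.1 ∘L g) ∘L p := by rw [hpc q hq]; rfl
        _ = S ∘L p ∘L g ∘L (q.1 ∘L p) := by rw [hgq]; rfl
        _ = _ := by rw [hpc q hq]; rfl
  have e : amp ht₂ (S ∘L adjoint S) ∘L Y = tens ht₃ ht₂ S 1 ∘L Z ∘L 1 := by
    have := tens_comp ht₂ ht₃ ht₂ S 1 (adjoint S) (1 : K₂ →L[ℂ] K₂)
    show _ = (tens ht₃ ht₂ S 1 ∘L tens ht₂ ht₃ (adjoint S) 1) ∘L Y
    rw [this]; rfl
  rw [e]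
  exact key

lemma step2 (ξ : H₁) {X : T₁ →L[ℂ] T₂} (hX : X ∈ ADg ht₁ ht₂ 𝓡) (hs : ∀ x y, slice ht₁ ht₂ x y X ∈ Ub) :
    X ∘L amp ht₁ (pc (Prod.fst '' 𝓡) ξ) ∈ N := by
  classical
  set p := pc (Prod.fst '' 𝓡) ξ with hpdef
  have hpp : IsProj p := pc_proj _ _
  have hpc : ∀ q ∈ 𝓡, q.1 ∘L p = p ∘L q.1 := fun q hq => pc_comm (by
    rintro _ ⟨q, hq, rfl⟩; exact (hp1 q hq).adj) ξ ⟨q, hq, rfl⟩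
  set Y := X ∘L amp ht₁ p with hYdef
  have hY : Y ∈ ADg ht₁ ht₂ 𝓡 := by
    intro q hq
    rw [hYdef, ← ContinuousLinearMap.comp_assoc, hX q hq, ContinuousLinearMap.comp_assoc, amp_comp, hpc q hq, ← amp_comp, ContinuousLinearMap.comp_assoc]
  have hYs : ∀ x y, slice ht₁ ht₂ x y Y ∈ Ub := by
    intro x y
    have := slice_amp ht₁ ht₂ x y p 1 X
    rw [amp_one] at this
    rw [show Y = 1 ∘L X ∘L amp ht₁ p from (ContinuousLinearMap.id_comp _).symm, this]; exact hs _ _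
  have hYp : Y ∘L amp ht₁ p = Y := by
    rw [hYdef, ContinuousLinearMap.comp_assoc, amp_comp, hpp.1]
  refine mem_of_approx hN (2 * ‖Y‖) (te_total ht₁) (te_total ht₂) ?_
  intro s hs' t ht' ε hε
  have k1 : ∀ w : T₁, ∃ x k, w ∈ s → w = t₁ x k := by
    intro w
    by_cases hw : w ∈ s
    · obtain ⟨x, k, h⟩ := hs' hw
      exact ⟨x, k, fun _ => h⟩
    · exact ⟨0, 0, fun h => absurd h hw⟩
  have k2 : ∀ w : T₂, ∃ x k, w ∈ t → w = t₂ x k := by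
    intro w
    by_cases hw : w ∈ t
    · obtain ⟨x, k, h⟩ := ht' hw
      exact ⟨x, k, fun _ => h⟩
    · exact ⟨0, 0, fun h => absurd h hw⟩
  choose x1 k1 hx1 using k1
  choose x2 k2 hx2 using k2
  let S : T₁ × T₂ → H₁ →L[ℂ] H₂ := fun i => slice' ht₁ ht₂ (k1 i.1) (k2 i.2) Y
  have hS : ∀ i, S i ∈ Dg 𝓡 := by
    intro i q hq
    have e1 := slice'_amp ht₁ ht₂ (k1 i.1) (k2 i.2) 1 q.2 Y
    have e2 := slice'_amp ht₁ ht₂ (k1 i.1) (k2 i.2) q.1 1 Y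
    rw [amp_one] at e1 e2
    have : amp ht₂ q.2 ∘L Y ∘L (1 : T₁ →L[ℂ] T₁) = (1 : T₂ →L[ℂ] T₂) ∘L Y ∘L amp ht₁ q.1 := hY q hq
    rw [this, e2] at e1
    exact e1.symm
  have hSp : ∀ i, S i ∘L p = S i := by
    intro i
    have e2 := slice'_amp ht₁ ht₂ (k1 i.1) (k2 i.2) p 1 Y
    rw [amp_one, hYp] at e2
    exact e2.symm
  obtain ⟨δ, hδ, hδ'⟩ := exists_delta (M := ∑ i ∈ s ×ˢ t, ‖x1 i.1‖ * ‖x2 i.2‖) (Finset.sum_nonneg fun i _ => by positivity) hε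
  obtain ⟨R, hR1, hR2, hR3, -, hR4, hR5⟩ := ctrick (s ×ˢ t) S hδ
  set c := ∑ j ∈ s ×ˢ t, S j ∘L adjoint (S j) with hcdef
  have hRF : ∀ q ∈ 𝓡, q.2 ∘L R = R ∘L q.2 := by
    intro q hq
    refine hR2 _ ?_
    rw [hcdef, ContinuousLinearMap.comp_finsetSum, ContinuousLinearMap.finsetSum_comp]
    refine Finset.sum_congr rfl fun i _ => ?_
    have := congrArg adjoint (hS i q hq)
    rw [ContinuousLinearMap.adjoint_comp, ContinuousLinearMap.adjoint_comp, (hp1 q hq).adj, (hp2 q hq).adj] at this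
    rw [← ContinuousLinearMap.comp_assoc, hS i q hq, ContinuousLinearMap.comp_assoc, ← this]; rfl
  have hYR : amp ht₂ R ∘L Y ∈ ADg ht₁ ht₂ 𝓡 := by
    intro q hq
    rw [← ContinuousLinearMap.comp_assoc, amp_comp, hRF q hq, ← amp_comp, ContinuousLinearMap.comp_assoc, hY q hq, ← ContinuousLinearMap.comp_assoc]
  have herr : amp ht₂ (c ∘L R) ∘L Y = Y - amp ht₂ ((δ : ℂ) • R) ∘L Y := by
    rw [← hR3, amp_sub, amp_one, ContinuousLinearMap.sub_comp]
    have : (1 : T₂ →L[ℂ] T₂) ∘L Y = Y := ContinuousLinearMap.id_comp _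
    rw [this]; abel
  refine ⟨amp ht₂ (c ∘L R) ∘L Y, ?_, ?_, ?_⟩
  · rw [← amp_comp, hcdef, amp_sum, ContinuousLinearMap.finsetSum_comp, ContinuousLinearMap.finsetSum_comp]
    refine Submodule.sum_mem _ fun i _ => ?_
    rw [ContinuousLinearMap.comp_assoc]
    refine step3 ht₁ ht₂ hp1 hp2 hc hN hT ξ (hS i) (hSp i) hYR ?_ ?_
    · intro x y
      have := slice_amp ht₁ ht₂ x y 1 R Y
      rw [amp_one] at this
      rw [show amp ht₂ R ∘L Y = amp ht₂ R ∘L Y ∘L 1 from congrArg _ (ContinuousLinearMap.comp_id _).symm, this]; exact hYs _ _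
    · rw [ContinuousLinearMap.comp_assoc, hYp]
  · rw [herr]
    refine (norm_sub_le _ _).trans ?_
    have h1 := (ContinuousLinearMap.opNorm_comp_le (amp ht₂ ((δ : ℂ) • R)) Y)
    have h2 := (norm_amp_le ht₂ ((δ : ℂ) • R)).trans hR4
    nlinarith [norm_nonneg Y]
  · intro w hw v hv
    rw [herr, sub_apply, inner_sub_right, sub_sub_cancel_left, norm_neg]
    have e : ⟪v, (amp ht₂ ((δ : ℂ) • R) ∘L Y) w⟫ = ⟪x2 v, ((δ : ℂ) • R) (S (w, v) (x1 w))⟫ := by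
      have := slice'_amp ht₁ ht₂ (k1 w) (k2 v) 1 ((δ : ℂ) • R) Y
      rw [amp_one] at this
      conv_lhs => rw [hx1 w hw, hx2 v hv]
      rw [← inner_slice' ht₁ ht₂, show amp ht₂ ((δ : ℂ) • R) ∘L Y = amp ht₂ ((δ : ℂ) • R) ∘L Y ∘L 1 from congrArg _ (ContinuousLinearMap.comp_id _).symm, this]
      rfl
    rw [e]
    refine (norm_inner_le_norm _ _).trans ?_
    have hm : (w, v) ∈ s ×ˢ t := Finset.mem_product.2 ⟨hw, hv⟩
    refine (mul_le_mul_of_nonneg_left (hR5 _ hm _) (norm_nonneg _)).trans ?_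
    refine le_trans ?_ hδ'
    have := Finset.single_le_sum (f := fun i : T₁ × T₂ => ‖x1 i.1‖ * ‖x2 i.2‖) (fun i _ => by positivity) hm
    calc _ = Real.sqrt δ * (‖x1 w‖ * ‖x2 v‖) := by ring
      _ ≤ _ := mul_le_mul_of_nonneg_left this (Real.sqrt_nonneg _)

lemma step1 {X : T₁ →L[ℂ] T₂} (hX : X ∈ ADg ht₁ ht₂ 𝓡) (hs : ∀ x y, slice ht₁ ht₂ x y X ∈ Ub) : X ∈ N := by
  classical
  refine mem_of_approx hN (2 * ‖X‖) (te_total ht₁) (B := Set.univ) (by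
    rw [Submodule.span_univ]; exact top_le_iff.1 (Submodule.le_topologicalClosure _)) ?_
  intro s hs' t ht' ε hε
  have k1 : ∀ w : T₁, ∃ x k, w ∈ s → w = t₁ x k := by
    intro w
    by_cases hw : w ∈ s
    · obtain ⟨x, k, h⟩ := hs' hw
      exact ⟨x, k, fun _ => h⟩
    · exact ⟨0, 0, fun h => absurd h hw⟩
  choose x1 k1 hx1 using k1
  let S : T₁ → H₁ →L[ℂ] H₁ := fun i => pc (Prod.fst '' 𝓡) (x1 i)
  have hSp : ∀ i, IsProj (S i) := fun i => pc_proj _ _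
  obtain ⟨δ, hδ, hδ'⟩ := exists_delta (M := ∑ i ∈ s ×ˢ t, ‖X‖ * ‖x1 i.1‖ * ‖k1 i.1‖ * ‖i.2‖) (Finset.sum_nonneg fun i _ => by positivity) hε
  obtain ⟨R, hR1, hR2, -, hR3, hR4, hR5⟩ := ctrick s S hδ
  set c := ∑ j ∈ s, S j ∘L adjoint (S j) with hcdef
  have hc2 : c = ∑ j ∈ s, S j := Finset.sum_congr rfl fun i _ => by rw [(hSp i).adj, (hSp i).1]
  have hRF : ∀ q ∈ 𝓡, q.1 ∘L R = R ∘L q.1 := by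
    intro q hq
    refine hR2 _ ?_
    rw [hc2, ContinuousLinearMap.comp_finsetSum, ContinuousLinearMap.finsetSum_comp]
    refine Finset.sum_congr rfl fun i _ => ?_
    exact pc_comm (by rintro _ ⟨q, hq, rfl⟩; exact (hp1 q hq).adj) _ ⟨q, hq, rfl⟩
  have hXR : X ∘L amp ht₁ R ∈ ADg ht₁ ht₂ 𝓡 := by
    intro q hq
    rw [← ContinuousLinearMap.comp_assoc, hX q hq, ContinuousLinearMap.comp_assoc, amp_comp, hRF q hq, ← amp_comp, ContinuousLinearMap.comp_assoc]
  have herr : X ∘L amp ht₁ (R ∘L c) = X - X ∘L amp ht₁ ((δ : ℂ) • R) := by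
    rw [← hR3, amp_sub, amp_one, ContinuousLinearMap.comp_sub]
    have : X ∘L (1 : T₁ →L[ℂ] T₁) = X := ContinuousLinearMap.comp_id _
    rw [this]; abel
  refine ⟨X ∘L amp ht₁ (R ∘L c), ?_, ?_, ?_⟩
  · rw [← amp_comp, hc2, amp_sum, ← ContinuousLinearMap.comp_assoc, ContinuousLinearMap.comp_finsetSum]
    refine Submodule.sum_mem _ fun i _ => ?_
    refine step2 ht₁ ht₂ hp1 hp2 hc hN hT _ hXR ?_
    intro x y
    have := slice_amp ht₁ ht₂ x y R 1 X
    rw [amp_one] at this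
    rw [show X ∘L amp ht₁ R = 1 ∘L X ∘L amp ht₁ R from (ContinuousLinearMap.id_comp _).symm, this]; exact hs _ _
  · rw [herr]
    refine (norm_sub_le _ _).trans ?_
    have h1 := (ContinuousLinearMap.opNorm_comp_le X (amp ht₁ ((δ : ℂ) • R)))
    have h2 := (norm_amp_le ht₁ ((δ : ℂ) • R)).trans hR4
    nlinarith [norm_nonneg X]
  · intro w hw v hv
    rw [herr, sub_apply, inner_sub_right, sub_sub_cancel_left, norm_neg]
    have e : ‖(amp ht₁ ((δ : ℂ) • R)) w‖ ≤ Real.sqrt δ * ‖x1 w‖ * ‖k1 w‖ := by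
      conv_lhs => rw [hx1 w hw]
      rw [amp_apply, te_norm ht₁]
      refine mul_le_mul_of_nonneg_right ?_ (norm_nonneg _)
      have := hR5 w hw (x1 w)
      rwa [show S w (x1 w) = x1 w from pc_self _ _] at this
    refine (norm_inner_le_norm _ _).trans ?_
    have hm : (w, v) ∈ s ×ˢ t := Finset.mem_product.2 ⟨hw, hv⟩
    refine (mul_le_mul_of_nonneg_left ((X.le_opNorm _).trans (mul_le_mul_of_nonneg_left e (norm_nonneg _))) (norm_nonneg _)).trans ?_
    refine le_trans ?_ hδ'
    have := Finset.single_le_sum (f := fun i : T₁ × T₂ => ‖X‖ * ‖x1 i.1‖ * ‖k1 i.1‖ * ‖i.2‖) (fun i _ => by positivity) hm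
    calc _ = Real.sqrt δ * (‖X‖ * ‖x1 w‖ * ‖k1 w‖ * ‖v‖) := by ring
      _ ≤ _ := mul_le_mul_of_nonneg_left this (Real.sqrt_nonneg _)
end FL
end OSP
end


noncomputable section
open scoped ComplexInnerProductSpace
open scoped InnerProduct
open Set OpSynth Filter Topology
open ContinuousLinearMap (adjoint)
set_option linter.unusedVariables false
set_option linter.unusedSectionVars false
namespace OSP
section MI
variable {H₁ H₂ K₁ K₂ T₁ T₂ : Type*}
  [NormedAddCommGroup H₁] [InnerProductSpace ℂ H₁] [CompleteSpace H₁]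
  [NormedAddCommGroup H₂] [InnerProductSpace ℂ H₂] [CompleteSpace H₂]
  [NormedAddCommGroup K₁] [InnerProductSpace ℂ K₁] [CompleteSpace K₁]
  [NormedAddCommGroup K₂] [InnerProductSpace ℂ K₂] [CompleteSpace K₂]
  [NormedAddCommGroup T₁] [InnerProductSpace ℂ T₁] [CompleteSpace T₁]
  [NormedAddCommGroup T₂] [InnerProductSpace ℂ T₂] [CompleteSpace T₂]
  {t₁ : H₁ → K₁ → T₁} {t₂ : H₂ → K₂ → T₂}

/-- bimodule of a pair set -/
def VP (P : Set ((H₁ →L[ℂ] H₁) × (H₂ →L[ℂ] H₂))) : Set (H₁ →L[ℂ] H₂) :=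
  {T | ∀ p ∈ P, (1 - p.2) ∘L T ∘L p.1 = 0}

/-- good pairs -/
def Ok (D₁ : StarSubalgebra ℂ (H₁ →L[ℂ] H₁)) (D₂ : StarSubalgebra ℂ (H₂ →L[ℂ] H₂))
    (P : Set ((H₁ →L[ℂ] H₁) × (H₂ →L[ℂ] H₂))) : Prop :=
  ∀ p ∈ P, IsProj p.1 ∧ IsProj p.2 ∧ p.1 ∈ D₁ ∧ p.2 ∈ D₂

/-- chains of pairs -/
def Chn (P : Set ((H₁ →L[ℂ] H₁) × (H₂ →L[ℂ] H₂))) : Prop :=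
  ∀ p ∈ P, ∀ q ∈ P, p.1 ∘L q.1 = q.1 ∨ q.2 ∘L p.2 = p.2

lemma VP_mod {P : Set ((H₁ →L[ℂ] H₁) × (H₂ →L[ℂ] H₂))} {T : H₁ →L[ℂ] H₂} (hT : T ∈ VP P)
    {A : H₁ →L[ℂ] H₁} {B : H₂ →L[ℂ] H₂} (hA : ∀ p ∈ P, A * p.1 = p.1 * A) (hB : ∀ p ∈ P, B * p.2 = p.2 * B) :
    B ∘L T ∘L A ∈ VP P := by
  intro p hp
  have h1 : A ∘L p.1 = p.1 ∘L A := hA p hp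
  have h2 : (1 - p.2) ∘L B = B ∘L (1 - p.2) := by
    show (1 - p.2) * B = B * (1 - p.2)
    rw [mul_sub, sub_mul, hB p hp]; simp
  calc (1 - p.2) ∘L (B ∘L T ∘L A) ∘L p.1 = ((1 - p.2) ∘L B) ∘L T ∘L (A ∘L p.1) := rfl
    _ = B ∘L ((1 - p.2) ∘L T ∘L p.1) ∘L A := by rw [h1, h2]; rfl
    _ = 0 := by rw [hT p hp]; simp

variable (ht₁ : IsTensorEmbedding t₁) (ht₂ : IsTensorEmbedding t₂)

lemma ADg_mod {P : Set ((H₁ →L[ℂ] H₁) × (H₂ →L[ℂ] H₂))} {X : T₁ →L[ℂ] T₂} (hX : X ∈ ADg ht₁ ht₂ P)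
    {A : H₁ →L[ℂ] H₁} {B : H₂ →L[ℂ] H₂} (hA : ∀ p ∈ P, A * p.1 = p.1 * A) (hB : ∀ p ∈ P, B * p.2 = p.2 * B) :
    amp ht₂ B ∘L X ∘L amp ht₁ A ∈ ADg ht₁ ht₂ P := by
  intro p hp
  have h1 : A ∘L p.1 = p.1 ∘L A := hA p hp
  have h2 : B ∘L p.2 = p.2 ∘L B := hB p hp
  rw [← ContinuousLinearMap.comp_assoc, amp_comp, ← h2, ← amp_comp, ContinuousLinearMap.comp_assoc,
    ← ContinuousLinearMap.comp_assoc (amp ht₂ p.2), hX p hp, ContinuousLinearMap.comp_assoc X, amp_comp, ← h1, ← amp_comp]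
  simp only [ContinuousLinearMap.comp_assoc]

lemma ADg_add {P : Set ((H₁ →L[ℂ] H₁) × (H₂ →L[ℂ] H₂))} {X Y : T₁ →L[ℂ] T₂} (hX : X ∈ ADg ht₁ ht₂ P)
    (hY : Y ∈ ADg ht₁ ht₂ P) : X + Y ∈ ADg ht₁ ht₂ P := by
  intro p hp
  rw [ContinuousLinearMap.comp_add, ContinuousLinearMap.add_comp, hX p hp, hY p hp]

lemma ADg_lim {β : Type*} {u : Filter β} [u.NeBot] {f : β → T₁ →L[ℂ] T₂} {Y : T₁ →L[ℂ] T₂} (hf : Tendsto f u (@nhds _ (sigmaWeak T₁ T₂) Y))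
    {E : T₁ →L[ℂ] T₁} {F : T₂ →L[ℂ] T₂} (h : ∀ᶠ s in u, F ∘L f s = f s ∘L E) : F ∘L Y = Y ∘L E := by
  ext x
  refine ext_inner_left ℂ fun y => ?_
  show ⟪y, F (Y x)⟫ = ⟪y, Y (E x)⟫
  rw [← ContinuousLinearMap.adjoint_inner_left]
  refine tendsto_nhds_unique (wk_tendsto_sand hf x (adjoint F y)) ?_
  refine (wk_tendsto_sand hf (E x) y).congr' ?_
  filter_upwards [h] with s hs
  rw [ContinuousLinearMap.adjoint_inner_left]
  exact congrArg (fun Z : T₁ →L[ℂ] T₂ => ⟪y, Z x⟫) hs.symm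

/-- generators -/
def GG {ι : Type*} (B : ι → Set (H₁ →L[ℂ] H₂)) (U : ι → Set (K₁ →L[ℂ] K₂)) : Set (T₁ →L[ℂ] T₂) :=
  {W | ∃ i, ∃ S ∈ B i, ∃ R ∈ U i, W = tens ht₁ ht₂ S R}

lemma sand_amp_tens (A : H₁ →L[ℂ] H₁) (B : H₂ →L[ℂ] H₂) (S : H₁ →L[ℂ] H₂) (R : K₁ →L[ℂ] K₂) :
    sand (amp ht₂ B) (amp ht₁ A) (tens ht₁ ht₂ S R) = tens ht₁ ht₂ (B ∘L S ∘L A) R := by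
  rw [sand_apply, amp, amp, tens_comp, tens_comp]; rfl

variable {ι : Type*} {J : ι → Type*}

/-- left hand side -/
def LH (Pf : (Σ i, J i) → Set ((H₁ →L[ℂ] H₁) × (H₂ →L[ℂ] H₂))) (U : ι → Set (K₁ →L[ℂ] K₂)) : Submodule ℂ (T₁ →L[ℂ] T₂) :=
  ⨅ j : ∀ i, J i, cspan (GG ht₁ ht₂ (fun i => VP (Pf ⟨i, j i⟩)) U)

/-- right hand side -/
def RH (Pf : (Σ i, J i) → Set ((H₁ →L[ℂ] H₁) × (H₂ →L[ℂ] H₂))) (U : ι → Set (K₁ →L[ℂ] K₂)) : Submodule ℂ (T₁ →L[ℂ] T₂) :=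
  cspan (GG ht₁ ht₂ (fun i => ⋂ j, VP (Pf ⟨i, j⟩)) U)

lemma LH_closed (Pf : (Σ i, J i) → Set ((H₁ →L[ℂ] H₁) × (H₂ →L[ℂ] H₂))) (U : ι → Set (K₁ →L[ℂ] K₂)) :
    WkClosed (LH ht₁ ht₂ Pf U : Set (T₁ →L[ℂ] T₂)) := by
  simp only [LH, Submodule.coe_iInf]
  exact @isClosed_iInter _ _ (sigmaWeak T₁ T₂) _ fun j => cspan_closed _

lemma cspan_GG_mod {B B' : ι → Set (H₁ →L[ℂ] H₂)} {U U' : ι → Set (K₁ →L[ℂ] K₂)} {A : H₁ →L[ℂ] H₁} {C : H₂ →L[ℂ] H₂}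
    (h : ∀ i, ∀ S ∈ B i, C ∘L S ∘L A = 0 ∨ (C ∘L S ∘L A ∈ B' i ∧ U i ⊆ U' i)) {X : T₁ →L[ℂ] T₂}
    (hX : X ∈ cspan (GG ht₁ ht₂ B U)) : amp ht₂ C ∘L X ∘L amp ht₁ A ∈ cspan (GG ht₁ ht₂ B' U') := by
  refine cspan_map (sand (amp ht₂ C) (amp ht₁ A)) (sand_cont _ _) (cspan_closed _) ?_ hX
  rintro _ ⟨i, S, hS, R, hR, rfl⟩
  rw [sand_amp_tens]
  rcases h i S hS with h | ⟨h, h'⟩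
  · rw [h, show tens ht₁ ht₂ (0 : H₁ →L[ℂ] H₂) R = 0 from (tensL ht₁ ht₂ R).map_zero]
    exact Submodule.zero_mem _
  · exact subset_cspan _ ⟨i, _, h, R, h' hR, rfl⟩

variable {D₁ : StarSubalgebra ℂ (H₁ →L[ℂ] H₁)} {D₂ : StarSubalgebra ℂ (H₂ →L[ℂ] H₂)}
  (hD₁ : ∀ a ∈ D₁, ∀ b ∈ D₁, a * b = b * a) (hD₂ : ∀ a ∈ D₂, ∀ b ∈ D₂, a * b = b * a)

lemma norm_diag {X : T₁ →L[ℂ] T₂} {E : T₁ →L[ℂ] T₁} {F : T₂ →L[ℂ] T₂} (hE : IsProj E) (hF : IsProj F) :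
    ‖F ∘L X ∘L E + (1 - F) ∘L X ∘L (1 - E)‖ ≤ ‖X‖ := by
  have hE' : IsProj (1 - E) := ⟨by
    have : E * E = E := hE.1
    show (1 - E) * (1 - E) = 1 - E
    simp [mul_sub, sub_mul, this], (IsSelfAdjoint.one _).sub hE.2⟩
  have hF' : IsProj (1 - F) := ⟨by
    have : F * F = F := hF.1
    show (1 - F) * (1 - F) = 1 - F
    simp [mul_sub, sub_mul, this], (IsSelfAdjoint.one _).sub hF.2⟩
  have hEE : E ∘L (1 - E) = 0 := by
    rw [ContinuousLinearMap.comp_sub, hE.1]; exact sub_self E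
  have hEE' : (1 - E) ∘L E = 0 := by
    rw [ContinuousLinearMap.sub_comp, hE.1]; exact sub_self E
  have hFF : ∀ w, F ((1 - F) w) = 0 := by
    intro w
    rw [sub_apply, map_sub, hF.app]; exact sub_self _
  have := norm_block (Finset.univ : Finset Bool) (fun b => cond b (F ∘L X ∘L E) ((1 - F) ∘L X ∘L (1 - E))) (fun b => cond b E (1 - E))
    (norm_nonneg X) ?_ ?_ ?_
  · simpa using this
  · refine proj_sum_sq _ _ ?_ ?_
    · rintro (_ | _) _
      · exact hE'
      · exact hE
    · rintro (_ | _) _ (_ | _) _ h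
      · exact absurd rfl h
      · exact hEE'
      · exact hEE
      · exact absurd rfl h
  · rintro (_ | _) _ w
    · exact (hF'.norm_le _).trans (X.le_opNorm _)
    · exact (hF.norm_le _).trans (X.le_opNorm _)
  · rintro (_ | _) _ (_ | _) _ h w
    · exact absurd rfl h
    · show ⟪(1 - F) _, F _⟫ = 0
      rw [← hF.inner, hFF, inner_zero_left]
    · show ⟪F _, (1 - F) _⟫ = 0
      rw [hF.inner, hFF, inner_zero_right]
    · exact absurd rfl h

include hD₁ hD₂

lemma base_case [TopologicalSpace.SeparableSpace H₁] [∀ i, Nonempty (J i)]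
    {Pf : (Σ i, J i) → Set ((H₁ →L[ℂ] H₁) × (H₂ →L[ℂ] H₂))} {U : ι → Set (K₁ →L[ℂ] K₂)}
    {𝓡 : Set ((H₁ →L[ℂ] H₁) × (H₂ →L[ℂ] H₂))} (hR : Ok D₁ D₂ 𝓡) (hV : ∀ a, Dg 𝓡 ⊆ VP (Pf a))
    {X : T₁ →L[ℂ] T₂} (hX : X ∈ LH ht₁ ht₂ Pf U) (hXR : X ∈ ADg ht₁ ht₂ 𝓡) : X ∈ RH ht₁ ht₂ Pf U := by
  refine step1 ht₁ ht₂ (𝓡 := 𝓡) (fun p hp => (hR p hp).1) (fun p hp => (hR p hp).2.1)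
    (fun p hp q hq => hD₁ _ (hR p hp).2.2.1 _ (hR q hq).2.2.1) (Ub := cspan (⋃ i, U i)) (N := RH ht₁ ht₂ Pf U) (cspan_closed _) ?_ hXR ?_
  · intro S hS u hu
    refine cspan_map (tensR ht₁ ht₂ S) (tensR_cont ht₁ ht₂ S) (cspan_closed _) ?_ hu
    intro u hu
    obtain ⟨i, hi⟩ := Set.mem_iUnion.1 hu
    exact subset_cspan _ ⟨i, S, Set.mem_iInter.2 fun j => hV _ hS, u, hi, rfl⟩
  · intro x y
    have j : ∀ i, J i := fun i => Classical.arbitrary _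
    have := (Submodule.mem_iInf _).1 hX j
    refine cspan_map (slice ht₁ ht₂ x y) (slice_cont ht₁ ht₂ x y) (cspan_closed _) ?_ this
    rintro _ ⟨i, S, hS, R, hR, rfl⟩
    rw [slice_tens]
    exact Submodule.smul_mem _ _ (subset_cspan _ (Set.mem_iUnion.2 ⟨i, hR⟩))

lemma main_ind [TopologicalSpace.SeparableSpace H₁] [∀ i, Nonempty (J i)] (S : Finset (Σ i, J i)) :
    ∀ (Pf : (Σ i, J i) → Set ((H₁ →L[ℂ] H₁) × (H₂ →L[ℂ] H₂))) (U : ι → Set (K₁ →L[ℂ] K₂))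
    (𝓡 : Set ((H₁ →L[ℂ] H₁) × (H₂ →L[ℂ] H₂))) (hP : ∀ a, Ok D₁ D₂ (Pf a)) (hC : ∀ a, Chn (Pf a)) (hR : Ok D₁ D₂ 𝓡) (hV : ∀ a ∉ S, Dg 𝓡 ⊆ VP (Pf a))
    (X : T₁ →L[ℂ] T₂) (hX : X ∈ LH ht₁ ht₂ Pf U) (hXR : X ∈ ADg ht₁ ht₂ 𝓡), X ∈ RH ht₁ ht₂ Pf U := by
  classical
  induction S using Finset.induction_on with
  | empty =>
    intro Pf U 𝓡 hP hC hR hV X hX hXR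
    exact base_case ht₁ ht₂ hD₁ hD₂ hR (fun a => hV a (by simp)) hX hXR
  | insert a S ha ih =>
    intro Pf U 𝓡 hP hC hR hV X hX hXR
    let Pf' := Function.update Pf a ∅
    have hPf'a : Pf' a = ∅ := Function.update_self _ _ _
    have hPf'b : ∀ b, b ≠ a → Pf' b = Pf b := fun b hb => Function.update_of_ne hb _ _
    have hP' : ∀ b, Ok D₁ D₂ (Pf' b) := by
      intro b
      by_cases hb : b = a
      · subst hb; rw [hPf'a]; intro p hp; exact absurd hp (Set.notMem_empty _)
      · rw [hPf'b b hb]; exact hP b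
    have hC' : ∀ b, Chn (Pf' b) := by
      intro b
      by_cases hb : b = a
      · subst hb; rw [hPf'a]; intro p hp; exact absurd hp (Set.notMem_empty _)
      · rw [hPf'b b hb]; exact hC b
    have hVe : ∀ T : H₁ →L[ℂ] H₂, T ∈ VP (Pf' a) := by
      intro T; rw [hPf'a]; intro p hp; exact absurd hp (Set.notMem_empty _)
    have hV' : ∀ b ∉ S, Dg 𝓡 ⊆ VP (Pf' b) := by
      intro b hb
      by_cases hba : b = a
      · subst hba; exact fun T _ => hVe T
      · rw [hPf'b b hba]; exact hV b (by simp [hba, hb])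
    -- module properties
    have hcomm : ∀ {Q : Set ((H₁ →L[ℂ] H₁) × (H₂ →L[ℂ] H₂))}, Ok D₁ D₂ Q → ∀ A ∈ D₁, ∀ q ∈ Q, A * q.1 = q.1 * A :=
      fun hQ A hA q hq => hD₁ _ hA _ (hQ q hq).2.2.1
    have hcomm2 : ∀ {Q : Set ((H₁ →L[ℂ] H₁) × (H₂ →L[ℂ] H₂))}, Ok D₁ D₂ Q → ∀ A ∈ D₂, ∀ q ∈ Q, A * q.2 = q.2 * A :=
      fun hQ A hA q hq => hD₂ _ hA _ (hQ q hq).2.2.2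
    have hVmod : ∀ b, ∀ T ∈ VP (Pf b), ∀ A ∈ D₁, ∀ B ∈ D₂, B ∘L T ∘L A ∈ VP (Pf b) :=
      fun b T hT A hA B hB => VP_mod hT (hcomm (hP b) A hA) (hcomm2 (hP b) B hB)
    have hRmod : ∀ Q, Ok D₁ D₂ Q → ∀ X ∈ ADg ht₁ ht₂ Q, ∀ A ∈ D₁, ∀ B ∈ D₂, amp ht₂ B ∘L X ∘L amp ht₁ A ∈ ADg ht₁ ht₂ Q :=
      fun Q hQ X hX A hA B hB => ADg_mod ht₁ ht₂ hX (hcomm hQ A hA) (hcomm2 hQ B hB)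
    have hLmod : ∀ X ∈ LH ht₁ ht₂ Pf U, ∀ A ∈ D₁, ∀ B ∈ D₂, amp ht₂ B ∘L X ∘L amp ht₁ A ∈ LH ht₁ ht₂ Pf U := by
      intro X hX A hA B hB
      refine (Submodule.mem_iInf _).2 fun j => ?_
      exact cspan_GG_mod ht₁ ht₂ (fun i S hS => Or.inr ⟨hVmod _ _ hS A hA B hB, le_rfl⟩) ((Submodule.mem_iInf _).1 hX j)
    -- off diagonal parts
    have upper : ∀ p ∈ Pf a, ∀ X ∈ LH ht₁ ht₂ Pf U, X ∈ ADg ht₁ ht₂ 𝓡 →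
        amp ht₂ p.2 ∘L X ∘L amp ht₁ (1 - p.1) ∈ RH ht₁ ht₂ Pf U := by
      intro p hp X hX hXR
      obtain ⟨hp1, hp2, hp3, hp4⟩ := hP a p hp
      have hp3' : 1 - p.1 ∈ D₁ := sub_mem (one_mem _) hp3
      have hZ1 : amp ht₂ p.2 ∘L X ∘L amp ht₁ (1 - p.1) ∈ LH ht₁ ht₂ Pf' U := by
        refine (Submodule.mem_iInf _).2 fun j => ?_
        refine cspan_GG_mod ht₁ ht₂ (fun i S hS => Or.inr ⟨?_, le_rfl⟩) ((Submodule.mem_iInf _).1 hX j)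
        by_cases hb : (⟨i, j i⟩ : Σ i, J i) = a
        · show _ ∈ VP (Pf' _)
          rw [hb]; exact hVe _
        · show _ ∈ VP (Pf' _)
          rw [hPf'b _ hb]; exact hVmod _ _ hS _ hp3' _ hp4
      have hZ2 := ih Pf' U 𝓡 hP' hC' hR hV' _ hZ1 (hRmod 𝓡 hR X hXR _ hp3' _ hp4)
      have e1 : p.2 ∘L p.2 = p.2 := hp2.1
      have e2 : (1 - p.1) ∘L (1 - p.1) = 1 - p.1 := by
        have : p.1 * p.1 = p.1 := hp1.1
        show (1 - p.1) * (1 - p.1) = 1 - p.1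
        simp [mul_sub, sub_mul, this]
      have hZ3 : amp ht₂ p.2 ∘L X ∘L amp ht₁ (1 - p.1) = amp ht₂ p.2 ∘L (amp ht₂ p.2 ∘L X ∘L amp ht₁ (1 - p.1)) ∘L amp ht₁ (1 - p.1) := by
        conv_lhs => rw [← e1, ← e2, ← amp_comp, ← amp_comp]
        simp only [ContinuousLinearMap.comp_assoc]
      rw [hZ3]
      refine cspan_GG_mod ht₁ ht₂ (fun i S hS => Or.inr ⟨?_, le_rfl⟩) hZ2
      refine Set.mem_iInter.2 fun j => ?_
      have hSj := Set.mem_iInter.1 hS j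
      by_cases hb : (⟨i, j⟩ : Σ i, J i) = a
      · rw [hb]
        intro q hq
        rcases hC a p hp q hq with h | h
        · have : (1 - p.1) ∘L q.1 = 0 := by rw [ContinuousLinearMap.sub_comp, h]; exact sub_self q.1
          calc (1 - q.2) ∘L (p.2 ∘L S ∘L (1 - p.1)) ∘L q.1 = (1 - q.2) ∘L p.2 ∘L S ∘L ((1 - p.1) ∘L q.1) := rfl
            _ = 0 := by rw [this]; simp
        · have : (1 - q.2) ∘L p.2 = 0 := by rw [ContinuousLinearMap.sub_comp, h]; exact sub_self p.2
          calc (1 - q.2) ∘L (p.2 ∘L S ∘L (1 - p.1)) ∘L q.1 = ((1 - q.2) ∘L p.2) ∘L S ∘L ((1 - p.1) ∘L q.1) := rfl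
            _ = 0 := by rw [this]; simp
      · rw [hPf'b _ hb] at hSj
        exact hVmod _ _ hSj _ hp3' _ hp4
    have lower : ∀ p ∈ Pf a, ∀ X ∈ LH ht₁ ht₂ Pf U, X ∈ ADg ht₁ ht₂ 𝓡 →
        amp ht₂ (1 - p.2) ∘L X ∘L amp ht₁ p.1 ∈ RH ht₁ ht₂ Pf U := by
      intro p hp X hX hXR
      obtain ⟨hp1, hp2, hp3, hp4⟩ := hP a p hp
      have hp4' : 1 - p.2 ∈ D₂ := sub_mem (one_mem _) hp4
      obtain ⟨i0, j0⟩ := a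
      let U' := Function.update U i0 ∅
      have hU'a : U' i0 = ∅ := Function.update_self _ _ _
      have hU'b : ∀ i, i ≠ i0 → U' i = U i := fun b hb => Function.update_of_ne hb _ _
      have hne : ∀ i, i ≠ i0 → ∀ j, (⟨i, j⟩ : Σ i, J i) ≠ ⟨i0, j0⟩ := by
        intro i hi j h
        exact hi (congrArg Sigma.fst h)
      have hZ1 : amp ht₂ (1 - p.2) ∘L X ∘L amp ht₁ p.1 ∈ LH ht₁ ht₂ Pf' U' := by
        refine (Submodule.mem_iInf _).2 fun j => ?_
        refine cspan_GG_mod ht₁ ht₂ (fun i S hS => ?_) ((Submodule.mem_iInf _).1 hX (Function.update j i0 j0))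
        by_cases hi : i = i0
        · subst hi
          left
          have hS' : S ∈ VP (Pf ⟨i, Function.update j i j0 i⟩) := hS
          rw [Function.update_self] at hS'
          exact hS' p hp
        · right
          have hS' : S ∈ VP (Pf ⟨i, Function.update j i0 j0 i⟩) := hS
          rw [Function.update_of_ne hi] at hS'
          refine ⟨?_, (hU'b i hi).ge⟩
          show _ ∈ VP (Pf' _)
          rw [hPf'b _ (hne i hi _)]; exact hVmod _ _ hS' _ hp3 _ hp4'
      have hZ2 := ih Pf' U' 𝓡 hP' hC' hR hV' _ hZ1 (hRmod 𝓡 hR X hXR _ hp3 _ hp4')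
      refine cspan_mono ?_ hZ2
      rintro _ ⟨i, S, hS, R, hR, rfl⟩
      by_cases hi : i = i0
      · subst hi; rw [hU'a] at hR; exact absurd hR (Set.notMem_empty _)
      · refine ⟨i, S, Set.mem_iInter.2 fun j => ?_, R, by rwa [hU'b i hi] at hR, rfl⟩
        have := Set.mem_iInter.1 hS j
        rwa [hPf'b _ (hne i hi _)] at this
    -- finite truncations
    have fin : ∀ 𝓕 : Finset ((H₁ →L[ℂ] H₁) × (H₂ →L[ℂ] H₂)), (𝓕 : Set _) ⊆ Pf a → ∃ Y : T₁ →L[ℂ] T₂, ‖Y‖ ≤ ‖X‖ ∧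
        Y ∈ LH ht₁ ht₂ Pf U ∧ Y ∈ ADg ht₁ ht₂ 𝓡 ∧ Y ∈ ADg ht₁ ht₂ (𝓕 : Set _) ∧ X - Y ∈ RH ht₁ ht₂ Pf U := by
      intro 𝓕
      induction 𝓕 using Finset.induction_on with
      | empty =>
        intro _
        exact ⟨X, le_rfl, hX, hXR, fun p hp => by simp at hp, by rw [sub_self]; exact Submodule.zero_mem _⟩
      | insert p 𝓕 hp𝓕 ihF =>
        intro hsub
        obtain ⟨Y, hY1, hY2, hY3, hY4, hY5⟩ := ihF (fun q hq => hsub (by simp at hq ⊢; exact Or.inr hq))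
        have hp : p ∈ Pf a := hsub (by simp)
        obtain ⟨hp1, hp2, hp3, hp4⟩ := hP a p hp
        have hp3' : 1 - p.1 ∈ D₁ := sub_mem (one_mem _) hp3
        have hp4' : 1 - p.2 ∈ D₂ := sub_mem (one_mem _) hp4
        have hF : Ok D₁ D₂ (𝓕 : Set _) := fun q hq => hP a q (hsub (by simp at hq ⊢; exact Or.inr hq))
        have hE1 := amp_proj ht₁ hp1
        have hF1 := amp_proj ht₂ hp2
        set E := amp ht₁ p.1 with hEdef
        set F := amp ht₂ p.2 with hFdef
        have hE' : amp ht₁ (1 - p.1) = 1 - E := by rw [amp_sub, amp_one]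
        have hF' : amp ht₂ (1 - p.2) = 1 - F := by rw [amp_sub, amp_one]
        have u1 := upper p hp Y hY2 hY3
        have u2 := lower p hp Y hY2 hY3
        refine ⟨F ∘L Y ∘L E + (1 - F) ∘L Y ∘L (1 - E), (norm_diag hE1 hF1).trans hY1, ?_, ?_, ?_, ?_⟩
        · refine Submodule.add_mem _ (hLmod Y hY2 _ hp3 _ hp4) ?_
          rw [← hE', ← hF']
          exact hLmod Y hY2 _ hp3' _ hp4'
        · refine ADg_add ht₁ ht₂ (hRmod _ hR Y hY3 _ hp3 _ hp4) ?_
          rw [← hE', ← hF']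
          exact hRmod _ hR Y hY3 _ hp3' _ hp4'
        · have hold : F ∘L Y ∘L E + (1 - F) ∘L Y ∘L (1 - E) ∈ ADg ht₁ ht₂ (𝓕 : Set _) := by
            refine ADg_add ht₁ ht₂ (hRmod _ hF Y hY4 _ hp3 _ hp4) ?_
            rw [← hE', ← hF']
            exact hRmod _ hF Y hY4 _ hp3' _ hp4'
          intro q hq
          rw [Finset.coe_insert] at hq
          rcases hq with rfl | hq
          · rw [← hEdef, ← hFdef]
            have e1 : F ∘L (1 - F) = 0 := by rw [ContinuousLinearMap.comp_sub, hF1.1]; exact sub_self F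
            have e2 : (1 - E) ∘L E = 0 := by rw [ContinuousLinearMap.sub_comp, hE1.1]; exact sub_self E
            have f1 : F ∘L (F ∘L Y ∘L E) = F ∘L Y ∘L E := by
              rw [← ContinuousLinearMap.comp_assoc, hF1.1]
            have f2 : F ∘L ((1 - F) ∘L Y ∘L (1 - E)) = 0 := by
              rw [← ContinuousLinearMap.comp_assoc, e1, ContinuousLinearMap.zero_comp]
            have f3 : (F ∘L Y ∘L E) ∘L E = F ∘L Y ∘L E := by
              rw [ContinuousLinearMap.comp_assoc, ContinuousLinearMap.comp_assoc, hE1.1]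
            have f4 : ((1 - F) ∘L Y ∘L (1 - E)) ∘L E = 0 := by
              rw [ContinuousLinearMap.comp_assoc, ContinuousLinearMap.comp_assoc, e2, ContinuousLinearMap.comp_zero, ContinuousLinearMap.comp_zero]
            rw [ContinuousLinearMap.comp_add, ContinuousLinearMap.add_comp, f1, f2, f3, f4]
          · exact hold q hq
        · have : X - (F ∘L Y ∘L E + (1 - F) ∘L Y ∘L (1 - E)) = (X - Y) + (F ∘L Y ∘L (1 - E) + (1 - F) ∘L Y ∘L E) := by
            ext x
            simp only [add_apply, sub_apply, ContinuousLinearMap.comp_apply, one_apply_eq_self, map_sub]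
            abel
          rw [this]
          rw [hE'] at u1
          rw [hF'] at u2
          exact Submodule.add_mem _ hY5 (Submodule.add_mem _ u1 u2)
    choose! f hf using fin
    let β := Finset (Pf a)
    let g : β → Finset ((H₁ →L[ℂ] H₁) × (H₂ →L[ℂ] H₂)) := fun s => s.map (Function.Embedding.subtype _)
    have hg : ∀ s, (g s : Set _) ⊆ Pf a := by
      intro s x hx; simp [g] at hx; exact hx.1
    let u : Ultrafilter β := Ultrafilter.of atTop
    have hu : (u : Filter β) ≤ atTop := Ultrafilter.of_le _
    obtain ⟨Y, -, hY⟩ := exists_lim u (f := fun s => f (g s)) (C := ‖X‖) (fun s => (hf _ (hg s)).1)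
    have hYL : Y ∈ LH ht₁ ht₂ Pf U := wk_mem_of_tendsto (LH_closed ht₁ ht₂ Pf U) hY (fun s => (hf _ (hg s)).2.1)
    have hYR : Y ∈ ADg ht₁ ht₂ (𝓡 ∪ Pf a) := by
      rintro p (hp | hp)
      · exact ADg_lim hY (Eventually.of_forall fun s => (hf _ (hg s)).2.2.1 p hp)
      · refine ADg_lim hY (hu ?_)
        filter_upwards [eventually_ge_atTop ({⟨p, hp⟩} : Finset (Pf a))] with s hs
        refine (hf _ (hg s)).2.2.2.1 p ?_
        have : (⟨p, hp⟩ : Pf a) ∈ s := hs (Finset.mem_singleton_self _)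
        simp [g, this, hp]
    have hXY : X - Y ∈ RH ht₁ ht₂ Pf U := by
      have hcl : WkClosed {Z : T₁ →L[ℂ] T₂ | (-1 : ℂ) • (Z + -X) ∈ RH ht₁ ht₂ Pf U} :=
        closed_comap (wk_add_right (-X)) (closed_comap (wk_smul (-1)) (cspan_closed (GG ht₁ ht₂ (fun i => ⋂ j, VP (Pf ⟨i, j⟩)) U)))
      have e : ∀ Z : T₁ →L[ℂ] T₂, (-1 : ℂ) • (Z + -X) = X - Z := by
        intro Z; rw [neg_one_smul]; abel
      have := wk_mem_of_tendsto hcl hY (fun s => by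
        show _ ∈ RH ht₁ ht₂ Pf U
        rw [e]; exact (hf _ (hg s)).2.2.2.2)
      rw [← e]; exact this
    have hYRH : Y ∈ RH ht₁ ht₂ Pf U := by
      refine ih Pf U (𝓡 ∪ Pf a) hP hC ?_ ?_ Y hYL hYR
      · rintro p (hp | hp)
        · exact hR p hp
        · exact hP a p hp
      · intro b hb T hT
        by_cases hba : b = a
        · subst hba
          intro p hp
          have h1 := hT p (Or.inr hp)
          have h2 : p.1 ∘L p.1 = p.1 := (hP _ p hp).1.1
          have h3 : p.2 ∘L T ∘L p.1 = T ∘L p.1 := by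
            rw [← ContinuousLinearMap.comp_assoc, h1, ContinuousLinearMap.comp_assoc, h2]
          rw [ContinuousLinearMap.sub_comp, h3]
          exact sub_self (T ∘L p.1)
        · exact hV b (by simp [hba, hb]) (fun p hp => hT p (Or.inl hp))
    have := Submodule.add_mem _ hXY hYRH
    rwa [sub_add_cancel] at this
end MI
end OSP
end


noncomputable section
open scoped ComplexInnerProductSpace
open scoped InnerProduct
open Set OpSynth Filter Topology
open ContinuousLinearMap (adjoint)
set_option linter.unusedVariables false
set_option linter.unusedSectionVars false
namespace OSP
section NP
variable {H K : Type*}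
  [NormedAddCommGroup H] [InnerProductSpace ℂ H] [CompleteSpace H]
  [NormedAddCommGroup K] [InnerProductSpace ℂ K] [CompleteSpace K]

/-- projection on the closure -/
def np (E : Submodule ℂ H) : H →L[ℂ] H := E.topologicalClosure.starProjection

lemma np_proj (E : Submodule ℂ H) : IsProj (np E) := starProj_isProj _

lemma np_mem {E : Submodule ℂ H} (hE : IsClosed (E : Set H)) (x : H) : np E x ∈ E := by
  have : np E x ∈ E.topologicalClosure := Submodule.starProjection_apply_mem _ _
  rwa [hE.submodule_topologicalClosure_eq] at this

lemma np_of_mem {E : Submodule ℂ H} {x : H} (h : x ∈ E) : np E x = x :=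
  Submodule.starProjection_eq_self_iff.2 (Submodule.le_topologicalClosure _ h)

lemma np_of_orth {E : Submodule ℂ H} {x : H} (h : x ∈ Eᗮ) : np E x = 0 :=
  (Submodule.starProjection_apply_eq_zero_iff _).2 (by rwa [Submodule.orthogonal_closure])

lemma np_np {E F : Submodule ℂ H} (hE : IsClosed (E : Set H)) (h : E ≤ F) (x : H) : np F (np E x) = np E x :=
  np_of_mem (h (np_mem hE x))

lemma np_np' {E F : Submodule ℂ H} (hE : IsClosed (E : Set H)) (h : E ≤ F) (x : H) : np E (np F x) = np E x := by
  refine ext_inner_left ℂ fun y => ?_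
  rw [← (np_proj E).inner, ← (np_proj F).inner, np_np hE h, (np_proj E).inner]

lemma np_inner_self (E : Submodule ℂ H) (x : H) : ⟪np E x, x⟫ = ((‖np E x‖ ^ 2 : ℝ) : ℂ) := by
  rw [← (np_proj E).app, (np_proj E).inner, (np_proj E).app, inner_self_eq_norm_sq_to_K]; norm_num

lemma np_inner_le {E F : Submodule ℂ H} (hE : IsClosed (E : Set H)) (h : E ≤ F) (x : H) :
    ⟪np E x, np F x⟫ = ((‖np E x‖ ^ 2 : ℝ) : ℂ) := by
  rw [← (np_proj F).inner, np_np hE h, np_inner_self]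

lemma np_mono {E F : Submodule ℂ H} (hE : IsClosed (E : Set H)) (h : E ≤ F) (x : H) : ‖np E x‖ ≤ ‖np F x‖ := by
  rw [← np_np' hE h]; exact (np_proj E).norm_le _

lemma np_orth {E : Submodule ℂ H} (x : H) : x - np E x ∈ Eᗮ := by
  intro y hy
  rw [inner_sub_right, ← (np_proj E).inner, np_of_mem hy, sub_self]

lemma np_diff_orth {E F : Submodule ℂ H} (hE : IsClosed (E : Set H)) (h : E ≤ F) (x : H) : np F x - np E x ∈ Eᗮ := by
  have := np_orth (E := E) (np F x)
  rwa [np_np' hE h] at this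

lemma np_diff_norm {E F : Submodule ℂ H} (hE : IsClosed (E : Set H)) (h : E ≤ F) (x : H) :
    ‖np F x - np E x‖ ^ 2 = ‖np F x‖ ^ 2 - ‖np E x‖ ^ 2 := by
  have h1 := congrArg RCLike.re (np_inner_le hE h x)
  rw [@norm_sub_sq ℂ, ← inner_re_symm, h1, show RCLike.re (((‖np E x‖ ^ 2 : ℝ) : ℂ)) = ‖np E x‖ ^ 2 from Complex.ofReal_re _]
  ring

/-- Gram kernel is the min -/
lemma np_gram {N : Set (Submodule ℂ H)} (hN : IsNest N) {E F : Submodule ℂ H} (hE : E ∈ N) (hF : F ∈ N) (x : H) :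
    ⟪np E x, np F x⟫ = ((min (‖np E x‖ ^ 2) (‖np F x‖ ^ 2) : ℝ) : ℂ) := by
  rcases hN.2.1.total hE hF with h | h
  · rw [np_inner_le (hN.1 E hE) h, min_eq_left]
    exact pow_le_pow_left₀ (norm_nonneg _) (np_mono (hN.1 E hE) h x) 2
  · rw [← inner_conj_symm, np_inner_le (hN.1 F hF) h, min_eq_right]
    · simp
    · exact pow_le_pow_left₀ (norm_nonneg _) (np_mono (hN.1 F hF) h x) 2

lemma lim_sup {N S : Set (Submodule ℂ H)} (hN : IsNest N) (hS : S ⊆ N) (hne : S.Nonempty) (x : H) {v : ℝ}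
    (h : ∀ F ∈ S, ‖np F x‖ ^ 2 ≤ v) : ‖np ((sSup S).topologicalClosure) x‖ ^ 2 ≤ v := by
  have : Nonempty S := hne.to_subtype
  have : IsDirected S (· ≤ ·) := ⟨fun a b => by
    rcases hN.2.1.total (hS a.2) (hS b.2) with h | h
    · exact ⟨b, h, le_rfl⟩
    · exact ⟨a, le_rfl, h⟩⟩
  have : ∀ i : S, CompleteSpace (i : Submodule ℂ H) := fun i => (hN.1 _ (hS i.2)).completeSpace_coe
  have := Submodule.starProjection_tendsto_closure_iSup (fun i : S => (i : Submodule ℂ H)) (fun a b h => h) x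
  have e : np ((sSup S).topologicalClosure) x = (⨆ i : S, (i : Submodule ℂ H)).topologicalClosure.starProjection x := by
    unfold np
    congr 2
    rw [(Submodule.isClosed_topologicalClosure _).submodule_topologicalClosure_eq, sSup_eq_iSup']
  rw [e]
  refine le_of_tendsto' (this.norm.pow 2) fun i => ?_
  have e3 : np (i : Submodule ℂ H) x = (i : Submodule ℂ H).starProjection x := by
    unfold np
    congr 2
    exact (hN.1 _ (hS i.2)).submodule_topologicalClosure_eq
  rw [← e3]; exact h i i.2

lemma lim_inf {N S : Set (Submodule ℂ H)} (hN : IsNest N) (hS : S ⊆ N) (hne : S.Nonempty) (x : H) {v : ℝ}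
    (h : ∀ F ∈ S, v ≤ ‖np F x‖ ^ 2) : v ≤ ‖np (sInf S) x‖ ^ 2 := by
  have : Nonempty S := hne.to_subtype
  have : IsDirected Sᵒᵈ (· ≤ ·) := ⟨fun a b => by
    rcases hN.2.1.total (hS (OrderDual.ofDual a).2) (hS (OrderDual.ofDual b).2) with h | h
    · exact ⟨a, le_rfl, h⟩
    · exact ⟨b, h, le_rfl⟩⟩
  have hcl := hN.1 _ (hN.2.2 S hS).1
  have key : ∀ F : Submodule ℂ H, Fᗮ.starProjection x = x - np F x := by
    intro F
    rw [show Fᗮ.starProjection x = F.topologicalClosureᗮ.starProjection x by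
      congr 2; rw [Submodule.orthogonal_closure], Submodule.starProjection_orthogonal']
    rfl
  have := Submodule.starProjection_tendsto_closure_iSup (fun i : Sᵒᵈ => ((OrderDual.ofDual i : S) : Submodule ℂ H)ᗮ)
    (fun a b h => Submodule.orthogonal_le h) x
  have e : (⨆ i : Sᵒᵈ, ((OrderDual.ofDual i : S) : Submodule ℂ H)ᗮ).topologicalClosure = (sInf S)ᗮ := by
    rw [← Submodule.orthogonal_orthogonal_eq_closure, ← Submodule.iInf_orthogonal]
    congr 1
    rw [sInf_eq_iInf']
    refine Equiv.iInf_congr OrderDual.ofDual fun i => ?_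
    have : CompleteSpace ((OrderDual.ofDual i : S) : Submodule ℂ H) := (hN.1 _ (hS (OrderDual.ofDual i).2)).completeSpace_coe
    rw [Submodule.orthogonal_orthogonal]
  have e2 : (⨆ i : Sᵒᵈ, ((OrderDual.ofDual i : S) : Submodule ℂ H)ᗮ).topologicalClosure.starProjection x = x - np (sInf S) x := by
    rw [← key]; congr 2
  rw [e2] at this
  simp only [key] at this
  have t2 := (this.const_sub x)
  simp only [sub_sub_cancel] at t2
  exact ge_of_tendsto' (t2.norm.pow 2) fun i => h _ (OrderDual.ofDual i).2

/-- adjacent pairs -/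
def Adj (N : Set (Submodule ℂ H)) (L R : Submodule ℂ H) : Prop := L ∈ N ∧ R ∈ N ∧ L ≤ R ∧ ∀ F ∈ N, F ≤ L ∨ R ≤ F

lemma exists_level {N : Set (Submodule ℂ H)} (hN : IsNest N) (x : H) (hx : ∀ L R, Adj N L R → np R x = np L x)
    {v : ℝ} (h0 : 0 ≤ v) (h1 : v ≤ ‖x‖ ^ 2) : ∃ E ∈ N, ‖np E x‖ ^ 2 = v := by
  have hbot : (⊥ : Submodule ℂ H) ∈ N := by
    have := (hN.2.2 ∅ (empty_subset _)).2
    rwa [sSup_empty, (isClosed_singleton : IsClosed ((⊥ : Submodule ℂ H) : Set H)).submodule_topologicalClosure_eq] at this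
  have htop : (⊤ : Submodule ℂ H) ∈ N := by
    have := (hN.2.2 ∅ (empty_subset _)).1
    rwa [sInf_empty] at this
  set S := {F | F ∈ N ∧ ‖np F x‖ ^ 2 ≤ v} with hS
  set S' := {F | F ∈ N ∧ v ≤ ‖np F x‖ ^ 2} with hS'
  have hE := (hN.2.2 S (fun F hF => hF.1)).2
  have hG := (hN.2.2 S' (fun F hF => hF.1)).1
  have hE1 := lim_sup hN (S := S) (fun F hF => hF.1) ⟨⊥, hbot, by
    have : np ⊥ x = 0 := np_of_orth (by simp)
    rw [this]; simpa using h0⟩ x (fun F hF => hF.2)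
  have hG1 := lim_inf hN (S := S') (fun F hF => hF.1) ⟨⊤, htop, by
    rw [np_of_mem (Submodule.mem_top)]; exact h1⟩ x (fun F hF => hF.2)
  set E := (sSup S).topologicalClosure
  set G := sInf S'
  rcases hN.2.1.total hE hG with h | h
  · have : np G x = np E x := hx E G ⟨hE, hG, h, fun F hF => by
      rcases le_total (‖np F x‖ ^ 2) v with h | h
      · exact Or.inl ((le_sSup (show F ∈ S from ⟨hF, h⟩)).trans (Submodule.le_topologicalClosure _))
      · exact Or.inr (sInf_le ⟨hF, h⟩)⟩
    rw [this] at hG1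
    exact ⟨E, hE, le_antisymm hE1 hG1⟩
  · exact ⟨E, hE, le_antisymm hE1 (hG1.trans (pow_le_pow_left₀ (norm_nonneg _) (np_mono (hN.1 _ hG) h x) 2))⟩
end NP
end OSP
end


noncomputable section
open scoped ComplexInnerProductSpace
open scoped InnerProduct
open Set OpSynth Filter Topology
open ContinuousLinearMap (adjoint)
set_option linter.unusedVariables false
set_option linter.unusedSectionVars false
namespace OSP
section BR
variable {H K : Type*}
  [NormedAddCommGroup H] [InnerProductSpace ℂ H] [CompleteSpace H]
  [NormedAddCommGroup K] [InnerProductSpace ℂ K] [CompleteSpace K]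
open InnerProductSpace (rankOne rankOne_apply)

variable {n : ℕ} {c : ℝ} {u : ℕ → H}

/-- increments -/
def inc (u : ℕ → H) (i : ℕ) : H := u (i + 1) - u i

/-- shift operator -/
def shf (n : ℕ) (c : ℝ) (u : ℕ → H) : H →L[ℂ] H :=
  ∑ i ∈ Finset.range n, (c : ℂ) • rankOne ℂ (inc u i) (inc u (i + 1))

variable (hc : 0 < c) (hu : ∀ i ≤ n + 1, ∀ j ≤ n + 1, ⟪u i, u j⟫ = ((min (i : ℝ) j / c : ℝ) : ℂ))
include hc hu

lemma inc_orth {i j : ℕ} (hi : i ≤ n) (hj : j ≤ n) (hij : i ≠ j) : ⟪inc u i, inc u j⟫ = 0 := by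
  simp only [inc, inner_sub_left, inner_sub_right]
  rw [hu _ (by omega) _ (by omega), hu _ (by omega) _ (by omega), hu _ (by omega) _ (by omega), hu _ (by omega) _ (by omega)]
  norm_cast
  rcases lt_or_gt_of_ne hij with h | h
  · rw [min_eq_left (by omega), min_eq_left (by omega), min_eq_left (by omega), min_eq_left (by omega)]; ring
  · rw [min_eq_right (by omega), min_eq_right (by omega), min_eq_right (by omega), min_eq_right (by omega)]; ring

lemma inc_self {i : ℕ} (hi : i ≤ n) : ⟪inc u i, inc u i⟫ = ((1 / c : ℝ) : ℂ) := by
  simp only [inc, inner_sub_left, inner_sub_right]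
  rw [hu _ (by omega) _ (by omega), hu _ (by omega) _ (by omega), hu _ (by omega) _ (by omega), hu _ (by omega) _ (by omega)]
  rw [← Complex.ofReal_sub, ← Complex.ofReal_sub, ← Complex.ofReal_sub]
  congr 1
  push_cast
  rw [min_self, min_self, min_eq_left (by linarith), min_eq_right (by linarith)]
  ring

lemma inc_norm {i : ℕ} (hi : i ≤ n) : ‖inc u i‖ ^ 2 = 1 / c := by
  have := inc_self hc hu hi
  rw [inner_self_eq_norm_sq_to_K] at this
  refine Complex.ofReal_injective ?_
  rw [← this, Complex.ofReal_pow]; rfl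

lemma shf_norm : ‖shf n c u‖ ≤ 1 := by
  have hcc : (c : ℂ) ≠ 0 := by exact_mod_cast hc.ne'
  refine norm_block _ _ (fun i => (c : ℂ) • rankOne ℂ (inc u (i + 1)) (inc u (i + 1))) zero_le_one ?_ ?_ ?_
  · refine proj_sum_sq _ _ ?_ ?_
    · intro i hi
      have hi' : i + 1 ≤ n := by simpa using hi
      refine ⟨?_, ?_⟩
      · ext x
        simp only [ContinuousLinearMap.comp_apply, smul_apply, rankOne_apply, inner_smul_right, inc_self hc hu hi', smul_smul]
        congr 1
        push_cast
        field_simp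
      · rw [IsSelfAdjoint, star_smul, ContinuousLinearMap.star_eq_adjoint]
        simp
    · intro i hi j hj hij
      have hi' : i + 1 ≤ n := by simpa using hi
      have hj' : j + 1 ≤ n := by simpa using hj
      ext x
      simp [inner_smul_right, inc_orth hc hu hi' hj' (by omega)]
  · intro i hi x
    have hi' : i + 1 ≤ n := by simpa using hi
    have : ‖inc u i‖ = ‖inc u (i + 1)‖ := by
      rw [← sq_eq_sq₀ (norm_nonneg _) (norm_nonneg _), inc_norm hc hu hi', inc_norm hc hu (by omega)]
    simp only [smul_apply, rankOne_apply, norm_smul, this, one_mul, le_refl]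
  · intro i hi j hj hij x
    have hi' : i + 1 ≤ n := by simpa using hi
    have hj' : j + 1 ≤ n := by simpa using hj
    simp only [smul_apply, rankOne_apply, inner_smul_left, inner_smul_right, inc_orth hc hu (show i ≤ n by omega) (show j ≤ n by omega) hij, mul_zero]

lemma shf_err {w : H} {m : ℝ} (hm : ‖w‖ ^ 2 = m) (hmn : m ≤ (n + 1) / c) (hw : ∀ i ≤ n + 1, ⟪u i, w⟫ = ((min (i / c) m : ℝ) : ℂ)) :
    ‖shf n c u w - w‖ ^ 2 ≤ 2 / c := by
  have hcc : (c : ℂ) ≠ 0 := by exact_mod_cast hc.ne'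
  have hm0 : 0 ≤ m := hm ▸ sq_nonneg _
  let la : ℕ → ℝ := fun i => min ((i + 1 : ℝ) / c) m - min (i / c) m
  have hla : ∀ i ≤ n, ⟪inc u i, w⟫ = (la i : ℂ) := by
    intro i hi
    simp only [inc, inner_sub_left, la]
    rw [hw _ (by omega), hw _ (by omega)]
    push_cast; rfl
  have hla' : ∀ i ≤ n, ⟪w, inc u i⟫ = (la i : ℂ) := by
    intro i hi
    rw [← inner_conj_symm, hla i hi, Complex.conj_ofReal]
  have h1 : RCLike.re ⟪w, shf n c u w⟫ = ∑ i ∈ Finset.range n, c * (la (i + 1) * la i) := by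
    rw [shf, sum_apply, inner_sum, map_sum]
    refine Finset.sum_congr rfl fun i hi => ?_
    have hi' : i + 1 ≤ n := by simpa using hi
    simp only [smul_apply, rankOne_apply, inner_smul_right, hla _ hi', hla' i (by omega)]
    rw [← Complex.ofReal_mul, ← Complex.ofReal_mul]
    exact Complex.ofReal_re _
  have h2 : ∀ i : ℕ, c * (la (i + 1) * la i) = la (i + 1) := by
    intro i
    simp only [la]
    push_cast
    have e1 : ((i : ℝ) + 1) / c = i / c + 1 / c := by ring
    have e2 : ((i : ℝ) + 1 + 1) / c = i / c + 1 / c + 1 / c := by ring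
    rw [e1, e2]
    have hp : 0 < 1 / c := by positivity
    rcases le_total m (i / c + 1 / c) with h | h
    · rw [min_eq_right (a := i / c + 1 / c + 1 / c) (by linarith), min_eq_right h]; ring
    · rw [min_eq_left h, min_eq_left (a := (i : ℝ) / c) (by linarith)]
      field_simp; ring
  have h3 : ∑ i ∈ Finset.range n, la (i + 1) = min (((n : ℝ) + 1) / c) m - min (1 / c) m := by
    have := Finset.sum_range_sub (fun i : ℕ => min (((i : ℝ) + 1) / c) m) n
    simp only [Nat.cast_zero, zero_add] at this
    rw [← this]
    refine Finset.sum_congr rfl fun i _ => ?_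
    simp only [la]; push_cast; ring
  rw [Finset.sum_congr rfl (fun i _ => h2 i), h3, min_eq_right hmn] at h1
  have h4 : ‖shf n c u w‖ ≤ ‖w‖ := by
    refine ((shf n c u).le_opNorm w).trans ?_
    have := shf_norm hc hu
    nlinarith [norm_nonneg w]
  have h5 : ‖shf n c u w‖ ^ 2 ≤ ‖w‖ ^ 2 := pow_le_pow_left₀ (norm_nonneg _) h4 2
  rw [@norm_sub_sq ℂ, ← inner_re_symm, h1]
  have h6 : min (1 / c) m ≤ 1 / c := min_le_left _ _
  have h7 : 2 / c = 2 * (1 / c) := by ring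
  linarith
end BR
end OSP
end


noncomputable section
open scoped ComplexInnerProductSpace
open scoped InnerProduct
open Set OpSynth Filter Topology
open ContinuousLinearMap (adjoint)
set_option linter.unusedVariables false
set_option linter.unusedSectionVars false
namespace OSP
section RF
variable {H K : Type*}
  [NormedAddCommGroup H] [InnerProductSpace ℂ H] [CompleteSpace H]
  [NormedAddCommGroup K] [InnerProductSpace ℂ K] [CompleteSpace K]
open InnerProductSpace (rankOne rankOne_apply)

lemma norm_closed {V : Set (H →L[ℂ] K)} (hV : WkClosed V) : IsClosed V := by
  refine IsSeqClosed.isClosed ?_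
  intro f Y hf hY
  obtain ⟨C, hC⟩ := hY.norm.bddAbove_range
  refine wk_mem_of_tendsto (l := atTop) hV (wk_tendsto_of_bdd (C := C) (fun i => hC ⟨i, rfl⟩) fun x y => ?_) hf
  have h1 : Tendsto (fun i => f i x) atTop (𝓝 (Y x)) := ((ContinuousLinearMap.apply ℂ K x).continuous.tendsto Y).comp hY
  exact tendsto_const_nhds.inner h1

/-- support map -/
def theta (V : Submodule ℂ (H →L[ℂ] K)) (E : Submodule ℂ H) : Submodule ℂ K :=
  (Submodule.span ℂ {y | ∃ S ∈ V, ∃ x ∈ E, y = S x}).topologicalClosure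

variable {N : Set (Submodule ℂ H)} (hN : IsNest N) {V : Submodule ℂ (H →L[ℂ] K)} (hV : WkClosed (V : Set (H →L[ℂ] K)))
  (hVA : ∀ X ∈ V, ∀ A ∈ nestAlg N, X ∘L A ∈ V)

lemma words (hN : IsNest N) {W : H →L[ℂ] H} (hW : W ∈ Submonoid.closure (np '' N)) : ∃ E ∈ N, W = np E := by
  induction hW using Submonoid.closure_induction with
  | mem x hx => obtain ⟨E, hE, rfl⟩ := hx; exact ⟨E, hE, rfl⟩
  | one =>
    refine ⟨⊤, ?_, ?_⟩
    · have := (hN.2.2 ∅ (empty_subset _)).1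
      rwa [sInf_empty] at this
    · ext x; exact (np_of_mem Submodule.mem_top).symm
  | mul x y _ _ hx hy =>
    obtain ⟨E, hE, rfl⟩ := hx
    obtain ⟨F, hF, rfl⟩ := hy
    rcases hN.2.1.total hE hF with h | h
    · exact ⟨E, hE, by ext x; exact np_np' (hN.1 _ hE) h x⟩
    · exact ⟨F, hF, by ext x; exact np_np (hN.1 _ hF) h x⟩

include hV hVA in
lemma adj_rank {L R : Submodule ℂ H} (hLR : Adj N L R) {T : H →L[ℂ] K} (hT : ∀ x ∈ R, T x ∈ theta V R) {x z : H}
    (hx : x ∈ R) (hz : z ∈ Lᗮ) : T ∘L rankOne ℂ x z ∈ V := by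
  rw [InnerProductSpace.comp_rankOne]
  let φ : K →L[ℂ] (H →L[ℂ] K) := (rankOne ℂ : K →L[ℂ] H →L⋆[ℂ] H →L[ℂ] K).flip z
  have : theta V R ≤ V.comap (φ : K →ₗ[ℂ] (H →L[ℂ] K)) := by
    refine Submodule.topologicalClosure_minimal _ ?_ ?_
    · rw [Submodule.span_le]
      rintro _ ⟨S, hS, x, hx, rfl⟩
      show rankOne ℂ (S x) z ∈ V
      rw [← InnerProductSpace.comp_rankOne]
      refine hVA S hS _ ?_
      intro F hF w hw
      rw [rankOne_apply]
      rcases hLR.2.2.2 F hF with h | h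
      · rw [← inner_conj_symm, hz w (h hw)]; simp
      · exact F.smul_mem _ (h hx)
    · exact (norm_closed hV).preimage φ.continuous
  exact this (hT x hx)

include hN hV hVA in
lemma atom_case {L R : Submodule ℂ H} (hLR : Adj N L R) {T : H →L[ℂ] K} (hT : ∀ x ∈ R, T x ∈ theta V R) {ξ : H}
    (hx : ξ ∈ R) (hz : ξ ∈ Lᗮ) : T ∘L pc (np '' N) ξ ∈ V := by
  have e : cyc (np '' N) ξ = Submodule.span ℂ {ξ} := by
    refine le_antisymm ?_ ?_
    · refine Submodule.topologicalClosure_minimal _ ?_ (Submodule.closed_of_finiteDimensional _)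
      rw [Submodule.span_le]
      rintro _ ⟨W, hW, rfl⟩
      obtain ⟨E, hE, rfl⟩ := words hN hW
      rcases hLR.2.2.2 E hE with h | h
      · rw [np_of_orth (Submodule.orthogonal_le h hz)]; exact Submodule.zero_mem _
      · rw [np_of_mem (h hx)]; exact Submodule.mem_span_singleton_self _
    · rw [Submodule.span_le, Set.singleton_subset_iff]
      exact mem_cyc (W := 1) (Submonoid.one_mem _)
  have e2 : pc (np '' N) ξ = ((1 / ‖ξ‖ ^ 2 : ℝ) : ℂ) • rankOne ℂ ξ ξ := by
    ext x
    have : pc (np '' N) ξ x = (Submodule.span ℂ {ξ}).starProjection x := by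
      unfold pc; congr 2
    rw [this, Submodule.starProjection_singleton, smul_apply, rankOne_apply, smul_smul]
    congr 1
    push_cast
    ring_nf
    rfl
  rw [e2, ContinuousLinearMap.comp_smul]
  exact V.smul_mem _ (adj_rank hV hVA hLR hT hx hz)

include hN hV hVA in
lemma cont_case {T : H →L[ℂ] K} (hT : ∀ E ∈ N, ∀ x ∈ E, T x ∈ theta V E) {ξ : H} (hξ : ∀ L R, Adj N L R → np R ξ = np L ξ) :
    T ∘L pc (np '' N) ξ ∈ V := by
  by_cases hξ0 : ξ = 0
  · subst hξ0
    have htop : (⊤ : Submodule ℂ H) ∈ N := by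
      have := (hN.2.2 ∅ (empty_subset _)).1
      rwa [sInf_empty] at this
    exact atom_case hN hV hVA (L := ⊤) (R := ⊤) ⟨htop, htop, le_rfl, fun F _ => Or.inl le_top⟩ (hT ⊤ htop) (Submodule.zero_mem _) (Submodule.zero_mem _)
  have hp : 0 < ‖ξ‖ := norm_pos_iff.2 hξ0
  have hp2 : 0 < ‖ξ‖ ^ 2 := by positivity
  have approx : ∀ n : ℕ, ∃ A : H →L[ℂ] H, ‖A‖ ≤ 1 ∧ T ∘L A ∈ V ∧ (∀ x ∈ (cyc (np '' N) ξ)ᗮ, A x = 0) ∧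
      ∀ E ∈ N, ‖A (np E ξ) - np E ξ‖ ^ 2 ≤ 2 * ‖ξ‖ ^ 2 / (n + 1) := by
    intro n
    set c : ℝ := (n + 1) / ‖ξ‖ ^ 2 with hcdef
    have hc : 0 < c := by positivity
    have hcn : ((n : ℝ) + 1) / c = ‖ξ‖ ^ 2 := by rw [hcdef]; field_simp
    have hlev : ∀ i : ℕ, ∃ E, i ≤ n + 1 → E ∈ N ∧ ‖np E ξ‖ ^ 2 = i / c := by
      intro i
      by_cases hi : i ≤ n + 1
      · obtain ⟨E, h1, h2⟩ := exists_level hN ξ hξ (v := i / c) (by positivity) (by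
          rw [← hcn]
          have : (i : ℝ) ≤ n + 1 := by exact_mod_cast hi
          gcongr)
        exact ⟨E, fun _ => ⟨h1, h2⟩⟩
      · exact ⟨⊥, fun h => absurd h hi⟩
    choose E hE using hlev
    let u : ℕ → H := fun i => np (E i) ξ
    have hu : ∀ i ≤ n + 1, ∀ j ≤ n + 1, ⟪u i, u j⟫ = ((min (i : ℝ) j / c : ℝ) : ℂ) := by
      intro i hi j hj
      rw [np_gram hN (hE i hi).1 (hE j hj).1, (hE i hi).2, (hE j hj).2, min_div_div_right hc.le]
    have hEm : ∀ i, i + 1 ≤ n + 1 → E i ≤ E (i + 1) := by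
      intro i hi
      rcases hN.2.1.total (hE i (by omega)).1 (hE (i + 1) hi).1 with h | h
      · exact h
      · exfalso
        have h1 := pow_le_pow_left₀ (norm_nonneg _) (np_mono (hN.1 _ (hE (i + 1) hi).1) h ξ) 2
        rw [(hE i (by omega)).2, (hE (i + 1) hi).2, div_le_div_iff_of_pos_right hc] at h1
        push_cast at h1
        linarith
    refine ⟨shf n c u, shf_norm hc hu, ?_, ?_, ?_⟩
    · rw [shf, ContinuousLinearMap.comp_finsetSum]
      refine Submodule.sum_mem _ fun i hi => ?_
      have hi' : i < n := by simpa using hi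
      rw [ContinuousLinearMap.comp_smul]
      refine Submodule.smul_mem _ _ ?_
      have hEi := hE (i + 1) (by omega)
      refine adj_rank hV hVA (L := E (i + 1)) (R := E (i + 1)) ⟨hEi.1, hEi.1, le_rfl, fun F hF => hN.2.1.total hF hEi.1⟩ (hT _ hEi.1) ?_ ?_
      · exact Submodule.sub_mem _ (np_mem (hN.1 _ hEi.1) _) (hEm i (by omega) (np_mem (hN.1 _ (hE i (by omega)).1) _))
      · exact np_diff_orth (hN.1 _ hEi.1) (hEm (i + 1) (by omega)) ξ
    · intro x hx
      rw [shf, sum_apply]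
      refine Finset.sum_eq_zero fun i hi => ?_
      have hi' : i < n := by simpa using hi
      have hm : inc u (i + 1) ∈ cyc (np '' N) ξ :=
        Submodule.sub_mem _ (mem_cyc (Submonoid.subset_closure ⟨_, (hE _ (by omega)).1, rfl⟩))
          (mem_cyc (Submonoid.subset_closure ⟨_, (hE _ (by omega)).1, rfl⟩))
      rw [smul_apply, rankOne_apply, hx _ hm]; simp
    · intro F hF
      have := shf_err hc hu (w := np F ξ) (m := ‖np F ξ‖ ^ 2) rfl (by
        rw [hcn]; exact pow_le_pow_left₀ (norm_nonneg _) ((np_proj F).norm_le ξ) 2) (fun i hi => by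
          rw [np_gram hN (hE i hi).1 hF, (hE i hi).2])
      refine this.trans (le_of_eq ?_)
      rw [hcdef]; field_simp
  refine mem_of_approx hV ‖T‖ (cycTest_total (np '' N) ξ) (B := Set.univ) (by
    rw [Submodule.span_univ]; exact top_le_iff.1 (Submodule.le_topologicalClosure _)) ?_
  intro s hs t ht ε hε
  obtain ⟨δ, hδ, hδ'⟩ := exists_delta (M := ∑ y ∈ t, ‖y‖ * ‖T‖) (Finset.sum_nonneg fun i _ => by positivity) hε
  obtain ⟨n, hn⟩ := exists_nat_gt (2 * ‖ξ‖ ^ 2 / δ)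
  obtain ⟨A, hA1, hA2, hA3, hA4⟩ := approx n
  refine ⟨T ∘L A, hA2, (ContinuousLinearMap.opNorm_comp_le _ _).trans (by nlinarith [norm_nonneg T]), ?_⟩
  intro x hx y hy
  have hb : ‖A x - pc (np '' N) ξ x‖ ≤ Real.sqrt δ := by
    rcases hs hx with ⟨W, hW, rfl⟩ | hx
    · rw [pc_of_mem (mem_cyc hW)]
      obtain ⟨E, hE, rfl⟩ := words hN hW
      refine Real.le_sqrt_of_sq_le ((hA4 E hE).trans ?_)
      rw [div_lt_iff₀ hδ] at hn
      rw [div_le_iff₀ (by positivity)]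
      nlinarith
    · rw [hA3 x hx, pc_of_orth hx]; simp
  rw [← inner_sub_right]
  show ‖⟪y, T (A x) - T (pc (np '' N) ξ x)⟫‖ ≤ ε
  rw [← map_sub]
  refine (norm_inner_le_norm _ _).trans ?_
  have h1 : ‖T (A x - pc (np '' N) ξ x)‖ ≤ ‖T‖ * Real.sqrt δ := (T.le_opNorm _).trans (mul_le_mul_of_nonneg_left hb (norm_nonneg _))
  have h2 := Finset.single_le_sum (f := fun y : K => ‖y‖ * ‖T‖) (fun i _ => by positivity) hy
  calc ‖y‖ * ‖T (A x - pc (np '' N) ξ x)‖ ≤ ‖y‖ * (‖T‖ * Real.sqrt δ) := mul_le_mul_of_nonneg_left h1 (norm_nonneg _)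
    _ = Real.sqrt δ * (‖y‖ * ‖T‖) := by ring
    _ ≤ Real.sqrt δ * ∑ y ∈ t, ‖y‖ * ‖T‖ := mul_le_mul_of_nonneg_left h2 (Real.sqrt_nonneg _)
    _ ≤ ε := hδ'

include hN hV hVA in
lemma reflexive {T : H →L[ℂ] K} (hT : ∀ E ∈ N, ∀ x ∈ E, T x ∈ theta V E) : T ∈ V := by
  classical
  let At : Set H := {x | ∃ L R, Adj N L R ∧ x ∈ R ∧ x ∈ Lᗮ}
  let A : Set H := At ∪ ((Submodule.span ℂ At)ᗮ : Submodule ℂ H)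
  have hA : (Submodule.span ℂ A).topologicalClosure = ⊤ := by
    rw [eq_top_iff]
    have h1 : (Submodule.span ℂ At).topologicalClosure ≤ (Submodule.span ℂ A).topologicalClosure :=
      Submodule.topologicalClosure_mono (Submodule.span_mono subset_union_left)
    have h2 : ((Submodule.span ℂ At).topologicalClosure)ᗮ ≤ (Submodule.span ℂ A).topologicalClosure := by
      rw [Submodule.orthogonal_closure]
      exact fun x hx => Submodule.le_topologicalClosure _ (Submodule.subset_span (Or.inr hx))
    rw [← Submodule.sup_orthogonal_of_hasOrthogonalProjection (K := (Submodule.span ℂ At).topologicalClosure)]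
    exact sup_le h1 h2
  have hpc : ∀ T : H →L[ℂ] K, (∀ E ∈ N, ∀ x ∈ E, T x ∈ theta V E) → ∀ ξ ∈ A, T ∘L pc (np '' N) ξ ∈ V := by
    rintro T hT ξ (⟨L, R, h, h1, h2⟩ | h)
    · exact atom_case hN hV hVA h (hT R h.2.1) h1 h2
    · refine cont_case hN hV hVA hT fun L R hLR => ?_
      have hL := hN.1 _ hLR.1
      have hR := hN.1 _ hLR.2.1
      have hm : np R ξ - np L ξ ∈ At := ⟨L, R, hLR, Submodule.sub_mem _ (np_mem hR _) (hLR.2.2.1 (np_mem hL _)), np_diff_orth hL hLR.2.2.1 ξ⟩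
      have h0 := h _ (Submodule.subset_span hm)
      rw [inner_sub_left, np_inner_self, np_inner_self, ← Complex.ofReal_sub, ← np_diff_norm hL hLR.2.2.1] at h0
      have h0' : ‖np R ξ - np L ξ‖ ^ 2 = 0 := by exact_mod_cast h0
      exact sub_eq_zero.1 (norm_eq_zero.1 (pow_eq_zero_iff (two_ne_zero) |>.1 h0'))
  refine mem_of_approx hV (2 * ‖T‖) hA (B := Set.univ) (by
    rw [Submodule.span_univ]; exact top_le_iff.1 (Submodule.le_topologicalClosure _)) ?_
  intro s hs t ht ε hε
  let S : H → H →L[ℂ] H := fun i => pc (np '' N) i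
  have hSp : ∀ i, IsProj (S i) := fun i => pc_proj _ _
  obtain ⟨δ, hδ, hδ'⟩ := exists_delta (M := ∑ i ∈ s ×ˢ t, ‖T‖ * ‖i.1‖ * ‖i.2‖) (Finset.sum_nonneg fun i _ => by positivity) hε
  obtain ⟨R, hR1, hR2, -, hR3, hR4, hR5⟩ := ctrick s S hδ
  set c := ∑ j ∈ s, S j ∘L adjoint (S j) with hcdef
  have hc2 : c = ∑ j ∈ s, S j := Finset.sum_congr rfl fun i _ => by rw [(hSp i).adj, (hSp i).1]
  have hRF : ∀ E ∈ N, np E ∘L R = R ∘L np E := by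
    intro E hE
    refine hR2 _ ?_
    rw [hc2, ContinuousLinearMap.comp_finsetSum, ContinuousLinearMap.finsetSum_comp]
    refine Finset.sum_congr rfl fun i _ => ?_
    exact pc_comm (by rintro _ ⟨q, hq, rfl⟩; exact (np_proj q).adj) _ ⟨E, hE, rfl⟩
  have hTR : ∀ E ∈ N, ∀ x ∈ E, (T ∘L R) x ∈ theta V E := by
    intro E hE x hx
    refine hT E hE _ ?_
    have := congrArg (fun A : H →L[ℂ] H => A x) (hRF E hE)
    simp only [ContinuousLinearMap.comp_apply] at this
    rw [np_of_mem hx] at this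
    show R x ∈ E
    rw [← this]; exact np_mem (hN.1 E hE) _
  have herr : T ∘L (R ∘L c) = T - T ∘L ((δ : ℂ) • R) := by
    rw [← hR3, ContinuousLinearMap.comp_sub]
    have : T ∘L (1 : H →L[ℂ] H) = T := ContinuousLinearMap.comp_id _
    rw [this]; abel
  refine ⟨T ∘L (R ∘L c), ?_, ?_, ?_⟩
  · rw [hc2, ← ContinuousLinearMap.comp_assoc, ContinuousLinearMap.comp_finsetSum]
    exact Submodule.sum_mem _ fun i hi => hpc _ hTR i (hs hi)
  · rw [herr]
    refine (norm_sub_le _ _).trans ?_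
    have h1 := (ContinuousLinearMap.opNorm_comp_le T ((δ : ℂ) • R))
    nlinarith [norm_nonneg T]
  · intro w hw v hv
    rw [herr, sub_apply, inner_sub_right, sub_sub_cancel_left, norm_neg]
    have e : ‖((δ : ℂ) • R) w‖ ≤ Real.sqrt δ * ‖w‖ := by
      have := hR5 w hw w
      rwa [show S w w = w from pc_self _ _] at this
    refine (norm_inner_le_norm _ _).trans ?_
    have hm : (w, v) ∈ s ×ˢ t := Finset.mem_product.2 ⟨hw, hv⟩
    refine (mul_le_mul_of_nonneg_left ((T.le_opNorm _).trans (mul_le_mul_of_nonneg_left e (norm_nonneg _))) (norm_nonneg _)).trans ?_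
    refine le_trans ?_ hδ'
    have := Finset.single_le_sum (f := fun i : H × K => ‖T‖ * ‖i.1‖ * ‖i.2‖) (fun i _ => by positivity) hm
    calc _ = Real.sqrt δ * (‖T‖ * ‖w‖ * ‖v‖) := by ring
      _ ≤ _ := mul_le_mul_of_nonneg_left this (Real.sqrt_nonneg _)
end RF
end OSP
end


noncomputable section
open scoped ComplexInnerProductSpace
open scoped InnerProduct
open Set OpSynth Filter Topology
open ContinuousLinearMap (adjoint)
set_option linter.unusedVariables false
set_option linter.unusedSectionVars false
namespace OSP

lemma masa_mem {H : Type*} [NormedAddCommGroup H] [InnerProductSpace ℂ H] [CompleteSpace H]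
    {D : StarSubalgebra ℂ (H →L[ℂ] H)} (hD : IsMasa D) {a : H →L[ℂ] H} (ha : IsSelfAdjoint a)
    (hc : ∀ b ∈ D, a * b = b * a) : a ∈ D := by
  have hcomm : ∀ x ∈ (D : Set (H →L[ℂ] H)) ∪ {a}, ∀ y ∈ (D : Set (H →L[ℂ] H)) ∪ {a}, x * y = y * x := by
    rintro x (hx | rfl) y (hy | rfl)
    · exact hD.1 x hx y hy
    · exact (hc x hx).symm
    · exact hc y hy
    · rfl
  have hst : ∀ y ∈ (D : Set (H →L[ℂ] H)) ∪ {a}, star y ∈ (D : Set (H →L[ℂ] H)) ∪ {a} := by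
    rintro y (hy | rfl)
    · exact Or.inl (star_mem (S := StarSubalgebra ℂ (H →L[ℂ] H)) hy)
    · right; exact ha
  have h1 := StarAlgebra.isMulCommutative_adjoin ℂ hcomm (fun x hx y hy => hcomm x hx _ (hst y hy))
  have h2 := hD.2 (StarAlgebra.adjoin ℂ ((D : Set (H →L[ℂ] H)) ∪ {a}))
    (fun x hx y hy => congrArg Subtype.val (h1.is_comm.comm ⟨x, hx⟩ ⟨y, hy⟩))
    (fun x hx => StarAlgebra.subset_adjoin ℂ _ (Or.inl hx))
  rw [← h2]
  exact StarAlgebra.subset_adjoin ℂ _ (Or.inr rfl)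

lemma np_comm {H : Type*} [NormedAddCommGroup H] [InnerProductSpace ℂ H] [CompleteSpace H]
    {E : Submodule ℂ H} (hE : IsClosed (E : Set H)) {A : H →L[ℂ] H}
    (h1 : ∀ x ∈ E, A x ∈ E) (h2 : ∀ x ∈ E, adjoint A x ∈ E) : np E * A = A * np E := by
  ext x
  show np E (A x) = A (np E x)
  have e : A x = A (np E x) + A (x - np E x) := by rw [← map_add]; congr 1; abel
  rw [e, map_add, np_of_mem (h1 _ (np_mem hE x)), np_of_orth (x := A (x - np E x)) ?_, add_zero]
  intro y hy
  rw [← ContinuousLinearMap.adjoint_inner_left]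
  exact np_orth x _ (h2 y hy)

lemma np_masa {H : Type*} [NormedAddCommGroup H] [InnerProductSpace ℂ H] [CompleteSpace H]
    {D : StarSubalgebra ℂ (H →L[ℂ] H)} (hD : IsMasa D) {E : Submodule ℂ H} (hE : IsClosed (E : Set H))
    (h : ∀ A ∈ D, ∀ x ∈ E, A x ∈ E) : np E ∈ D :=
  masa_mem hD (np_proj E).2 fun A hA => np_comm hE (h A hA) (h _ (star_mem hA))

section Str
variable {H₁ H₂ K₁ K₂ T₁ T₂ : Type*}
    [NormedAddCommGroup H₁] [InnerProductSpace ℂ H₁] [CompleteSpace H₁]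
    [NormedAddCommGroup H₂] [InnerProductSpace ℂ H₂] [CompleteSpace H₂]
    [NormedAddCommGroup K₁] [InnerProductSpace ℂ K₁] [CompleteSpace K₁]
    [NormedAddCommGroup K₂] [InnerProductSpace ℂ K₂] [CompleteSpace K₂]
    [NormedAddCommGroup T₁] [InnerProductSpace ℂ T₁] [CompleteSpace T₁]
    [NormedAddCommGroup T₂] [InnerProductSpace ℂ T₂] [CompleteSpace T₂]

lemma theta_closed (M : Submodule ℂ (H₁ →L[ℂ] H₂)) (E : Submodule ℂ H₁) :
    IsClosed (theta M E : Set H₂) := Submodule.isClosed_topologicalClosure _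

lemma mem_theta {M : Submodule ℂ (H₁ →L[ℂ] H₂)} {E : Submodule ℂ H₁} {S : H₁ →L[ℂ] H₂} (hS : S ∈ M)
    {x : H₁} (hx : x ∈ E) : S x ∈ theta M E :=
  Submodule.le_topologicalClosure _ (Submodule.subset_span ⟨S, hS, x, hx, rfl⟩)

lemma theta_le {M : Submodule ℂ (H₁ →L[ℂ] H₂)} {E : Submodule ℂ H₁} {F : Submodule ℂ H₂}
    (hF : IsClosed (F : Set H₂)) (h : ∀ S ∈ M, ∀ x ∈ E, S x ∈ F) : theta M E ≤ F := by
  refine Submodule.topologicalClosure_minimal _ (Submodule.span_le.2 ?_) hF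
  rintro _ ⟨S, hS, x, hx, rfl⟩
  exact h S hS x hx

/-- saturation -/
def sat (M : Submodule ℂ (H₁ →L[ℂ] H₂)) (E : Submodule ℂ H₁) : Submodule ℂ H₁ where
  carrier := {x | ∀ T ∈ M, T x ∈ theta M E}
  zero_mem' := fun T _ => by rw [map_zero]; exact zero_mem _
  add_mem' := fun hx hy T hT => by rw [map_add]; exact add_mem (hx T hT) (hy T hT)
  smul_mem' := fun c x hx T hT => by rw [map_smul]; exact Submodule.smul_mem _ _ (hx T hT)

lemma sat_closed (M : Submodule ℂ (H₁ →L[ℂ] H₂)) (E : Submodule ℂ H₁) : IsClosed (sat M E : Set H₁) := by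
  have : (sat M E : Set H₁) = ⋂ T ∈ M, T ⁻¹' (theta M E : Set H₂) := by
    ext x; simp only [mem_iInter, mem_preimage]; rfl
  rw [this]
  exact isClosed_biInter fun T _ => (theta_closed M E).preimage T.continuous

lemma le_sat (M : Submodule ℂ (H₁ →L[ℂ] H₂)) (E : Submodule ℂ H₁) : E ≤ sat M E :=
  fun _ hx _ hT => mem_theta hT hx

lemma theta_mono (M : Submodule ℂ (H₁ →L[ℂ] H₂)) {E F : Submodule ℂ H₁} (h : E ≤ F) :
    theta M E ≤ theta M F :=
  theta_le (theta_closed _ _) fun _ hS _ hx => mem_theta hS (h hx)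

lemma sat_mono (M : Submodule ℂ (H₁ →L[ℂ] H₂)) {E F : Submodule ℂ H₁} (h : E ≤ F) :
    sat M E ≤ sat M F := fun _ hx T hT => theta_mono M h (hx T hT)

variable {D₁ : StarSubalgebra ℂ (H₁ →L[ℂ] H₁)} {D₂ : StarSubalgebra ℂ (H₂ →L[ℂ] H₂)}

lemma structure_thm (hD₁ : IsMasa D₁) (hD₂ : IsMasa D₂) {V : Set (H₁ →L[ℂ] H₂)}
    (hV : IsMasaBimodule D₁ D₂ V) (hVn : IsNestBimodule V) :
    ∃ P, Ok D₁ D₂ P ∧ Chn P ∧ V = VP P := by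
  obtain ⟨⟨⟨M, rfl⟩, hcl⟩, hbi⟩ := hV
  obtain ⟨-, N, N₂, hN, -, hnb⟩ := hVn
  have hVA : ∀ X ∈ M, ∀ A ∈ nestAlg N, X ∘L A ∈ M := fun X hX A hA =>
    hnb X hX A hA 1 (fun p _ x hx => hx)
  have hr : ∀ X ∈ M, ∀ A ∈ D₁, X ∘L A ∈ M := fun X hX A hA => hbi X hX A hA 1 (one_mem _)
  have hl : ∀ X ∈ M, ∀ B ∈ D₂, B ∘L X ∈ M := fun X hX B hB => hbi X hX 1 (one_mem _) B hB
  refine ⟨(fun E => (np (sat M E), np (theta M E))) '' N, ?_, ?_, ?_⟩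
  · rintro _ ⟨E, hE, rfl⟩
    refine ⟨np_proj _, np_proj _, ?_, ?_⟩
    · refine np_masa hD₁ (sat_closed M E) fun A hA x hx T hT => hx (T ∘L A) (hr T hT A hA)
    · refine np_masa hD₂ (theta_closed M E) fun B hB x hx => ?_
      have : theta M E ≤ (theta M E).comap (B : H₂ →ₗ[ℂ] H₂) := by
        refine theta_le ((theta_closed M E).preimage B.continuous) fun S hS x hx => ?_
        exact mem_theta (hl S hS B hB) hx
      exact this hx
  · rintro _ ⟨E, hE, rfl⟩ _ ⟨F, hF, rfl⟩
    rcases hN.2.1.total hE hF with h | h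
    · right; ext x; exact np_np (theta_closed _ _) (theta_mono M h) x
    · left; ext x; exact np_np (sat_closed _ _) (sat_mono M h) x
  · ext T
    constructor
    · rintro hT _ ⟨E, hE, rfl⟩
      ext x
      show T (np (sat M E) x) - np (theta M E) (T (np (sat M E) x)) = 0
      rw [np_of_mem (np_mem (sat_closed M E) x T hT), sub_self]
    · intro hT
      refine reflexive hN hcl hVA fun E hE x hx => ?_
      have := congrArg (fun S : H₁ →L[ℂ] H₂ => S x) (hT _ ⟨E, hE, rfl⟩)
      have h2 : T (np (sat M E) x) - np (theta M E) (T (np (sat M E) x)) = 0 := this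
      rw [np_of_mem (le_sat M E hx), sub_eq_zero] at h2
      rw [h2]; exact np_mem (theta_closed M E) _

variable {t₁ : H₁ → K₁ → T₁} {t₂ : H₂ → K₂ → T₂}

lemma sum_eq (ht₁ : IsTensorEmbedding t₁) (ht₂ : IsTensorEmbedding t₂) {r : ℕ} (B : Fin r → Set (H₁ →L[ℂ] H₂)) (U : Fin r → Set (K₁ →L[ℂ] K₂)) :
    wkClosure (setSum fun i => wTensor t₁ t₂ (B i) (U i)) = (cspan (GG ht₁ ht₂ B U) : Set (T₁ →L[ℂ] T₂)) := by
  have hw : ∀ i, wTensor t₁ t₂ (B i) (U i) =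
      (cspan {W : T₁ →L[ℂ] T₂ | ∃ S ∈ B i, ∃ R ∈ U i, IsElemTensor t₁ t₂ W S R} : Set (T₁ →L[ℂ] T₂)) := fun i => rfl
  apply Subset.antisymm
  · refine wkClosure_min ?_ (cspan_closed _)
    rintro _ ⟨f, hf, rfl⟩
    refine Submodule.sum_mem _ fun i _ => ?_
    have h : f i ∈ wTensor t₁ t₂ (B i) (U i) := hf i
    rw [hw] at h
    refine cspan_mono ?_ h
    rintro W ⟨S, hS, R, hR, hW⟩
    exact ⟨i, S, hS, R, hR, (elem_iff ht₁ ht₂).1 hW⟩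
  · refine wkClosure_mono (S := (Submodule.span ℂ (GG ht₁ ht₂ B U) : Set (T₁ →L[ℂ] T₂))) ?_
    intro X hX
    simp only [hw]
    refine Submodule.span_induction (p := fun X _ => X ∈ setSum fun i => (cspan {W : T₁ →L[ℂ] T₂ | ∃ S ∈ B i, ∃ R ∈ U i, IsElemTensor t₁ t₂ W S R} : Set (T₁ →L[ℂ] T₂))) ?_ ?_ ?_ ?_ hX
    · rintro W ⟨i, S, hS, R, hR, hW⟩
      refine ⟨Pi.single i W, fun k => ?_, ?_⟩
      · by_cases hk : k = i
        · subst hk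
          rw [Pi.single_eq_same]
          exact subset_cspan _ ⟨S, hS, R, hR, (elem_iff ht₁ ht₂).2 hW⟩
        · rw [Pi.single_eq_of_ne hk]; exact zero_mem _
      · rw [Finset.sum_pi_single']; simp
    · exact ⟨fun _ => 0, fun i => zero_mem _, by simp⟩
    · rintro x y _ _ ⟨f, hf, rfl⟩ ⟨g, hg, rfl⟩
      exact ⟨fun i => f i + g i, fun i => add_mem (hf i) (hg i), Finset.sum_add_distrib.symm⟩
    · rintro c x _ ⟨f, hf, rfl⟩
      exact ⟨fun i => c • f i, fun i => Submodule.smul_mem _ c (hf i), Finset.smul_sum⟩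

lemma GG_mono (ht₁ : IsTensorEmbedding t₁) (ht₂ : IsTensorEmbedding t₂) {ι : Type*} {B B' : ι → Set (H₁ →L[ℂ] H₂)} (U : ι → Set (K₁ →L[ℂ] K₂)) (h : ∀ i, B i ⊆ B' i) :
    GG ht₁ ht₂ B U ⊆ GG ht₁ ht₂ B' U := by
  rintro _ ⟨i, S, hS, R, hR, rfl⟩
  exact ⟨i, S, h i hS, R, hR, rfl⟩

lemma final (ht₁ : IsTensorEmbedding t₁) (ht₂ : IsTensorEmbedding t₂) [TopologicalSpace.SeparableSpace H₁] (hD₁ : IsMasa D₁) (hD₂ : IsMasa D₂)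
    {r : ℕ} (l : Fin r → ℕ) (hl : ∀ i, 0 < l i)
    (B : (i : Fin r) → Fin (l i) → Set (H₁ →L[ℂ] H₂))
    (hB : ∀ i j, HasFiniteWidth D₁ D₂ (B i j))
    (Us : Fin r → Set (K₁ →L[ℂ] K₂)) :
    (⋂ j : (i : Fin r) → Fin (l i),
        wkClosure (setSum fun i => wTensor t₁ t₂ (B i (j i)) (Us i))) =
      wkClosure (setSum fun i =>
        wTensor t₁ t₂ (⋂ j : Fin (l i), B i j) (Us i)) := by
  simp only [sum_eq ht₁ ht₂]
  apply Subset.antisymm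
  swap
  · refine subset_iInter fun j => cspan_mono (GG_mono ht₁ ht₂ Us fun i => iInter_subset _ _)
  choose k Vs hVs hBV using hB
  choose P hOk hChn hVP using fun i j m => structure_thm hD₁ hD₂ (hVs i j m).1 (hVs i j m).2
  let J : Fin r → Type := fun i => Σ j : Fin (l i), Option (Fin (k i j))
  haveI : ∀ i, Nonempty (J i) := fun i => ⟨⟨⟨0, hl i⟩, none⟩⟩
  haveI : ∀ i, Fintype (J i) := fun i => inferInstanceAs (Fintype (Σ j : Fin (l i), Option (Fin (k i j))))
  let Pf : (Σ i, J i) → Set ((H₁ →L[ℂ] H₁) × (H₂ →L[ℂ] H₂)) := fun a =>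
    Option.elim a.2.2 ∅ (fun m => P a.1 a.2.1 m)
  have hsub : ∀ i (j : J i), B i j.1 ⊆ VP (Pf ⟨i, j⟩) := by
    rintro i ⟨j, _ | m⟩ T hT
    · exact fun p hp => hp.elim
    · have : T ∈ ⋂ j', Vs i j j' := hBV i j ▸ hT
      have := mem_iInter.1 this m
      rw [hVP] at this
      exact this
  intro X hX
  rw [mem_iInter] at hX
  have key : X ∈ RH ht₁ ht₂ Pf Us := by
    refine main_ind ht₁ ht₂ hD₁.1 hD₂.1 Finset.univ Pf Us ∅ ?_ ?_ ?_ ?_ X ?_ ?_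
    · rintro ⟨i, j, _ | m⟩
      · exact fun p hp => hp.elim
      · exact hOk i j m
    · rintro ⟨i, j, _ | m⟩
      · exact fun p hp => hp.elim
      · exact hChn i j m
    · exact fun p hp => hp.elim
    · exact fun a ha => (ha (Finset.mem_univ _)).elim
    · rw [LH, Submodule.mem_iInf]
      intro j
      exact cspan_mono (GG_mono ht₁ ht₂ Us fun i => hsub i (j i)) (hX fun i => (j i).1)
    · exact fun p hp => hp.elim
  refine cspan_mono (GG_mono ht₁ ht₂ Us fun i => ?_) key
  intro T hT
  rw [mem_iInter] at hT ⊢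
  intro j
  rw [hBV, mem_iInter]
  intro m
  rw [hVP]
  exact hT ⟨j, some m⟩

end Str
end OSP
end

open scoped ComplexInnerProductSpace Pointwise
open Set OpSynth

/-- Corollary `epsilona`. -/
theorem statement11
    {H₁ H₂ K₁ K₂ T₁ T₂ : Type*}
    [NormedAddCommGroup H₁] [InnerProductSpace ℂ H₁] [CompleteSpace H₁]
    [NormedAddCommGroup H₂] [InnerProductSpace ℂ H₂] [CompleteSpace H₂]
    [NormedAddCommGroup K₁] [InnerProductSpace ℂ K₁] [CompleteSpace K₁]
    [NormedAddCommGroup K₂] [InnerProductSpace ℂ K₂] [CompleteSpace K₂]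
    [NormedAddCommGroup T₁] [InnerProductSpace ℂ T₁] [CompleteSpace T₁]
    [NormedAddCommGroup T₂] [InnerProductSpace ℂ T₂] [CompleteSpace T₂]
    [TopologicalSpace.SeparableSpace H₁] [TopologicalSpace.SeparableSpace H₂]
    (D₁ : StarSubalgebra ℂ (H₁ →L[ℂ] H₁)) (D₂ : StarSubalgebra ℂ (H₂ →L[ℂ] H₂))
    (hD₁ : IsMasa D₁) (hD₂ : IsMasa D₂)
    {r : ℕ} (l : Fin r → ℕ) (hl : ∀ i, 0 < l i)
    (B : (i : Fin r) → Fin (l i) → Set (H₁ →L[ℂ] H₂))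
    (hB : ∀ i j, HasFiniteWidth D₁ D₂ (B i j))
    (Us : Fin r → Set (K₁ →L[ℂ] K₂))
    (hUs : ∀ i, IsWkClosedSubspace (Us i))
    (t₁ : H₁ → K₁ → T₁) (t₂ : H₂ → K₂ → T₂)
    (ht₁ : IsTensorEmbedding t₁) (ht₂ : IsTensorEmbedding t₂) :
    (⋂ j : (i : Fin r) → Fin (l i),
        wkClosure (setSum fun i => wTensor t₁ t₂ (B i (j i)) (Us i))) =
      wkClosure (setSum fun i =>
        wTensor t₁ t₂ (⋂ j : Fin (l i), B i j) (Us i)) := by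
  exact OSP.final ht₁ ht₂ hD₁ hD₂ l hl B hB Us
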